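/- For a prime N ≡ 1 (mod 3), write L_N = Q(ζ_3, N^{1/3}). As x → ∞, the ratio #{N ≤ x : N prime, N ≡ 4 or 7 (mod 9), rk_3(Cl(L_N)) = 2} / #{N ≤ x : N prime, N ≡ 4 or 7 (mod 9)} tends to 1/3; equivalently, the ratio with the condition rk_3(Cl(L_N)) = 1 in the numerator tends to 2/3. -/

import Mathlib

open NumberField Polynomial Filter

/-- The `p`-rank of a finite abelian group `G`: the `𝔽_p`-dimension of `G ⊗ 𝔽_p`,
equivalently of `G[p]`. -/
noncomputable def pRank (p : ℕ) (G : Type*) [Group G] : ℕ :=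
  (Nat.card {g : G // g ^ p = 1}).factorization p

/-- `L_N = ℚ(ζ_3, N^{1/3})`, realised as the splitting field of `X³ - N` over `ℚ`. -/
noncomputable def Lfield (N : ℕ) : Type := ((X : ℚ[X]) ^ 3 - C (N : ℚ)).SplittingField

noncomputable instance (N : ℕ) : Field (Lfield N) :=
  inferInstanceAs (Field (Polynomial.SplittingField _))

noncomputable instance (N : ℕ) : Algebra ℚ (Lfield N) :=
  inferInstanceAs (Algebra ℚ (Polynomial.SplittingField _))

instance (N : ℕ) : CharZero (Lfield N) :=
  inferInstanceAs (CharZero (Polynomial.SplittingField _))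

instance (N : ℕ) : FiniteDimensional ℚ (Lfield N) :=
  inferInstanceAs (FiniteDimensional ℚ (Polynomial.SplittingField _))

instance (N : ℕ) : NumberField (Lfield N) := ⟨⟩

/-- The 3-rank of the class group of `L_N = ℚ(ζ_3, N^{1/3})`. -/
noncomputable def rk3 (N : ℕ) : ℕ := pRank 3 (ClassGroup (𝓞 (Lfield N)))

set_option linter.unusedSectionVars false

section
namespace S11
section Tauber
open MeasureTheory Filter Topology Set

/-- Fejér kernel. -/
noncomputable def fej (x : ℝ) : ℝ := 2 * (1 - Real.cos x) / x ^ 2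

lemma fej_nonneg (x : ℝ) : 0 ≤ fej x := by
  have := Real.cos_le_one x
  unfold fej; apply div_nonneg <;> nlinarith [sq_nonneg x]

lemma fej_le (x : ℝ) : fej x ≤ 5 * (1 + x ^ 2)⁻¹ := by
  unfold fej
  rcases eq_or_ne x 0 with rfl | hx
  · simp
  have h1 := Real.one_sub_sq_div_two_le_cos (x := x)
  have h2 := Real.neg_one_le_cos x
  have h3 : 0 < x ^ 2 := by positivity
  rw [← div_eq_mul_inv, div_le_div_iff₀ h3 (by positivity)]
  nlinarith

lemma fej_meas : Measurable fej := by unfold fej; fun_prop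

lemma fej_integrable : Integrable fej := by
  refine (integrable_inv_one_add_sq.const_mul 5).mono' fej_meas.aestronglyMeasurable ?_
  filter_upwards with x
  rw [Real.norm_of_nonneg (fej_nonneg x)]
  exact fej_le x

noncomputable def fejM : ℝ := ∫ x, fej x

lemma fejM_pos : 0 < fejM := by
  unfold fejM
  rw [integral_pos_iff_support_of_nonneg fej_nonneg fej_integrable]
  refine lt_of_lt_of_le ?_ (measure_mono (s := Ioo 0 1) ?_)
  · simp
  · intro x hx
    have h1 : Real.cos x < 1 := by
      have h0 := Real.cos_lt_cos_of_nonneg_of_le_pi_div_two (x := 0) (y := x) le_rfl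
        (by linarith [hx.2, Real.pi_gt_three]) hx.1
      simpa using h0
    have : 0 < fej x := by
      unfold fej
      have := hx.1
      have : 0 < 1 - Real.cos x := by linarith
      positivity
    exact this.ne'

/-- scaled kernel -/
noncomputable def fejR (R x : ℝ) : ℝ := R * fej (R * x)

lemma fejR_nonneg {R : ℝ} (hR : 0 < R) (x : ℝ) : 0 ≤ fejR R x :=
  mul_nonneg hR.le (fej_nonneg _)

lemma fejR_neg (R x : ℝ) : fejR R (-x) = fejR R x := by
  unfold fejR fej; simp

lemma fejR_integrable {R : ℝ} (hR : 0 < R) : Integrable (fejR R) :=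
  (fej_integrable.comp_mul_left' hR.ne').const_mul R

lemma fejR_integral {R : ℝ} (hR : 0 < R) : ∫ x, fejR R x = fejM := by
  unfold fejR fejM
  rw [integral_const_mul, Measure.integral_comp_mul_left, abs_of_pos (by positivity)]
  simp [hR.ne']

/-- mass of central part -/
lemma fejR_integral_mid {R d : ℝ} (hR : 0 < R) :
    ∫ x in (-d)..d, fejR R x = ∫ x in (-(R * d))..(R * d), fej x := by
  unfold fejR
  rw [intervalIntegral.integral_const_mul, intervalIntegral.integral_comp_mul_left _ hR.ne']
  simp [hR.ne']

lemma fej_mid_tendsto : Tendsto (fun T : ℝ => ∫ x in (-T)..T, fej x) atTop (𝓝 fejM) :=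
  intervalIntegral_tendsto_integral fej_integrable tendsto_neg_atTop_atBot tendsto_id

lemma fejR_eq {R x : ℝ} (hR : 0 < R) (hx : x ≠ 0) :
    fejR R x = 2 * ∫ t in (0:ℝ)..R, (1 - t / R) * Real.cos (t * x) := by
  have hd : ∀ t ∈ uIcc 0 R, HasDerivAt
      (fun t => (1 - t / R) * Real.sin (t * x) / x - Real.cos (t * x) / (R * x ^ 2))
      ((1 - t / R) * Real.cos (t * x)) t := by
    intro t _
    have h1 : HasDerivAt (fun t : ℝ => t * x) x t := by simpa using (hasDerivAt_id t).mul_const x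
    have h2 : HasDerivAt (fun t : ℝ => 1 - t / R) (-(1 / R)) t := by
      simpa using ((hasDerivAt_id t).div_const R).const_sub 1
    have h3 := ((h2.mul h1.sin).div_const x).sub (h1.cos.div_const (R * x ^ 2))
    refine HasDerivAt.congr_deriv h3 ?_
    field_simp
    ring
  rw [intervalIntegral.integral_eq_sub_of_hasDerivAt hd]
  · unfold fejR fej
    field_simp
    simp [mul_comm]
    ring
  · apply Continuous.intervalIntegrable
    fun_prop


lemma key_sigma {φ : ℝ → ℝ} (hm : Measurable φ) {C : ℝ} (hC : ∀ u, |φ u| ≤ C)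
    {h : ℂ → ℂ}
    (hh : ∀ z : ℂ, 0 < z.re → ∫ u in Ioi (0:ℝ), (φ u : ℂ) * Complex.exp (-z * u) = h z)
    {R : ℝ} (hR : 0 < R) (v : ℝ) {σ : ℝ} (hσ : 0 < σ) :
    ∫ u in Ioi (0:ℝ), φ u * Real.exp (-σ * u) * fejR R (v - u) =
      2 * ∫ t in (0:ℝ)..R, (1 - t / R) * (Complex.exp (t * v * Complex.I) * h (σ + t * Complex.I)).re := by
  have hexp : IntegrableOn (fun u : ℝ => Real.exp (-σ * u)) (Ioi 0) :=
    integrableOn_exp_mul_Ioi (by linarith) 0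
  have hinner : ∀ t : ℝ, (Complex.exp (t * v * Complex.I) * h (σ + t * Complex.I)).re =
      ∫ u in Ioi (0:ℝ), φ u * Real.exp (-σ * u) * Real.cos (t * (v - u)) := by
    intro t
    rw [← hh _ (by simpa using hσ), ← integral_const_mul]
    have : ∀ u : ℝ, φ u * Real.exp (-σ * u) * Real.cos (t * (v - u)) =
       RCLike.re (Complex.exp (t * v * Complex.I) * ((φ u : ℂ) * Complex.exp (-(σ + t * Complex.I) * u))) := by
      intro u
      have e1 : Complex.exp (t * v * Complex.I) * ((φ u : ℂ) * Complex.exp (-(σ + t * Complex.I) * u))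
        = ((φ u * Real.exp (-σ * u) : ℝ) : ℂ) * Complex.exp ((t * (v - u) : ℝ) * Complex.I) := by
        push_cast
        rw [mul_left_comm, ← Complex.exp_add, mul_assoc (φ u : ℂ), ← Complex.exp_add]
        congr 2
        ring
      rw [e1]
      change _ = Complex.re _
      rw [Complex.re_ofReal_mul, Complex.exp_ofReal_mul_I_re]
    simp_rw [this]
    rw [integral_re]
    · rfl
    · have hi : IntegrableOn (fun u : ℝ => C * Real.exp (-σ * u)) (Ioi 0) := hexp.const_mul C
      refine hi.mono' (by fun_prop) ?_
      filter_upwards with u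
      have n1 : ‖Complex.exp (t * v * Complex.I)‖ = 1 := by
        have := Complex.norm_exp_ofReal_mul_I (t * v)
        simpa using this
      have n2 : ‖Complex.exp (-(σ + t * Complex.I) * u)‖ = Real.exp (-σ * u) := by
        rw [Complex.norm_exp]; simp
      rw [norm_mul, norm_mul, n1, n2, one_mul, Complex.norm_real]
      exact mul_le_mul_of_nonneg_right (hC u) (Real.exp_pos _).le
  simp_rw [hinner, ← integral_const_mul]
  rw [← intervalIntegral.integral_const_mul]
  simp_rw [← integral_const_mul]
  rw [intervalIntegral.integral_of_le hR.le, integral_integral_swap]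
  · apply integral_congr_ae
    have : ∀ᵐ u ∂(volume.restrict (Ioi (0:ℝ))), u ≠ v := by
      apply ae_restrict_of_ae
      exact Measure.ae_ne volume v
    filter_upwards [this] with u hu
    rw [fejR_eq hR (sub_ne_zero.mpr hu.symm), ← intervalIntegral.integral_of_le hR.le,
      mul_left_comm, ← intervalIntegral.integral_const_mul, ← intervalIntegral.integral_const_mul]
    apply intervalIntegral.integral_congr
    intro t _
    simp only; ring
  · have hi : Integrable (fun p : ℝ × ℝ => (2 : ℝ) * (C * Real.exp (-σ * p.2)))
        ((volume.restrict (Ioc 0 R)).prod (volume.restrict (Ioi 0))) := by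
      have := Integrable.mul_prod (μ := volume.restrict (Ioc 0 R)) (ν := volume.restrict (Ioi 0))
        (f := fun _ : ℝ => (2:ℝ)) (g := fun u : ℝ => C * Real.exp (-σ * u))
        (integrable_const _) (hexp.const_mul C)
      exact this
    refine hi.mono' ?_ ?_
    · apply Measurable.aestronglyMeasurable
      unfold Function.uncurry
      fun_prop
    · rw [Measure.prod_restrict]
      refine (ae_restrict_iff' (by measurability)).mpr (Eventually.of_forall ?_)
      rintro ⟨t, u⟩ ⟨ht, hu⟩
      simp only [Function.uncurry]
      simp only [mem_Ioc] at ht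
      have h1 : |1 - t / R| ≤ 1 := by
        have : 0 ≤ t / R := by have := ht.1; positivity
        have : t / R ≤ 1 := by rw [div_le_one hR]; exact ht.2
        rw [abs_le]; constructor <;> linarith
      have h2 := Real.abs_cos_le_one (t * (v - u))
      rw [norm_mul, norm_mul, norm_mul, norm_mul, Real.norm_eq_abs, Real.norm_eq_abs, Real.norm_eq_abs,
        Real.norm_eq_abs, Real.norm_eq_abs, Real.abs_exp, abs_of_pos (by norm_num : (0:ℝ) < 2)]
      have h3 : |φ u| * Real.exp (-σ * u) ≤ C * Real.exp (-σ * u) :=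
        mul_le_mul_of_nonneg_right (hC u) (Real.exp_pos _).le
      have h4 : |φ u| * Real.exp (-σ * u) * |Real.cos (t * (v - u))| ≤ C * Real.exp (-σ * u) * 1 :=
        mul_le_mul h3 h2 (abs_nonneg _) (le_trans (by positivity) h3)
      have h5 : |1 - t / R| * (|φ u| * Real.exp (-σ * u) * |Real.cos (t * (v - u))|) ≤
          1 * (C * Real.exp (-σ * u) * 1) := mul_le_mul h1 h4 (by positivity) (by norm_num)
      linarith


lemma key_zero {φ : ℝ → ℝ} (hm : Measurable φ) {C : ℝ} (hC : ∀ u, |φ u| ≤ C)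
    {h : ℂ → ℂ} (hcont : ContinuousOn h {z | 0 ≤ z.re})
    (hh : ∀ z : ℂ, 0 < z.re → ∫ u in Ioi (0:ℝ), (φ u : ℂ) * Complex.exp (-z * u) = h z)
    {R : ℝ} (hR : 0 < R) (v : ℝ) :
    ∫ u in Ioi (0:ℝ), φ u * fejR R (v - u) =
      2 * ∫ t in (0:ℝ)..R, (1 - t / R) * (Complex.exp (t * v * Complex.I) * h (t * Complex.I)).re := by
  have hσ : Tendsto (fun n : ℕ => (1 / ((n : ℝ) + 1))) atTop (𝓝 0) :=
    tendsto_one_div_add_atTop_nhds_zero_nat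
  have hK : Integrable (fun u => fejR R (v - u)) := (fejR_integrable hR).comp_sub_left v
  have l1 : Tendsto (fun n : ℕ => ∫ u in Ioi (0:ℝ), φ u * Real.exp (-(1 / ((n : ℝ) + 1)) * u) * fejR R (v - u))
      atTop (𝓝 (∫ u in Ioi (0:ℝ), φ u * fejR R (v - u))) := by
    refine tendsto_integral_of_dominated_convergence (fun u => C * fejR R (v - u)) ?_ ?_ ?_ ?_
    · intro n
      have : Measurable (fejR R) := by unfold fejR; exact ((fej_meas.comp (by fun_prop)).const_mul R)
      apply Measurable.aestronglyMeasurable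
      fun_prop
    · exact (hK.const_mul C).integrableOn
    · intro n
      refine (ae_restrict_iff' measurableSet_Ioi).mpr (Eventually.of_forall ?_)
      intro u hu
      have hu : 0 < u := hu
      rw [norm_mul, norm_mul, Real.norm_eq_abs, Real.norm_eq_abs, Real.norm_eq_abs, Real.abs_exp,
        abs_of_nonneg (fejR_nonneg hR _)]
      refine mul_le_mul_of_nonneg_right ?_ (fejR_nonneg hR _)
      have : Real.exp (-(1 / ((n : ℝ) + 1)) * u) ≤ 1 := by
        rw [Real.exp_le_one_iff]
        have : 0 < 1 / ((n : ℝ) + 1) := by positivity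
        nlinarith
      calc _ ≤ |φ u| * 1 := mul_le_mul_of_nonneg_left this (abs_nonneg _)
        _ ≤ C := by simpa using hC u
    · filter_upwards with u
      have : Tendsto (fun n : ℕ => φ u * Real.exp (-(1 / ((n : ℝ) + 1)) * u) * fejR R (v - u)) atTop
          (𝓝 (φ u * Real.exp (-0 * u) * fejR R (v - u))) := by
        refine Tendsto.mul_const _ (Tendsto.const_mul _ ?_)
        exact (Real.continuous_exp.tendsto _).comp (hσ.neg.mul_const u)
      simpa using this
  have l2 : Tendsto (fun n : ℕ => 2 * ∫ t in (0:ℝ)..R, (1 - t / R) *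
        (Complex.exp (t * v * Complex.I) * h ((1 / ((n : ℝ) + 1) : ℝ) + t * Complex.I)).re) atTop
      (𝓝 (2 * ∫ t in (0:ℝ)..R, (1 - t / R) * (Complex.exp (t * v * Complex.I) * h (t * Complex.I)).re)) := by
    refine Tendsto.const_mul _ ?_
    have hcomp : ContinuousOn (fun p : ℝ × ℝ => (1 - p.2 / R) *
        (Complex.exp (p.2 * v * Complex.I) * h (p.1 + p.2 * Complex.I)).re) (Icc 0 1 ×ˢ Icc 0 R) := by
      have h0 : ContinuousOn (fun p : ℝ × ℝ => h (p.1 + p.2 * Complex.I)) (Icc 0 1 ×ˢ Icc 0 R) := by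
        refine hcont.comp (by fun_prop) ?_
        rintro ⟨a, b⟩ ⟨ha, hb⟩
        simpa using ha.1
      refine ContinuousOn.mul (by fun_prop) (Complex.continuous_re.comp_continuousOn ?_)
      exact ContinuousOn.mul (by fun_prop) h0
    obtain ⟨D, hD⟩ := (isCompact_Icc.prod isCompact_Icc).exists_bound_of_continuousOn hcomp
    have hmem : ∀ n : ℕ, (1 / ((n : ℝ) + 1)) ∈ Icc (0:ℝ) 1 := fun n =>
      ⟨by positivity, by rw [div_le_one (by positivity)]; linarith [(Nat.cast_nonneg n : (0:ℝ) ≤ n)]⟩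
    refine intervalIntegral.tendsto_integral_filter_of_dominated_convergence (fun _ => D) ?_ ?_ ?_ ?_
    · filter_upwards with n
      rw [uIoc_of_le hR.le]
      have : ContinuousOn (fun t : ℝ => (1 - t / R) *
        (Complex.exp (t * v * Complex.I) * h ((1 / ((n : ℝ) + 1) : ℝ) + t * Complex.I)).re) (Icc 0 R) := by
        exact hcomp.comp (f := fun t : ℝ => ((1 / ((n : ℝ) + 1) : ℝ), t)) (by fun_prop) (fun t ht => ⟨hmem n, ht⟩)
      exact (this.mono Ioc_subset_Icc_self).aestronglyMeasurable measurableSet_Ioc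
    · filter_upwards with n
      filter_upwards with t ht
      rw [uIoc_of_le hR.le] at ht
      exact hD ((1 / ((n : ℝ) + 1) : ℝ), t) ⟨hmem n, Ioc_subset_Icc_self ht⟩
    · exact intervalIntegrable_const
    · filter_upwards with t ht
      rw [uIoc_of_le hR.le] at ht
      have hc := hcomp ((0:ℝ), t) ⟨by simp, Ioc_subset_Icc_self ht⟩
      have ht' : Tendsto (fun n : ℕ => ((1 / ((n : ℝ) + 1) : ℝ), t)) atTop
          (𝓝[Icc 0 1 ×ˢ Icc 0 R] ((0:ℝ), t)) := by
        refine tendsto_nhdsWithin_iff.mpr ⟨hσ.prodMk_nhds tendsto_const_nhds, ?_⟩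
        filter_upwards with n using ⟨hmem n, Ioc_subset_Icc_self ht⟩
      have := Tendsto.comp hc ht'
      simpa [Function.comp_def] using this
  refine tendsto_nhds_unique l1 (l2.congr fun n => ?_)
  exact (key_sigma hm hC hh hR v (by positivity)).symm

lemma key_limit {φ : ℝ → ℝ} (hm : Measurable φ) {C : ℝ} (hC : ∀ u, |φ u| ≤ C)
    {h : ℂ → ℂ} (hcont : ContinuousOn h {z | 0 ≤ z.re})
    (hh : ∀ z : ℂ, 0 < z.re → ∫ u in Ioi (0:ℝ), (φ u : ℂ) * Complex.exp (-z * u) = h z)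
    {R : ℝ} (hR : 0 < R) :
    Tendsto (fun v => ∫ u in Ioi (0:ℝ), φ u * fejR R (v - u)) atTop (𝓝 0) := by
  simp_rw [key_zero hm hC hcont hh hR]
  let g : ℝ → ℂ := (Ioc 0 R).indicator (fun t : ℝ => ((1 - t / R : ℝ) : ℂ) * h (t * Complex.I))
  have hrl := Real.tendsto_integral_exp_smul_cocompact g
  have hw : Tendsto (fun v : ℝ => -v / (2 * Real.pi)) atTop (cocompact ℝ) := by
    have : Tendsto (fun v : ℝ => -v / (2 * Real.pi)) atTop atBot := by
      refine Tendsto.atBot_div_const (by positivity) tendsto_neg_atTop_atBot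
    exact this.mono_right atBot_le_cocompact
  have h2 := (Complex.continuous_re.tendsto _).comp (hrl.comp hw)
  have h3 := h2.const_mul 2
  simp only [Complex.zero_re, mul_zero] at h3
  refine h3.congr fun v => ?_
  simp only [Function.comp]
  congr 1
  have e1 : ∀ t : ℝ, (Real.fourierChar (-(t * (-v / (2 * Real.pi)))) • g t) =
     (Ioc 0 R).indicator (fun t : ℝ => ((1 - t / R : ℝ) : ℂ) * (Complex.exp (t * v * Complex.I) * h (t * Complex.I))) t := by
    intro t
    by_cases ht : t ∈ Ioc 0 R
    · simp only [g, indicator_of_mem ht, Circle.smul_def, Real.fourierChar_apply, smul_eq_mul]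
      rw [mul_left_comm]
      congr 3
      have : (Real.pi : ℂ) ≠ 0 := by exact_mod_cast Real.pi_ne_zero
      push_cast
      field_simp
    · simp [g, indicator_of_notMem ht]
  simp_rw [e1]
  rw [integral_indicator measurableSet_Ioc, ← intervalIntegral.integral_of_le hR.le]
  have hint : IntervalIntegrable (fun t : ℝ => ((1 - t / R : ℝ) : ℂ) * (Complex.exp (t * v * Complex.I) * h (t * Complex.I))) volume 0 R := by
    apply ContinuousOn.intervalIntegrable
    rw [uIcc_of_le hR.le]
    have h0 : ContinuousOn (fun t : ℝ => h (t * Complex.I)) (Icc 0 R) :=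
      hcont.comp (by fun_prop) (fun t _ => by simp)
    exact ContinuousOn.mul (by fun_prop) (ContinuousOn.mul (by fun_prop) h0)
  have := Complex.reCLM.intervalIntegral_comp_comm hint
  simp only [Complex.reCLM_apply] at this
  rw [← this]
  apply intervalIntegral.integral_congr
  intro t _
  simp only [Complex.re_ofReal_mul]


lemma key_limit' {f : ℝ → ℝ} (hm : Measurable f) {B c : ℝ} (h0 : ∀ u, 0 ≤ f u) (hB : ∀ u, f u ≤ B)
    {h : ℂ → ℂ} (hcont : ContinuousOn h {z | 0 ≤ z.re})
    (hh : ∀ z : ℂ, 0 < z.re → ∫ u in Ioi (0:ℝ), ((f u - c : ℝ) : ℂ) * Complex.exp (-z * u) = h z)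
    {R : ℝ} (hR : 0 < R) :
    Tendsto (fun v => ∫ u in Ioi (0:ℝ), f u * fejR R (v - u)) atTop (𝓝 (c * fejM)) := by
  have hK : ∀ v, Integrable (fun u => fejR R (v - u)) := fun v => (fejR_integrable hR).comp_sub_left v
  have hmK : Measurable (fejR R) := by unfold fejR; exact ((fej_meas.comp (by fun_prop)).const_mul R)
  have h1 := key_limit (φ := fun u => f u - c) (by fun_prop) (C := B + |c|)
    (fun u => by
      have h1 := h0 u; have h2 := hB u
      have h3 := neg_abs_le c; have h4 := le_abs_self c
      rw [abs_le]; constructor <;> linarith) hcont hh hR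
  have h2 : Tendsto (fun v => ∫ u in Ioi (0:ℝ), fejR R (v - u)) atTop (𝓝 fejM) := by
    have e : ∀ v, ∫ u in Ioi (0:ℝ), fejR R (v - u) = ∫ u in Iio v, fejR R u := by
      intro v
      rw [← integral_indicator measurableSet_Ioi, ← integral_indicator measurableSet_Iio,
        ← integral_sub_left_eq_self ((Iio v).indicator (fejR R)) volume v]
      congr 1; ext u
      by_cases hu : 0 < u
      · rw [indicator_of_mem (mem_Ioi.mpr hu), indicator_of_mem (by simpa using hu)]
      · rw [indicator_of_notMem (by simpa using hu), indicator_of_notMem (by simpa using hu)]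
    simp_rw [e]
    rw [← fejR_integral hR]
    have := (aecover_Iio (μ := volume) (tendsto_id : Tendsto (fun v : ℝ => v) atTop atTop))
    exact this.integral_tendsto_of_countably_generated (fejR_integrable hR)
  have h3 := h1.add (h2.const_mul c)
  rw [zero_add] at h3
  refine h3.congr fun v => ?_
  rw [← integral_const_mul, ← integral_add]
  · congr 1; ext u; ring
  · refine ((hK v).const_mul (B + |c|)).integrableOn.mono' (by fun_prop) ?_
    filter_upwards with u
    rw [norm_mul, Real.norm_of_nonneg (fejR_nonneg hR _)]
    refine mul_le_mul_of_nonneg_right ?_ (fejR_nonneg hR _)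
    have h1 := h0 u; have h2 := hB u
    have h3 := neg_abs_le c; have h4 := le_abs_self c
    rw [Real.norm_eq_abs, abs_le]; constructor <;> linarith
  · exact ((hK v).const_mul c).integrableOn

lemma tauber {f : ℝ → ℝ} (hm : Measurable f) {B c : ℝ} (h0 : ∀ u, 0 ≤ f u) (hB : ∀ u, f u ≤ B)
    (hmono : ∀ u v, 0 < u → u ≤ v → f u * Real.exp u ≤ f v * Real.exp v)
    {h : ℂ → ℂ} (hcont : ContinuousOn h {z | 0 ≤ z.re})
    (hh : ∀ z : ℂ, 0 < z.re → ∫ u in Ioi (0:ℝ), ((f u - c : ℝ) : ℂ) * Complex.exp (-z * u) = h z) :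
    Tendsto f atTop (𝓝 c) := by
  have hMp := fejM_pos
  have hB0 : 0 ≤ B := (h0 0).trans (hB 0)
  -- the mass function
  set m : ℝ → ℝ := fun T => ∫ x in (-T)..T, fej x with hmdef
  have hmt : Tendsto m atTop (𝓝 fejM) := fej_mid_tendsto
  have hmK : ∀ R, Measurable (fejR R) := fun R => by unfold fejR; exact ((fej_meas.comp (by fun_prop)).const_mul R)
  have hfK : ∀ R > 0, ∀ v, Integrable (fun u => f u * fejR R (v - u)) := by
    intro R hR v
    refine (((fejR_integrable hR).comp_sub_left v).const_mul B).mono' (by have := hmK R; fun_prop) ?_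
    filter_upwards with u
    rw [norm_mul, Real.norm_of_nonneg (fejR_nonneg hR _), Real.norm_of_nonneg (h0 _)]
    exact mul_le_mul_of_nonneg_right (hB u) (fejR_nonneg hR _)
  have hmid : ∀ R > 0, ∀ d v : ℝ, ∫ u in (v - d)..(v + d), fejR R (v - u) = m (R * d) := by
    intro R hR d v
    rw [intervalIntegral.integral_comp_sub_left (fun x => fejR R x) v]
    simp only [sub_add_cancel_left, sub_sub_cancel]
    exact fejR_integral_mid hR
  -- upper
  have hup : ∀ R > 0, ∀ d > 0, ∀ᶠ v in atTop, f v * m (R * d) ≤ Real.exp (2 * d) * (c * fejM + d) := by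
    intro R hR d hd
    have hl := key_limit' hm h0 hB hcont hh hR
    have hl2 : ∀ᶠ v in atTop, ∫ u in Ioi (0:ℝ), f u * fejR R ((v + d) - u) < c * fejM + d :=
      (hl.comp (tendsto_atTop_add_const_right atTop d tendsto_id)).eventually_lt_const (by linarith)
    filter_upwards [hl2, eventually_gt_atTop 0] with v hv hv0
    have s1 : ∫ u in v..(v + 2 * d), f u * fejR R ((v + d) - u) ≤ ∫ u in Ioi (0:ℝ), f u * fejR R ((v + d) - u) := by
      rw [intervalIntegral.integral_of_le (by linarith)]
      apply setIntegral_mono_set (hfK R hR _).integrableOn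
      · filter_upwards with u using mul_nonneg (h0 _) (fejR_nonneg hR _)
      · exact LE.le.eventuallyLE (fun u hu => hv0.trans hu.1)
    have s2 : f v * Real.exp (-(2 * d)) * m (R * d) ≤ ∫ u in v..(v + 2 * d), f u * fejR R ((v + d) - u) := by
      rw [← hmid R hR d (v + d), ← intervalIntegral.integral_const_mul]
      have e1 : v + d - d = v := by ring
      have e2 : v + d + d = v + 2 * d := by ring
      rw [e1, e2]
      apply intervalIntegral.integral_mono_on (by linarith)
      · exact (((fejR_integrable hR).comp_sub_left _).const_mul _).intervalIntegrable
      · exact (hfK R hR _).intervalIntegrable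
      · intro u hu
        refine mul_le_mul_of_nonneg_right ?_ (fejR_nonneg hR _)
        have := hmono v u hv0 hu.1
        have e : f v * Real.exp (-(2 * d)) ≤ f v * Real.exp (v - u) :=
          mul_le_mul_of_nonneg_left (Real.exp_le_exp.mpr (by linarith [hu.2])) (h0 v)
        refine e.trans ?_
        rw [Real.exp_sub, mul_div_assoc', div_le_iff₀ (Real.exp_pos _)]
        exact this
    have s3 := (s2.trans s1).trans hv.le
    have e : f v * m (R * d) = Real.exp (2 * d) * (f v * Real.exp (-(2 * d)) * m (R * d)) := by
      rw [Real.exp_neg]; field_simp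
    rw [e]
    exact mul_le_mul_of_nonneg_left s3 (Real.exp_pos _).le
  have hlo : ∀ R > 0, ∀ d > 0, ∀ᶠ v in atTop,
      Real.exp (-(2 * d)) * (c * fejM - d - B * (fejM - m (R * d))) ≤ f v * fejM := by
    intro R hR d hd
    have hl := key_limit' hm h0 hB hcont hh hR
    have hl2 : ∀ᶠ v in atTop, c * fejM - d < ∫ u in Ioi (0:ℝ), f u * fejR R ((v - d) - u) :=
      (hl.comp (tendsto_atTop_add_const_right atTop (-d) tendsto_id)).eventually_const_lt (by linarith)
    filter_upwards [hl2, eventually_gt_atTop (2 * d)] with v hv hv0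
    set w := v - d with hw
    have hmid' := hmid R hR d w
    have e1 : w - d = v - 2 * d := by rw [hw]; ring
    have e2 : w + d = v := by rw [hw]; ring
    rw [e1, e2] at hmid'
    rw [intervalIntegral.integral_of_le (by linarith)] at hmid'
    have hKi := (fejR_integrable hR).comp_sub_left w
    have htot : ∫ u, fejR R (w - u) = fejM := by
      rw [integral_sub_left_eq_self (fejR R)]; exact fejR_integral hR
    have hcompl := integral_add_compl (measurableSet_Ioc : MeasurableSet (Ioc (v - 2 * d) v)) hKi
    rw [htot, hmid'] at hcompl
    have s1 : ∫ u in Ioi (0:ℝ), f u * fejR R (w - u) ≤ ∫ u, f u * fejR R (w - u) :=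
      setIntegral_le_integral (hfK R hR w) (by filter_upwards with u using mul_nonneg (h0 _) (fejR_nonneg hR _))
    have s2 := integral_add_compl (measurableSet_Ioc : MeasurableSet (Ioc (v - 2 * d) v)) (hfK R hR w)
    have s3 : ∫ u in (Ioc (v - 2 * d) v)ᶜ, f u * fejR R (w - u) ≤ B * (fejM - m (R * d)) := by
      have : fejM - m (R * d) = ∫ u in (Ioc (v - 2 * d) v)ᶜ, fejR R (w - u) := by linarith
      rw [this, ← integral_const_mul]
      apply integral_mono (hfK R hR w).integrableOn (hKi.const_mul B).integrableOn
      intro u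
      exact mul_le_mul_of_nonneg_right (hB u) (fejR_nonneg hR _)
    have s4 : ∫ u in Ioc (v - 2 * d) v, f u * fejR R (w - u) ≤ f v * Real.exp (2 * d) * m (R * d) := by
      rw [← hmid', ← integral_const_mul]
      apply setIntegral_mono_on (hfK R hR w).integrableOn (hKi.const_mul _).integrableOn measurableSet_Ioc
      intro u hu
      refine mul_le_mul_of_nonneg_right ?_ (fejR_nonneg hR _)
      have := hmono u v (by linarith [hu.1]) hu.2
      have e : f v * Real.exp (v - u) ≤ f v * Real.exp (2 * d) :=
        mul_le_mul_of_nonneg_left (Real.exp_le_exp.mpr (by linarith [hu.1])) (h0 v)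
      refine le_trans ?_ e
      rw [Real.exp_sub, mul_div_assoc', le_div_iff₀ (Real.exp_pos _)]
      exact this
    have s5 : m (R * d) ≤ fejM := by
      have : 0 ≤ ∫ u in (Ioc (v - 2 * d) v)ᶜ, fejR R (w - u) :=
        integral_nonneg fun u => fejR_nonneg hR _
      linarith
    have s6 : f v * Real.exp (2 * d) * m (R * d) ≤ f v * Real.exp (2 * d) * fejM :=
      mul_le_mul_of_nonneg_left s5 (mul_nonneg (h0 v) (Real.exp_pos _).le)
    have s7 : c * fejM - d - B * (fejM - m (R * d)) ≤ f v * Real.exp (2 * d) * fejM := by linarith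
    have e : f v * fejM = Real.exp (-(2 * d)) * (f v * Real.exp (2 * d) * fejM) := by
      rw [Real.exp_neg]; field_simp
    rw [e]
    exact mul_le_mul_of_nonneg_left s7 (Real.exp_pos _).le
  -- conclude
  have hd0 : Tendsto (fun d : ℝ => d) (𝓝[>] 0) (𝓝 0) := tendsto_nhdsWithin_of_tendsto_nhds tendsto_id
  have hRd : Tendsto (fun d : ℝ => (1 / d ^ 2) * d) (𝓝[>] 0) atTop := by
    refine tendsto_inv_nhdsGT_zero.congr' ?_
    filter_upwards [self_mem_nhdsWithin] with d hd
    have : d ≠ 0 := (mem_Ioi.mp hd).ne'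
    field_simp
  have hmd := hmt.comp hRd
  have hexp2 : Tendsto (fun d : ℝ => Real.exp (2 * d)) (𝓝[>] 0) (𝓝 1) := by
    have := (Real.continuous_exp.tendsto _).comp (hd0.const_mul 2)
    simpa [Function.comp_def] using this
  have hexp3 : Tendsto (fun d : ℝ => Real.exp (-(2 * d))) (𝓝[>] 0) (𝓝 1) := by
    have := (Real.continuous_exp.tendsto _).comp (hd0.const_mul 2).neg
    simpa [Function.comp_def] using this
  rw [tendsto_order]
  constructor
  · intro a ha
    have hL : Tendsto (fun d : ℝ => Real.exp (-(2 * d)) * (c * fejM - d - B * (fejM - m ((1 / d ^ 2) * d))) / fejM)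
        (𝓝[>] 0) (𝓝 c) := by
      have := ((hexp3.mul (((tendsto_const_nhds (x := c * fejM)).sub hd0).sub
        (((tendsto_const_nhds (x := fejM)).sub hmd).const_mul B)))).div_const fejM
      have e : 1 * (c * fejM - 0 - B * (fejM - fejM)) / fejM = c := by field_simp; ring
      rw [e] at this
      exact this
    obtain ⟨d, hd, hd1⟩ := ((hL.eventually_const_lt ha).and self_mem_nhdsWithin).exists
    have hd1 : 0 < d := hd1
    filter_upwards [hlo (1 / d ^ 2) (by positivity) d hd1] with v hv
    refine hd.trans_le ?_
    rw [div_le_iff₀ hMp]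
    exact hv
  · intro a ha
    have hL : Tendsto (fun d : ℝ => Real.exp (2 * d) * (c * fejM + d) / m ((1 / d ^ 2) * d))
        (𝓝[>] 0) (𝓝 c) := by
      have := (hexp2.mul ((tendsto_const_nhds (x := c * fejM)).add hd0)).div hmd hMp.ne'
      have e : 1 * (c * fejM + 0) / fejM = c := by field_simp; ring
      rw [e] at this
      exact this
    obtain ⟨d, ⟨hd, hmp⟩, hd1⟩ := (((hL.eventually_lt_const ha).and (hmd.eventually_const_lt hMp)).and
      self_mem_nhdsWithin).exists
    have hd1 : 0 < d := hd1
    filter_upwards [hup (1 / d ^ 2) (by positivity) d hd1] with v hv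
    refine lt_of_le_of_lt ?_ hd
    rw [le_div_iff₀ (by exact hmp)]
    exact hv

end Tauber
end S11
end

section
namespace S11
section Tauber
open MeasureTheory Filter Topology Set

theorem wiener_ikehara (a : ℕ → ℝ) (ha : ∀ n, 0 ≤ a n) {B : ℝ}
    (hB : ∀ n : ℕ, ∑ k ∈ Finset.Icc 1 n, a k ≤ B * n) {c : ℝ} {G : ℂ → ℂ}
    (hG : ContinuousOn G {s | 1 ≤ s.re})
    (hL : ∀ s : ℂ, 1 < s.re → LSeries (fun n => (a n : ℂ)) s = c / (s - 1) + G s) :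
    Tendsto (fun n : ℕ => (∑ k ∈ Finset.Icc 1 n, a k) / (n : ℝ)) atTop (𝓝 c) := by
  have hB0 : 0 ≤ B := by
    have := hB 1
    simp only [Finset.Icc_self, Finset.sum_singleton, Nat.cast_one, mul_one] at this
    exact (ha 1).trans this
  set A : ℕ → ℝ := fun n => ∑ k ∈ Finset.Icc 1 n, a k with hA
  have hA0 : ∀ n, 0 ≤ A n := fun n => Finset.sum_nonneg fun k _ => ha k
  have hAm : Monotone A := by
    intro m n hmn
    exact Finset.sum_le_sum_of_subset_of_nonneg (Finset.Icc_subset_Icc le_rfl hmn) (fun k _ _ => ha k)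
  set f : ℝ → ℝ := fun u => A ⌊Real.exp u⌋₊ * Real.exp (-u) with hf
  have hfm : Measurable f := by
    refine Measurable.mul ?_ (by fun_prop)
    exact (measurable_of_countable A).comp (Nat.measurable_floor.comp Real.measurable_exp)
  have hf0 : ∀ u, 0 ≤ f u := fun u => mul_nonneg (hA0 _) (Real.exp_pos _).le
  have hfB : ∀ u, f u ≤ B := by
    intro u
    have h1 : A ⌊Real.exp u⌋₊ ≤ B * Real.exp u :=
      (hB _).trans (mul_le_mul_of_nonneg_left (Nat.floor_le (Real.exp_pos _).le) hB0)
    calc f u ≤ B * Real.exp u * Real.exp (-u) := mul_le_mul_of_nonneg_right h1 (Real.exp_pos _).le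
      _ = B := by rw [mul_assoc, ← Real.exp_add]; simp
  have hfe : ∀ u, f u * Real.exp u = A ⌊Real.exp u⌋₊ := by
    intro u; simp only [hf]; rw [mul_assoc, ← Real.exp_add]; simp
  have hmono : ∀ u v, 0 < u → u ≤ v → f u * Real.exp u ≤ f v * Real.exp v := by
    intro u v _ huv
    rw [hfe, hfe]
    exact hAm (Nat.floor_mono (Real.exp_le_exp.mpr huv))
  have hcont : ContinuousOn (fun z : ℂ => (G (1 + z) - c) / (1 + z)) {z | 0 ≤ z.re} := by
    refine ContinuousOn.div ?_ (by fun_prop) ?_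
    · refine ContinuousOn.sub (hG.comp (by fun_prop) ?_) continuousOn_const
      intro z hz
      simpa using hz
    · intro z hz h
      have := congrArg Complex.re h
      simp at this
      have hz : 0 ≤ z.re := hz
      linarith
  have hh : ∀ z : ℂ, 0 < z.re → ∫ u in Ioi (0:ℝ), ((f u - c : ℝ) : ℂ) * Complex.exp (-z * u) =
      (G (1 + z) - c) / (1 + z) := by
    intro z hz
    have hz0 : z ≠ 0 := fun h => by simp [h] at hz
    have hz1 : 1 + z ≠ 0 := fun h => by
      have := congrArg Complex.re h
      simp at this
      linarith
    have hs : (1:ℝ) < (1 + z).re := by simpa using hz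
    have hO : (fun n => ∑ k ∈ Finset.Icc 1 n, a k) =O[atTop] fun n : ℕ => (n : ℝ) ^ (1:ℝ) := by
      refine Asymptotics.IsBigO.of_bound B ?_
      filter_upwards with n
      rw [Real.rpow_one, Real.norm_of_nonneg (hA0 n), Real.norm_of_nonneg (Nat.cast_nonneg n)]
      exact hB n
    have e1 := LSeries_eq_mul_integral_of_nonneg a zero_le_one hs hO ha
    rw [hL _ hs] at e1
    have e2 : ∫ t in Set.Ioi (1 : ℝ), (∑ k ∈ Finset.Icc 1 ⌊t⌋₊, (a k : ℂ)) * (t:ℂ) ^ (-((1 + z) + 1)) =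
        ∫ u in Ioi (0:ℝ), (f u : ℂ) * Complex.exp (-z * u) := by
      rw [← Real.exp_zero, ← integral_comp_exp_Ioi]
      congr 1; ext u
      have hp : ((Real.exp u : ℝ) : ℂ) ^ (-((1 + z) + 1)) = Complex.exp (-((1 + z) + 1) * u) := by
        rw [Complex.cpow_def_of_ne_zero (by exact_mod_cast (Real.exp_pos u).ne'), ← Complex.ofReal_log (Real.exp_pos u).le,
          Real.log_exp, mul_comm]
      rw [hp]
      simp only [hf, hA, Complex.real_smul]
      push_cast
      rw [mul_left_comm, mul_assoc, ← Complex.exp_add, ← Complex.exp_add]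
      congr 2
      ring
    rw [e2] at e1
    have i1 : IntegrableOn (fun u : ℝ => (f u : ℂ) * Complex.exp (-z * u)) (Ioi 0) := by
      have hexp : IntegrableOn (fun u : ℝ => B * Real.exp (-z.re * u)) (Ioi 0) :=
        (integrableOn_exp_mul_Ioi (by linarith) 0).const_mul B
      refine hexp.mono' (by fun_prop) ?_
      filter_upwards with u
      rw [norm_mul, Complex.norm_exp, Complex.norm_real, Real.norm_of_nonneg (hf0 u)]
      simp only [Complex.mul_re, Complex.neg_re, Complex.ofReal_re, Complex.neg_im, Complex.ofReal_im, mul_zero, sub_zero]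
      exact mul_le_mul_of_nonneg_right (hfB u) (Real.exp_pos _).le
    have i2 : IntegrableOn (fun u : ℝ => (c : ℂ) * Complex.exp (-z * u)) (Ioi 0) :=
      (integrableOn_exp_mul_complex_Ioi (by simpa using hz) 0).const_mul _
    have e3 : ∫ u in Ioi (0:ℝ), ((f u - c : ℝ) : ℂ) * Complex.exp (-z * u) =
        (∫ u in Ioi (0:ℝ), (f u : ℂ) * Complex.exp (-z * u)) - ∫ u in Ioi (0:ℝ), (c : ℂ) * Complex.exp (-z * u) := by
      rw [← integral_sub i1 i2]
      congr 1; ext u; push_cast; ring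
    rw [e3, integral_const_mul, integral_exp_mul_complex_Ioi (by simpa using hz)]
    have e4 : ∫ u in Ioi (0:ℝ), (f u : ℂ) * Complex.exp (-z * u) = (c / (1 + z - 1) + G (1 + z)) / (1 + z) := by
      rw [e1]; field_simp
    rw [e4]
    simp only [add_sub_cancel_left, Complex.ofReal_zero, mul_zero, Complex.exp_zero]
    field_simp
    ring
  have key := tauber hfm hf0 hfB hmono hcont hh
  have h2 : Tendsto (fun n : ℕ => Real.log n) atTop atTop := Real.tendsto_log_atTop.comp tendsto_natCast_atTop_atTop
  refine (key.comp h2).congr' ?_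
  filter_upwards [eventually_gt_atTop 0] with n hn
  have hn' : (0:ℝ) < n := by exact_mod_cast hn
  simp only [Function.comp, hf, Real.exp_neg, Real.exp_log hn', Nat.floor_natCast]
  rw [div_eq_mul_inv]

end Tauber
end S11
end

section
namespace S11
section Count
open Filter Topology

lemma log_ratio_tendsto : Tendsto (fun n : ℕ => Real.log n / Real.log (n / (Real.log n)^2)) atTop (𝓝 1) := by
  have h2 : Tendsto (fun n : ℕ => Real.log n) atTop atTop := Real.tendsto_log_atTop.comp tendsto_natCast_atTop_atTop
  have h3 : Tendsto (fun x : ℝ => Real.log x / x) atTop (𝓝 0) := by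
    simpa using Real.tendsto_pow_log_div_mul_add_atTop 1 0 1 one_ne_zero
  have h4 := h3.comp h2
  have h5 : Tendsto (fun n : ℕ => (1 - 2 * (Real.log (Real.log n) / Real.log n))⁻¹) atTop (𝓝 ((1 - 2 * 0)⁻¹)) :=
    ((h4.const_mul 2).const_sub 1).inv₀ (by norm_num)
  rw [mul_zero, sub_zero, inv_one] at h5
  refine h5.congr' ?_
  filter_upwards [eventually_gt_atTop 0, h2.eventually_gt_atTop 0] with n hn hl
  have hn' : (0:ℝ) < n := by exact_mod_cast hn
  rw [Real.log_div hn'.ne' (by positivity), Real.log_pow]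
  have : (1 - 2 * (Real.log (Real.log n) / Real.log n)) = (Real.log n - 2 * Real.log (Real.log n)) / Real.log n := by
    field_simp
  rw [this, inv_div]; norm_num

lemma count_asymp (S : Set ℕ) {c : ℝ}
    (h : Tendsto (fun n : ℕ => (∑ k ∈ Finset.Icc 1 n, S.indicator (fun k => Real.log k) k) / (n:ℝ)) atTop (𝓝 c)) :
    Tendsto (fun n : ℕ => (∑ k ∈ Finset.Icc 1 n, S.indicator (fun _ => (1:ℝ)) k) * Real.log n / n) atTop (𝓝 c) := by
  have h2 : Tendsto (fun n : ℕ => Real.log n) atTop atTop := Real.tendsto_log_atTop.comp tendsto_natCast_atTop_atTop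
  have hu : Tendsto (fun n : ℕ => (Real.log n)⁻¹ + (∑ k ∈ Finset.Icc 1 n, S.indicator (fun k => Real.log k) k) / (n:ℝ) *
      (Real.log n / Real.log (n / (Real.log n)^2))) atTop (𝓝 (0 + c * 1)) :=
    h2.inv_tendsto_atTop.add (h.mul log_ratio_tendsto)
  rw [zero_add, mul_one] at hu
  have hy : ∀ᶠ n : ℕ in atTop, 0 < Real.log (n / (Real.log n)^2) := by
    have := log_ratio_tendsto.eventually (lt_mem_nhds (show (0:ℝ) < 1 by norm_num))
    filter_upwards [this, h2.eventually_gt_atTop 0] with n h1 h2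
    by_contra hc
    exact absurd h1 (not_lt.2 (div_nonpos_of_nonneg_of_nonpos h2.le (not_lt.1 hc)))
  refine tendsto_of_tendsto_of_tendsto_of_le_of_le' h hu ?_ ?_
  · filter_upwards [eventually_gt_atTop 0] with n hn
    have hn' : (0:ℝ) < n := by exact_mod_cast hn
    gcongr
    rw [Finset.sum_mul]
    refine Finset.sum_le_sum fun k hk => ?_
    simp only [Finset.mem_Icc] at hk
    by_cases hks : k ∈ S
    · simp only [Set.indicator_of_mem hks, one_mul]
      exact Real.log_le_log (by exact_mod_cast hk.1) (by exact_mod_cast hk.2)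
    · simp [Set.indicator_of_notMem hks]
  · filter_upwards [eventually_gt_atTop 0, h2.eventually_gt_atTop 0, hy] with n hn hl hly
    have hn' : (0:ℝ) < n := by exact_mod_cast hn
    set y : ℝ := n / (Real.log n)^2 with hydef
    have hy0 : 0 < y := by positivity
    set A := (∑ k ∈ Finset.Icc 1 n, S.indicator (fun k => Real.log k) k)
    set C := (∑ k ∈ Finset.Icc 1 n, S.indicator (fun _ => (1:ℝ)) k)
    have key : C * Real.log y ≤ y * Real.log y + A := by
      have hb : ∑ k ∈ Finset.Icc 1 n, (if (k:ℝ) ≤ y then Real.log y else 0) ≤ y * Real.log y := by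
        rw [← Finset.sum_filter, Finset.sum_const, nsmul_eq_mul]
        gcongr
        have : (Finset.Icc 1 n).filter (fun k : ℕ => (k:ℝ) ≤ y) ⊆ Finset.Icc 1 ⌊y⌋₊ := by
          intro k; simp only [Finset.mem_filter, Finset.mem_Icc]
          rintro ⟨⟨h1, h2⟩, h3⟩
          exact ⟨h1, Nat.le_floor h3⟩
        calc _ ≤ (((Finset.Icc 1 ⌊y⌋₊).card : ℕ) : ℝ) := by exact_mod_cast Finset.card_le_card this
          _ ≤ y := by simpa using Nat.floor_le hy0.le
      refine le_trans ?_ (add_le_add_left hb A)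
      rw [Finset.sum_mul, ← Finset.sum_add_distrib]
      refine Finset.sum_le_sum fun k hk => ?_
      simp only [Finset.mem_Icc] at hk
      have hlk : 0 ≤ Real.log k := Real.log_natCast_nonneg k
      by_cases hks : k ∈ S
      · simp only [Set.indicator_of_mem hks, one_mul]
        split_ifs with hky
        · linarith
        · have := Real.log_le_log hy0 (not_le.1 hky).le
          linarith
      · simp only [Set.indicator_of_notMem hks, zero_mul]
        split_ifs <;> linarith
    have : C * Real.log n / n = C * Real.log y * (Real.log n / (n * Real.log y)) := by
      field_simp
    rw [this]
    calc _ ≤ (y * Real.log y + A) * (Real.log n / (n * Real.log y)) := by gcongr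
      _ = (y * Real.log n / n) + A / n * (Real.log n / Real.log y) := by field_simp
      _ = _ := by
        congr 1
        rw [hydef]; field_simp

lemma sum_indicator_ncard (S : Set ℕ) (h0 : 0 ∉ S) (n : ℕ) :
    (∑ k ∈ Finset.Icc 1 n, S.indicator (fun _ => (1:ℝ)) k) = (({N | N ≤ n ∧ N ∈ S}.ncard : ℕ) : ℝ) := by
  classical
  have : {N | N ≤ n ∧ N ∈ S} = (((Finset.Icc 1 n).filter (· ∈ S) : Finset ℕ) : Set ℕ) := by
    ext k
    simp only [Set.mem_ofPred_eq, Finset.coe_filter, Finset.mem_Icc]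
    constructor
    · rintro ⟨h1, h2⟩
      refine ⟨⟨Nat.one_le_iff_ne_zero.2 fun h => h0 (h ▸ h2), h1⟩, h2⟩
    · tauto
  rw [this, Set.ncard_coe_finset]
  simp [Set.indicator_apply]

/-- ratio of counts from theta asymptotics -/
theorem ratio_of_theta (S T : Set ℕ) (hS0 : 0 ∉ S) (hT0 : 0 ∉ T) {c d : ℝ} (hd : d ≠ 0)
    (hS : Tendsto (fun n : ℕ => (∑ k ∈ Finset.Icc 1 n, S.indicator (fun k => Real.log k) k) / (n:ℝ)) atTop (𝓝 c))
    (hT : Tendsto (fun n : ℕ => (∑ k ∈ Finset.Icc 1 n, T.indicator (fun k => Real.log k) k) / (n:ℝ)) atTop (𝓝 d)) :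
    Tendsto (fun n : ℕ => (({N | N ≤ n ∧ N ∈ S}.ncard : ℕ) : ℝ) / (({N | N ≤ n ∧ N ∈ T}.ncard : ℕ) : ℝ)) atTop (𝓝 (c / d)) := by
  have := (count_asymp S hS).div (count_asymp T hT) hd
  refine this.congr' ?_
  have h2 : Tendsto (fun n : ℕ => Real.log n) atTop atTop := Real.tendsto_log_atTop.comp tendsto_natCast_atTop_atTop
  filter_upwards [eventually_gt_atTop 0, h2.eventually_gt_atTop 0] with n hn hl
  have hn' : (0:ℝ) < n := by exact_mod_cast hn
  simp only [Pi.div_apply, sum_indicator_ncard S hS0, sum_indicator_ncard T hT0]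
  rw [div_div_div_cancel_right₀ hn'.ne', mul_div_mul_right _ _ hl.ne']

end Count
end S11
end

section
namespace S11
section Eisenstein
open QuadraticAlgebra

/-- Eisenstein integers -/
abbrev E := QuadraticAlgebra ℤ (-1) (-1)

namespace E

lemma norm_eq (x : E) : x.norm = x.re^2 - x.re * x.im + x.im^2 := by
  rw [norm_def]; ring

lemma norm_nonneg (x : E) : 0 ≤ x.norm := by
  rw [norm_eq]; nlinarith [sq_nonneg (x.re - x.im), sq_nonneg x.re, sq_nonneg x.im]

lemma norm_eq_zero {x : E} : x.norm = 0 ↔ x = 0 := by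
  constructor
  · intro h
    rw [norm_eq] at h
    have h1 : x.re = 0 := by nlinarith [sq_nonneg (x.re - 2 * x.im), sq_nonneg x.re]
    have h2 : x.im = 0 := by nlinarith [sq_nonneg (x.im - 2 * x.re), sq_nonneg x.im]
    ext <;> simp [h1, h2]
  · rintro rfl; simp

instance : NoZeroDivisors E where
  eq_zero_or_eq_zero_of_mul_eq_zero {a b} h := by
    have : a.norm * b.norm = 0 := by rw [← map_mul, h]; simp
    rcases mul_eq_zero.1 this with h | h
    · exact Or.inl (norm_eq_zero.1 h)
    · exact Or.inr (norm_eq_zero.1 h)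

instance : IsDomain E := NoZeroDivisors.to_isDomain E

lemma norm_pos {x : E} (h : x ≠ 0) : 0 < x.norm :=
  lt_of_le_of_ne (norm_nonneg x) (Ne.symm (fun h' => h (norm_eq_zero.1 h')))

noncomputable def quo (x y : E) : E :=
  ⟨round (((x * star y).re : ℚ) / y.norm), round (((x * star y).im : ℚ) / y.norm)⟩

lemma mul_star_eq (y : E) : y * star y = (y.norm : E) := by
  have := algebraMap_norm_eq_mul_star y
  rw [← this]; rfl

lemma norm_rem_lt (x : E) {y : E} (hy : y ≠ 0) : (x - y * quo x y).norm < y.norm := by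
  have hN := norm_pos hy
  have hNq : (0:ℚ) < y.norm := by exact_mod_cast hN
  suffices h : (x - y * quo x y).norm * y.norm < y.norm * y.norm from lt_of_mul_lt_mul_right h hN.le
  rw [← norm_star y, ← map_mul, norm_star y]
  have e : (x - y * quo x y) * star y = x * star y - (y.norm : E) * quo x y := by
    rw [← mul_star_eq]; ring
  rw [e, norm_eq]
  set z := x * star y
  set n := y.norm
  have h1 : |(z.re : ℚ) / n - round ((z.re : ℚ) / n)| ≤ 1/2 := abs_sub_round _
  have h2 : |(z.im : ℚ) / n - round ((z.im : ℚ) / n)| ≤ 1/2 := abs_sub_round _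
  have e1 : ((z - (n : E) * quo x y).re : ℚ) = n * ((z.re : ℚ) / n - round ((z.re : ℚ) / n)) := by
    rw [mul_sub, mul_div_cancel₀ _ hNq.ne']
    simp [quo, z, n]
  have e2 : ((z - (n : E) * quo x y).im : ℚ) = n * ((z.im : ℚ) / n - round ((z.im : ℚ) / n)) := by
    rw [mul_sub, mul_div_cancel₀ _ hNq.ne']
    simp [quo, z, n]
  set a := (z.re : ℚ) / n - round ((z.re : ℚ) / n)
  set b := (z.im : ℚ) / n - round ((z.im : ℚ) / n)
  have h3 : a^2 - a*b + b^2 < 1 := by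
    rw [abs_le] at h1 h2
    nlinarith
  have : (((z - (n : E) * quo x y).re ^ 2 - (z - (n : E) * quo x y).re * (z - (n : E) * quo x y).im +
    (z - (n : E) * quo x y).im ^ 2 : ℤ) : ℚ) < ((n * n : ℤ) : ℚ) := by
    push_cast
    rw [e1, e2]
    nlinarith [mul_pos hNq hNq]
  exact_mod_cast this

noncomputable instance : EuclideanDomain E where
  quotient := quo
  quotient_zero x := by ext <;> simp [quo]
  remainder x y := x - y * quo x y
  quotient_mul_add_remainder_eq x y := by ring
  r := fun x y => x.norm.natAbs < y.norm.natAbs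
  r_wellFounded := (measure (fun x : E => x.norm.natAbs)).wf
  remainder_lt x {y} hy := by
    have := norm_rem_lt x hy
    have h1 := norm_nonneg (x - y * quo x y)
    have h2 := norm_nonneg y
    change Int.natAbs _ < Int.natAbs _
    omega
  mul_left_not_lt x {y} hy := by
    change ¬ (Int.natAbs _ < Int.natAbs _)
    rw [map_mul, Int.natAbs_mul, not_lt]
    have := norm_pos hy
    exact Nat.le_mul_of_pos_right _ (by omega)

lemma isUnit_iff {x : E} : IsUnit x ↔ x.norm = 1 := by
  rw [isUnit_iff_norm_isUnit, Int.isUnit_iff]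
  have := norm_nonneg x
  omega

/-- 1+3β -/
def M (β : E) : E := 1 + 3 * β

@[simp] lemma M_re (β : E) : (M β).re = 1 + 3 * β.re := by simp [M]
@[simp] lemma M_im (β : E) : (M β).im = 3 * β.im := by simp [M]

lemma M_inj : Function.Injective M := by
  intro a b h
  have h1 := congrArg QuadraticAlgebra.re h
  have h2 := congrArg QuadraticAlgebra.im h
  simp at h1 h2
  ext <;> assumption

lemma M_ne_zero (β : E) : M β ≠ 0 := by
  intro h
  have h1 := congrArg QuadraticAlgebra.re h
  simp at h1
  omega

/-- circle operation -/
def op (β γ : E) : E := β + γ + 3 * (β * γ)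

lemma M_op (β γ : E) : M (op β γ) = M β * M γ := by simp only [M, op]; ring

lemma M_of_mul {β γ y : E} (h : M β * y = M γ) : ∃ δ, y = M δ := by
  refine ⟨γ - β * y, ?_⟩
  simp only [M] at *
  linear_combination h

lemma norm_M_mod (β : E) : (M β).norm % 3 = 1 := by
  have : (M β).norm = 1 + 3 * (2 * β.re + 3 * β.re^2 - β.im - 3 * β.re * β.im + 3 * β.im^2) := by
    rw [norm_eq]; simp; ring
  omega

lemma norm_M_mod9 (β : E) : (M β).norm % 9 = (1 + 3 * (2 * β.re - β.im)) % 9 := by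
  have : (M β).norm = 1 + 3 * (2 * β.re - β.im) + 9 * (β.re^2 - β.re * β.im + β.im^2) := by
    rw [norm_eq]; simp; ring
  omega

lemma unit_M {u : E} {β γ : E} (hu : IsUnit u) (h : M β * u = M γ) : u = 1 := by
  obtain ⟨δ, rfl⟩ := M_of_mul h
  rw [isUnit_iff, norm_eq] at hu
  simp only [M_re, M_im] at hu
  have h1 : δ.im = 0 := by
    have : (3 * δ.im)^2 ≤ 3 := by nlinarith [sq_nonneg (2 * (1 + 3 * δ.re) - 3 * δ.im)]
    nlinarith [sq_nonneg δ.im, sq_nonneg (δ.im)]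
  rw [h1] at hu
  have h2 : δ.re = 0 := by
    have : δ.re * (2 + 3 * δ.re) = 0 := by nlinarith
    rcases mul_eq_zero.1 this with h | h
    · exact h
    · omega
  ext <;> simp [h1, h2]

lemma associated_M {β γ : E} (h : Associated (M β) (M γ)) : β = γ := by
  obtain ⟨u, hu⟩ := h
  have := unit_M u.isUnit hu
  rw [this, mul_one] at hu
  exact M_inj hu

lemma exists_M {x : E} (h : ¬ (3:ℤ) ∣ x.norm) : ∃ β, Associated x (M β) := by
  have key : ∃ u : E, IsUnit u ∧ ((x * u).re % 3 = 1 ∧ (x * u).im % 3 = 0) := by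
    rw [norm_eq] at h
    have hr : x.re % 3 = 0 ∨ x.re % 3 = 1 ∨ x.re % 3 = 2 := by omega
    have hi : x.im % 3 = 0 ∨ x.im % 3 = 1 ∨ x.im % 3 = 2 := by omega
    have hh : (x.re^2 - x.re * x.im + x.im^2) % 3 ≠ 0 := fun h' => h (Int.dvd_of_emod_eq_zero h')
    rcases hr with hr | hr | hr <;> rcases hi with hi | hi | hi
    · simp [pow_two, Int.add_emod, Int.sub_emod, Int.mul_emod, hr, hi] at hh
    · refine ⟨⟨-1, -1⟩, by rw [isUnit_iff, norm_eq]; norm_num, ?_⟩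
      simp; omega
    · refine ⟨⟨1, 1⟩, by rw [isUnit_iff, norm_eq]; norm_num, ?_⟩
      simp; omega
    · refine ⟨1, isUnit_one, ?_⟩
      simp; omega
    · refine ⟨⟨0, -1⟩, by rw [isUnit_iff, norm_eq]; norm_num, ?_⟩
      simp; omega
    · simp [pow_two, Int.add_emod, Int.sub_emod, Int.mul_emod, hr, hi] at hh
    · refine ⟨-1, isUnit_one.neg, ?_⟩
      simp; omega
    · simp [pow_two, Int.add_emod, Int.sub_emod, Int.mul_emod, hr, hi] at hh
    · refine ⟨⟨0, 1⟩, by rw [isUnit_iff, norm_eq]; norm_num, ?_⟩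
      simp; omega
  obtain ⟨u, hu, h1, h2⟩ := key
  refine ⟨⟨(x * u).re / 3, (x * u).im / 3⟩, hu.unit, ?_⟩
  ext
  · simp only [M_re, IsUnit.unit_spec]; omega
  · simp only [M_im, IsUnit.unit_spec]; omega

/-- natural norm of 1+3β -/
def nn (β : E) : ℕ := (M β).norm.natAbs

lemma nn_cast (β : E) : (nn β : ℤ) = (M β).norm := Int.natAbs_of_nonneg (norm_nonneg _)

lemma nn_pos (β : E) : 0 < nn β := by
  have := norm_pos (M_ne_zero β)
  have := nn_cast β
  omega

lemma nn_op (β γ : E) : nn (op β γ) = nn β * nn γ := by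
  simp [nn, M_op, Int.natAbs_mul]

lemma nn_mod (β : E) : nn β % 3 = 1 := by
  have := norm_M_mod β
  have := nn_cast β
  omega

lemma nn_eq_one {β : E} (h : nn β = 1) : β = 0 := by
  have h1 : IsUnit (M β) := by rw [isUnit_iff, ← nn_cast, h]; rfl
  have : Associated (M β) (M 0) := by simpa [M] using (associated_one_iff_isUnit.2 h1)
  exact associated_M this

lemma nn_ge_four {β : E} (h : β ≠ 0) : 4 ≤ nn β := by
  have h1 := nn_mod β
  have h2 : nn β ≠ 1 := fun h' => h (nn_eq_one h')
  omega

end E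
end Eisenstein
end S11
end

section
namespace S11
section Eisenstein2
open QuadraticAlgebra
namespace E

lemma irreducible_of_norm {x : E} (h : Prime x.norm) : Irreducible x := by
  refine ⟨fun hu => ?_, fun a b hab => ?_⟩
  · rw [isUnit_iff] at hu
    rw [hu] at h
    exact not_prime_one h
  · rw [hab, map_mul] at h
    rcases h.irreducible.isUnit_or_isUnit rfl with h | h
    · exact Or.inl (isUnit_iff_norm_isUnit.2 h)
    · exact Or.inr (isUnit_iff_norm_isUnit.2 h)

lemma prime_of_nn {β : E} (h : (nn β).Prime) : Prime (M β) := by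
  refine (irreducible_of_norm ?_).prime
  rw [← nn_cast]
  exact Nat.prime_iff_prime_int.1 h

/-- a prime element divides a rational prime -/
lemma exists_rat_prime {x : E} (hx : Prime x) : ∃ q : ℕ, q.Prime ∧ x ∣ (q : E) := by
  have h1 : x ∣ ((x.norm.natAbs : ℕ) : E) := by
    have : ((x.norm.natAbs : ℕ) : E) = ((x.norm : ℤ) : E) := by
      have : ((x.norm.natAbs : ℕ) : ℤ) = x.norm := Int.natAbs_of_nonneg (norm_nonneg _)
      rw [← this]; simp
    rw [this, ← mul_star_eq]
    exact dvd_mul_right _ _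
  have h0 : x.norm.natAbs ≠ 0 := by
    have := norm_pos hx.ne_zero; omega
  have h2 := Nat.prod_primeFactorsList h0
  rw [← h2, Nat.cast_list_prod, hx.dvd_prod_iff] at h1
  obtain ⟨a, ha, hxa⟩ := h1
  rw [List.mem_map] at ha
  obtain ⟨q, hq, rfl⟩ := ha
  exact ⟨q, Nat.prime_of_mem_primeFactorsList hq, hxa⟩

lemma norm_cases {x y : E} {q : ℕ} (hq : q.Prime) (h : x * y = (q : E)) :
    x.norm = 1 ∨ x.norm = q ∨ y.norm = 1 := by
  have h1 : x.norm.natAbs * y.norm.natAbs = q ^ 2 := by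
    rw [← Int.natAbs_mul, ← map_mul, h, QuadraticAlgebra.norm_natCast, Int.natAbs_pow, Int.natAbs_natCast]
  have h2 : x.norm.natAbs ∣ q ^ 2 := Dvd.intro _ h1
  rw [Nat.dvd_prime_pow hq] at h2
  obtain ⟨k, hk, h2⟩ := h2
  have hx := norm_nonneg x
  have hy := norm_nonneg y
  interval_cases k
  · left; simp at h2; omega
  · right; left; simp at h2; omega
  · right; right
    rw [h2] at h1
    have : y.norm.natAbs = 1 := by
      have : 0 < q^2 := pow_pos hq.pos 2
      exact Nat.eq_of_mul_eq_mul_left this (by rw [h1, mul_one])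
    omega

lemma unit_cases {u : E} (hu : IsUnit u) : (u.im = 0) ∨ (u.re = 0) ∨ (u.re = u.im ∧ u.re^2 = 1) := by
  rw [isUnit_iff, norm_eq] at hu
  have h1 : u.re^2 ≤ 1 := by nlinarith [sq_nonneg (u.re - 2 * u.im)]
  have h2 : u.im^2 ≤ 1 := by nlinarith [sq_nonneg (2 * u.re - u.im)]
  have h3 : -1 ≤ u.re ∧ u.re ≤ 1 := abs_le.1 (sq_le_one_iff_abs_le_one _ |>.1 h1)
  have h4 : -1 ≤ u.im ∧ u.im ≤ 1 := abs_le.1 (sq_le_one_iff_abs_le_one _ |>.1 h2)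
  obtain ⟨h3, h3'⟩ := h3
  obtain ⟨h4, h4'⟩ := h4
  generalize u.re = a at *
  generalize u.im = b at *
  interval_cases a <;> interval_cases b <;> simp_all

lemma inert_im {β : E} (hp : Prime (M β)) (hn : ¬ (nn β).Prime) : β.im = 0 := by
  obtain ⟨q, hq, y, hy⟩ := exists_rat_prime hp
  rcases norm_cases hq hy.symm with h | h | h
  · exact absurd (isUnit_iff.2 h) hp.not_isUnit
  · rw [← nn_cast] at h
    have : nn β = q := by exact_mod_cast h
    exact absurd (this ▸ hq) hn
  · have hu := isUnit_iff.2 h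
    obtain ⟨v, hv⟩ := hu
    have e : M β = (q : E) * ((v⁻¹ : Eˣ) : E) := by rw [hy, ← hv, mul_assoc, Units.mul_inv, mul_one]
    have e1 := congrArg QuadraticAlgebra.re e
    have e2 := congrArg QuadraticAlgebra.im e
    simp at e1 e2
    rcases unit_cases (v⁻¹ : Eˣ).isUnit with h | h | ⟨h, h'⟩
    · rw [h] at e2; simpa using e2
    · rw [h] at e1; omega
    · rw [h] at e1; omega

lemma M_star (β : E) : M (star β) = star (M β) := by
  ext <;> simp <;> ring

lemma nn_star (β : E) : nn (star β) = nn β := by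
  rw [nn, M_star, QuadraticAlgebra.norm_star, nn]

lemma exists_nn {q : ℕ} (hq : q.Prime) (h3 : q % 3 = 1) : ∃ β, nn β = q := by
  have := Fact.mk hq
  -- a primitive cube root of unity mod q
  have hcard : 3 ∣ q - 1 := by omega
  obtain ⟨g, hg⟩ : ∃ g : (ZMod q)ˣ, orderOf g = 3 := by
    apply exists_prime_orderOf_dvd_card' 3 
    rw [Nat.card_eq_fintype_card, ZMod.card_units_eq_totient, Nat.totient_prime hq]
    exact hcard
  have hg3 : (g : ZMod q)^3 = 1 := by
    rw [← Units.val_pow_eq_pow_val, ← hg, pow_orderOf_eq_one, Units.val_one]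
  have hg1 : (g : ZMod q) ≠ 1 := by
    intro h
    have : g = 1 := Units.ext h
    rw [this, orderOf_one] at hg; omega
  have hz : (g : ZMod q)^2 + g + 1 = 0 := by
    have : ((g : ZMod q) - 1) * ((g : ZMod q)^2 + g + 1) = 0 := by linear_combination hg3
    exact (mul_eq_zero.1 this).resolve_left (sub_ne_zero.2 hg1)
  set n : ℤ := ((g : ZMod q).val : ℤ)
  have hn : (q : ℤ) ∣ n^2 + n + 1 := by
    rw [← ZMod.intCast_zmod_eq_zero_iff_dvd]
    push_cast
    simpa [n] using hz
  have hnp : ¬ Prime (q : E) := by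
    intro hp
    have hd : (q : E) ∣ (⟨n, -1⟩ : E) * (⟨n+1, 1⟩ : E) := by
      obtain ⟨c, hc⟩ := hn
      refine ⟨(c : E), ?_⟩
      ext
      · simp; linear_combination hc
      · simp
    have hcase : ∀ a b : ℤ, (q : E) ∣ ⟨a, b⟩ → (q : ℤ) ∣ b := by
      rintro a b ⟨c, hc⟩
      have := congrArg QuadraticAlgebra.im hc
      simp at this
      exact ⟨_, this⟩
    rcases hp.dvd_or_dvd hd with h | h
    · have := hcase _ _ h
      rw [Int.dvd_neg] at this
      have := Int.le_of_dvd one_pos this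
      have := hq.one_lt
      omega
    · have := Int.le_of_dvd one_pos (hcase _ _ h)
      have := hq.one_lt
      omega
  have hq0 : (q : E) ≠ 0 := by exact_mod_cast hq.ne_zero
  have hqu : ¬ IsUnit (q : E) := by
    rw [isUnit_iff, QuadraticAlgebra.norm_natCast]
    have := hq.one_lt
    intro h
    have : (q:ℤ)^2 > 1 := by have : (1:ℤ) < q := by exact_mod_cast this
                             nlinarith
    omega
  have hni : ¬ Irreducible (q : E) := fun h => hnp h.prime
  rw [irreducible_iff] at hni
  push Not at hni
  obtain ⟨a, b, hab, ha, hb⟩ := hni hqu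
  rw [isUnit_iff] at ha hb
  rcases norm_cases hq hab.symm with h | h | h
  · exact absurd h ha
  · obtain ⟨β, hβ⟩ := exists_M (x := a) (by rw [h]; omega)
    refine ⟨β, ?_⟩
    obtain ⟨u, hu⟩ := hβ
    rw [nn, ← hu, map_mul, h, isUnit_iff.1 u.isUnit]; simp
  · exact absurd h hb

lemma star_ne {β : E} (h : (nn β).Prime) : star β ≠ β := by
  intro hs
  have := congrArg QuadraticAlgebra.im hs
  simp at this
  have h0 : β.im = 0 := by omega
  have : nn β = (1 + 3 * β.re).natAbs * (1 + 3 * β.re).natAbs := by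
    rw [nn, norm_eq]; simp [h0, Int.natAbs_mul, pow_two]
  rw [this] at h
  have h2 := Nat.not_prime_mul (a := (1 + 3 * β.re).natAbs) (b := (1 + 3 * β.re).natAbs)
  by_cases h1 : (1 + 3 * β.re).natAbs = 1
  · rw [h1] at h; exact absurd h (by decide)
  · exact h2 h1 h1 h

lemma nn_fiber {β γ : E} (h : (nn β).Prime) (hγ : nn γ = nn β) : γ = β ∨ γ = star β := by
  have hp : Prime (M γ) := prime_of_nn (hγ ▸ h)
  have hd : M γ ∣ M β * M (star β) := by
    rw [M_star, mul_star_eq, ← nn_cast, ← hγ, nn_cast, ← mul_star_eq]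
    exact dvd_mul_right _ _
  rcases hp.dvd_or_dvd hd with h1 | h1
  · left; exact associated_M (hp.associated_of_dvd (prime_of_nn h) h1)
  · right; exact associated_M (hp.associated_of_dvd (prime_of_nn (by rwa [nn_star])) h1)

/-- prime elements in M-coordinates -/
abbrev PP := {β : E // Prime (M β)}

open scoped Classical in
lemma log_hasSum (x : E) (hx : x ≠ 0) (h3 : ¬ (3:ℤ) ∣ x.norm) :
    HasSum (fun q : PP × ℕ => if M q.1.1 ^ (q.2 + 1) ∣ x then Real.log (nn q.1.1) else 0) (Real.log x.norm) := by
  induction x using UniqueFactorizationMonoid.induction_on_prime with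
  | h₁ => exact absurd rfl hx
  | h₂ x hu =>
    rw [isUnit_iff.1 hu]
    have : (fun q : PP × ℕ => if M q.1.1 ^ (q.2 + 1) ∣ x then Real.log (nn q.1.1) else 0) = fun _ => 0 := by
      ext q
      rw [if_neg]
      intro hd
      exact q.1.2.not_isUnit (isUnit_of_dvd_unit ((dvd_pow_self _ (Nat.succ_ne_zero _)).trans hd) hu)
    rw [this]; simpa using hasSum_zero
  | h₃ a p ha hp ih =>
    rw [map_mul] at h3
    have ih' := ih ha (fun h => h3 (h.mul_left _))
    obtain ⟨β, hβ⟩ := exists_M (x := p) (fun h => h3 (h.mul_right _))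
    have hpβ : Prime (M β) := hβ.prime hp
    have hfin : FiniteMultiplicity (M β) a := FiniteMultiplicity.of_prime_left hpβ ha
    have hnp : p.norm = nn β := by
      obtain ⟨u, hu⟩ := hβ
      rw [nn_cast, ← hu, map_mul, isUnit_iff.1 u.isUnit, mul_one]
    set m := multiplicity (M β) a
    have hs := ih'.add (hasSum_ite_eq ((⟨β, hpβ⟩ : PP), m) (Real.log (nn β)))
    convert hs using 1
    · ext ⟨⟨q, hq⟩, k⟩
      simp only [Prod.mk.injEq, Subtype.mk.injEq]
      by_cases hqb : q = β
      · subst hqb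
        have e1 : M q ^ (k+1) ∣ p * a ↔ k ≤ m := by
          rw [(hβ.mul_right a).dvd_iff_dvd_right, pow_succ', mul_dvd_mul_iff_left hq.ne_zero]
          exact hfin.pow_dvd_iff_le_multiplicity
        have e2 : M q ^ (k+1) ∣ a ↔ k + 1 ≤ m := hfin.pow_dvd_iff_le_multiplicity
        simp only [e1, e2, true_and]
        split_ifs <;> first | omega | simp
      · have e1 : M q ^ (k+1) ∣ p * a ↔ M q ^ (k+1) ∣ a := by
          constructor
          · intro h
            refine hq.pow_dvd_of_dvd_mul_left _ ?_ h
            intro h'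
            exact hqb (associated_M ((hq.associated_of_dvd hp h').trans hβ))
          · exact fun h => h.mul_left _
        simp [e1, hqb]
    · rw [map_mul, Int.cast_mul, Real.log_mul, add_comm, hnp]
      · simp
      · exact_mod_cast (norm_pos hp.ne_zero).ne'
      · exact_mod_cast (norm_pos ha).ne'

end E
end Eisenstein2
end S11
end

section
namespace S11
section HeckeSum
open QuadraticAlgebra Filter Topology
namespace E

/-- character of E/3E -/
structure IsCh (e : E → ℂ) : Prop where
  add : ∀ a b, e (a + b) = e a * e b
  three : ∀ a, e (3 * a) = 1
  norm : ∀ a, ‖e a‖ = 1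

lemma IsCh.op {e : E → ℂ} (h : IsCh e) (a b : E) : e (op a b) = e a * e b := by
  rw [E.op, h.add, h.add, h.three, mul_one]

lemma nn_real (β : E) : (nn β : ℝ) = ((M β).norm : ℝ) := by
  rw [← nn_cast]; simp

lemma one_le_nn (β : E) : (1:ℝ) ≤ nn β := by exact_mod_cast nn_pos β

lemma nn_rpos (β : E) : (0:ℝ) < nn β := by exact_mod_cast nn_pos β

lemma summable_nn {σ : ℝ} (hσ : 1 < σ) : Summable fun β : E => (nn β : ℝ) ^ (-σ) := by
  have h1 := EisensteinSeries.summable_one_div_norm_rpow (k := 2 * σ) (by linarith)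
  let f : E → (Fin 2 → ℤ) := fun β => ![(M β).re, (M β).im]
  have hf : Function.Injective f := by
    intro a b hab
    apply M_inj
    have h1 := congrFun hab 0
    have h2 := congrFun hab 1
    ext
    · simpa [f] using h1
    · simpa [f] using h2
  have h2 := (h1.comp_injective hf).mul_left ((4:ℝ) ^ σ)
  refine Summable.of_nonneg_of_le (fun β => by positivity) (fun β => ?_) h2
  simp only [Function.comp]
  have hne : f β ≠ 0 := by
    intro h
    apply M_ne_zero β
    have h1 := congrFun h 0
    have h2 := congrFun h 1
    ext
    · simpa [f] using h1
    · simpa [f] using h2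
  have hpos : 0 < ‖f β‖ := norm_pos_iff.2 hne
  have key : ‖f β‖ ^ 2 ≤ 4 * nn β := by
    have hle : ‖f β‖ ≤ Real.sqrt (4 * nn β) := by
      rw [pi_norm_le_iff_of_nonneg (Real.sqrt_nonneg _)]
      intro i
      apply Real.le_sqrt_of_sq_le
      rw [Int.norm_eq_abs, sq_abs, nn_real, norm_eq]
      fin_cases i
      · simp only [f]
        push_cast
        simp
        nlinarith [sq_nonneg ((1 + 3 * β.re : ℝ) - 2 * (3 * β.im)), sq_nonneg (1 + 3 * β.re : ℝ)]
      · simp only [f]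
        push_cast
        simp
        nlinarith [sq_nonneg (2 * (1 + 3 * β.re : ℝ) - (3 * β.im)), sq_nonneg (3 * β.im : ℝ)]
    calc ‖f β‖ ^ 2 ≤ Real.sqrt (4 * nn β) ^ 2 := by gcongr
      _ = _ := Real.sq_sqrt (by positivity)
  have e1 : ‖f β‖ ^ (-(2 * σ)) = (‖f β‖ ^ 2) ^ (-σ) := by
    rw [← Real.rpow_natCast, ← Real.rpow_mul hpos.le]; congr 1; push_cast; ring
  rw [e1]
  calc (nn β : ℝ) ^ (-σ) = 4 ^ σ * (4 * (nn β : ℝ)) ^ (-σ) := by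
        rw [Real.mul_rpow (by norm_num) (nn_rpos β).le, ← mul_assoc, ← Real.rpow_add (by norm_num)]; simp
    _ ≤ _ := by
      exact mul_le_mul_of_nonneg_left (Real.rpow_le_rpow_of_nonpos (by positivity) key (by linarith)) (by positivity)

lemma log_nn_nonneg (β : E) : 0 ≤ Real.log (nn β) := Real.log_natCast_nonneg _

lemma summable_log_nn {σ : ℝ} (hσ : 1 < σ) : Summable fun β : E => Real.log (nn β) * (nn β : ℝ) ^ (-σ) := by
  set ε := (σ - 1) / 2
  have hε : 0 < ε := by simp [ε]; linarith
  have h := (summable_nn (σ := σ - ε) (by simp [ε]; linarith)).mul_left (1 / ε)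
  refine Summable.of_nonneg_of_le (fun β => mul_nonneg (log_nn_nonneg β) (by positivity)) (fun β => ?_) h
  calc _ ≤ ((nn β : ℝ) ^ ε / ε) * (nn β : ℝ) ^ (-σ) := by
        gcongr
        exact Real.log_le_rpow_div (nn_rpos β).le hε
    _ = _ := by
      rw [show -(σ - ε) = ε + -σ by ring, Real.rpow_add (nn_rpos β)]; ring

lemma norm_cpow (β : E) (s : ℂ) : ‖(nn β : ℂ) ^ s‖ = (nn β : ℝ) ^ s.re :=
  Complex.norm_natCast_cpow_of_pos (nn_pos β) s

lemma cpow_diff {A B m : ℝ} (hm : 0 < m) (hA : m ≤ A) (hB : m ≤ B) {s : ℂ} (hs : 0 < s.re) :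
    ‖(A:ℂ) ^ (-s) - (B:ℂ) ^ (-s)‖ ≤ ‖s‖ * m ^ (-s.re - 1) * |A - B| := by
  have hs0 : -s ≠ 0 := by
    intro h
    have := congrArg Complex.re h
    simp at this; linarith
  refine Convex.norm_image_sub_le_of_norm_hasDerivWithin_le (f := fun t : ℝ => (t:ℂ) ^ (-s)) (𝕜 := ℝ)
    (f' := fun t : ℝ => (-s) * (t:ℂ) ^ (-s - 1)) (s := Set.Ici m) (fun x hx => ?_) (fun x hx => ?_) (convex_Ici m) hB hA
  · exact (hasDerivAt_ofReal_cpow_const (hm.trans_le hx).ne' hs0).hasDerivWithinAt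
  · have hx0 : 0 < x := hm.trans_le hx
    rw [norm_mul, _root_.norm_neg, Complex.norm_cpow_eq_rpow_re_of_pos hx0]
    gcongr
    simp only [Complex.sub_re, Complex.neg_re, Complex.one_re]
    exact Real.rpow_le_rpow_of_nonpos hm hx (by linarith)

lemma norm_shift (d : E) : ∃ C : ℝ, 0 ≤ C ∧ ∀ β, |(nn (β + d) : ℝ) - nn β| ≤ C * Real.sqrt (nn β) := by
  refine ⟨6 * Real.sqrt d.norm + 9 * d.norm, ?_, fun β => ?_⟩
  · have : (0:ℝ) ≤ d.norm := by exact_mod_cast norm_nonneg d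
    positivity
  have hd0 : (0:ℝ) ≤ d.norm := by exact_mod_cast norm_nonneg d
  set T : ℤ := 2 * (M β).re * d.re - (M β).re * d.im - (M β).im * d.re + 2 * (M β).im * d.im with hT
  have e : (nn (β + d) : ℝ) - nn β = 3 * (T : ℝ) + 9 * d.norm := by
    rw [nn_real, nn_real, norm_eq, norm_eq, norm_eq, hT]
    simp only [M_re, M_im, re_add, im_add]
    push_cast; ring
  have hT2 : (T:ℝ)^2 ≤ (2 * (Real.sqrt d.norm * Real.sqrt (nn β)))^2 := by
    rw [mul_pow, mul_pow, Real.sq_sqrt hd0, Real.sq_sqrt (nn_rpos β).le, nn_real]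
    have : T^2 ≤ 2^2 * (d.norm * (M β).norm) := by
      rw [norm_eq, norm_eq, hT]
      nlinarith [sq_nonneg ((M β).re * d.im - (M β).im * d.re)]
    exact_mod_cast this
  have hT3 : |(T:ℝ)| ≤ 2 * (Real.sqrt d.norm * Real.sqrt (nn β)) :=
    abs_le_of_sq_le_sq hT2 (by positivity)
  have h1 : 1 ≤ Real.sqrt (nn β) := Real.one_le_sqrt.2 (one_le_nn β)
  rw [e]
  calc |3 * (T : ℝ) + 9 * d.norm| ≤ |3 * (T:ℝ)| + |9 * (d.norm : ℝ)| := abs_add_le _ _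
    _ = 3 * |(T:ℝ)| + 9 * d.norm := by rw [abs_mul, abs_mul, abs_of_nonneg hd0]; norm_num
    _ ≤ 3 * (2 * (Real.sqrt d.norm * Real.sqrt (nn β))) + 9 * d.norm * Real.sqrt (nn β) := by
      have : 9 * (d.norm : ℝ) * 1 ≤ 9 * d.norm * Real.sqrt (nn β) := by gcongr
      linarith
    _ = _ := by ring

lemma term_bound (d : E) : ∃ K : ℝ, 1 ≤ K ∧ ∀ β, ∀ s : ℂ, 0 < s.re →
    ‖(nn β : ℂ) ^ (-s) - (nn (β + d) : ℂ) ^ (-s)‖ ≤ ‖s‖ * K ^ (s.re + 2) * (nn β : ℝ) ^ (-(s.re + 1/2)) := by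
  obtain ⟨C, hC0, hC⟩ := norm_shift d
  obtain ⟨C', hC0', hC'⟩ := norm_shift (-d)
  set K := 1 + C + C'
  have hK : 1 ≤ K := by simp only [K]; linarith
  refine ⟨K, hK, fun β s hs => ?_⟩
  set A : ℝ := (nn β : ℝ) with hAdef
  set B : ℝ := (nn (β + d) : ℝ) with hBdef
  have hA1 : 1 ≤ A := one_le_nn _
  have hB1 : 1 ≤ B := one_le_nn _
  have hAB : A ≤ K * B := by
    have := hC' (β + d)
    rw [add_neg_cancel_right, ← hAdef, ← hBdef] at this
    have h2 : Real.sqrt B ≤ B := (Real.sqrt_le_left (by linarith)).2 (by nlinarith)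
    have h3 := (abs_le.1 this).2
    have h4 : C' * Real.sqrt B ≤ C' * B := by gcongr
    simp only [K]
    nlinarith
  have h1 := cpow_diff (A := A) (B := B) (m := A / K) (by positivity) (div_le_self (by linarith) hK)
    (by rw [div_le_iff₀ (by linarith)]; linarith) hs
  have e : ((nn β : ℂ) ^ (-s) - (nn (β + d) : ℂ) ^ (-s)) = (A:ℂ) ^ (-s) - (B:ℂ) ^ (-s) := by simp [A, B]
  rw [e]
  refine h1.trans ?_
  have h2 : |A - B| ≤ K * A ^ (1/2 : ℝ) := by
    rw [abs_sub_comm, ← Real.sqrt_eq_rpow]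
    refine (hC β).trans ?_
    gcongr
    simp only [K]; linarith
  calc _ ≤ ‖s‖ * (A / K) ^ (-s.re - 1) * (K * A ^ (1/2 : ℝ)) := by gcongr
    _ = _ := by
      rw [Real.div_rpow (by linarith) (by linarith), div_eq_mul_inv, ← Real.rpow_neg (by linarith)]
      have e1 : K ^ (s.re + 2) = K ^ (-(-s.re - 1)) * K := by
        rw [← Real.rpow_add_one (by linarith)]; congr 1; ring
      have e2 : A ^ (-(s.re + 1/2)) = A ^ (-s.re - 1) * A ^ (1/2:ℝ) := by
        rw [← Real.rpow_add (by linarith)]; congr 1; ring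
      rw [e1, e2]; ring

/-- Hecke L series -/
noncomputable def Lf (e : E → ℂ) (s : ℂ) : ℂ := ∑' β, e β * (nn β : ℂ) ^ (-s)

/-- its continuation -/
noncomputable def Lc (d : E) (e : E → ℂ) (s : ℂ) : ℂ :=
  (1 - (e d)⁻¹)⁻¹ * ∑' β, e β * ((nn β : ℂ) ^ (-s) - (nn (β + d) : ℂ) ^ (-s))

lemma summable_Lf {e : E → ℂ} (he : IsCh e) {s : ℂ} (hs : 1 < s.re) :
    Summable fun β => ‖e β * (nn β : ℂ) ^ (-s)‖ := by
  simp_rw [norm_mul, he.norm, one_mul, norm_cpow]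
  exact summable_nn hs

lemma Lc_eq {e : E → ℂ} (he : IsCh e) {d : E} (hd : e d ≠ 1) {s : ℂ} (hs : 1 < s.re) : Lc d e s = Lf e s := by
  have h0 := (summable_Lf he hs).of_norm
  have hd0 : e d ≠ 0 := fun h => by simpa [h] using he.norm d
  have h1 : ∀ β, e β * (nn (β + d) : ℂ) ^ (-s) = (e d)⁻¹ * (e (β + d) * (nn (β + d) : ℂ) ^ (-s)) := by
    intro β
    rw [he.add]; field_simp
  have h2 : Summable fun β => e (β + d) * (nn (β + d) : ℂ) ^ (-s) := h0.comp_injective (add_left_injective d)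
  have h3 : ∑' β, e (β + d) * (nn (β + d) : ℂ) ^ (-s) = Lf e s :=
    (Equiv.addRight d).tsum_eq (fun β => e β * (nn β : ℂ) ^ (-s))
  unfold Lc
  simp_rw [mul_sub, h1]
  rw [h0.tsum_sub (h2.mul_left _), tsum_mul_left, h3]
  change (1 - (e d)⁻¹)⁻¹ * (Lf e s - _) = _
  have : 1 - (e d)⁻¹ ≠ 0 := by
    rw [sub_ne_zero]
    intro h
    exact hd (by rw [← inv_inv (e d), ← h, inv_one])
  field_simp

lemma cpow_diffble (β : E) : Differentiable ℂ fun s : ℂ => (nn β : ℂ) ^ (-s) := by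
  have : (nn β : ℂ) ≠ 0 := by exact_mod_cast (nn_pos β).ne'
  exact differentiable_id.neg.const_cpow (Or.inl this)

lemma Lc_diff {e : E → ℂ} (he : IsCh e) (d : E) : DifferentiableOn ℂ (Lc d e) {s | 1/2 < s.re} := by
  obtain ⟨K, hK, hb⟩ := term_bound d
  intro s₀ hs₀
  refine DifferentiableAt.differentiableWithinAt ?_
  simp only [Set.mem_ofPred_eq] at hs₀
  set a := (1/2 + s₀.re) / 2
  have ha : 1/2 < a := by simp only [a]; linarith
  have ha' : a < s₀.re := by simp only [a]; linarith
  set R := ‖s₀‖ + 1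
  let U : Set ℂ := {s | a < s.re} ∩ Metric.ball 0 R
  have hU : IsOpen U := (isOpen_lt continuous_const Complex.continuous_re).inter Metric.isOpen_ball
  have hs₀U : s₀ ∈ U := ⟨ha', by simp [R]⟩
  have hdiff : DifferentiableOn ℂ (fun s => ∑' β, e β * ((nn β : ℂ) ^ (-s) - (nn (β + d) : ℂ) ^ (-s))) U := by
    refine Complex.differentiableOn_tsum_of_summable_norm (u := fun β => R * K ^ (R + 2) * (nn β : ℝ) ^ (-(a + 1/2)))
      ((summable_nn (by linarith)).mul_left _) (fun β => ?_) hU (fun β s hs => ?_)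
    · exact (((cpow_diffble β).sub (cpow_diffble (β + d))).const_mul _).differentiableOn
    · have h1 : ‖s‖ < R := by simpa using hs.2
      have h2 : s.re ≤ R := (Complex.re_le_norm s).trans h1.le
      have h3 : a < s.re := hs.1
      rw [norm_mul, he.norm, one_mul]
      refine (hb β s (by linarith)).trans ?_
      have := one_le_nn β
      gcongr 
  exact ((hdiff.differentiableAt (hU.mem_nhds hs₀U)).const_mul _)

end E
end HeckeSum
end S11
end

section
namespace S11
section HeckeD
open QuadraticAlgebra Filter Topology
namespace E

/-- multiplicative summand -/
noncomputable def Ft (e : E → ℂ) (s : ℂ) (β : E) : ℂ := e β * (nn β : ℂ) ^ (-s)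

lemma Ft_op {e : E → ℂ} (he : IsCh e) (s : ℂ) (a b : E) : Ft e s (op a b) = Ft e s a * Ft e s b := by
  rw [Ft, Ft, Ft, he.op, nn_op, Nat.cast_mul, Complex.natCast_mul_natCast_cpow]; ring

lemma Ft_norm {e : E → ℂ} (he : IsCh e) (s : ℂ) (a : E) : ‖Ft e s a‖ = (nn a : ℝ) ^ (-s.re) := by
  rw [Ft, norm_mul, he.norm, one_mul, norm_cpow, Complex.neg_re]

/-- power in M coordinates: M (pw β k) = M β ^ (k+1) -/
def pw (β : E) : ℕ → E
  | 0 => β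
  | k+1 => op (pw β k) β

lemma M_pw (β : E) (k : ℕ) : M (pw β k) = M β ^ (k+1) := by
  induction k with
  | zero => simp [pw]
  | succ k ih => rw [pw, M_op, ih, pow_succ _ (k+1)]

lemma Ft_pw {e : E → ℂ} (he : IsCh e) (s : ℂ) (β : E) (k : ℕ) : Ft e s (pw β k) = Ft e s β ^ (k+1) := by
  induction k with
  | zero => simp [pw]
  | succ k ih => rw [pw, Ft_op he, ih, pow_succ _ (k+1)]

noncomputable def Dt (e : E → ℂ) (s : ℂ) (q : PP × ℕ) : ℂ := (Real.log (nn q.1.1) : ℂ) * Ft e s q.1.1 ^ (q.2 + 1)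

/-- log derivative -/
noncomputable def Dd (e : E → ℂ) (s : ℂ) : ℂ := ∑' q, Dt e s q

lemma Dt_norm {e : E → ℂ} (he : IsCh e) (s : ℂ) (q : PP × ℕ) :
    ‖Dt e s q‖ = Real.log (nn q.1.1) * ((nn q.1.1 : ℝ) ^ (-s.re)) ^ (q.2 + 1) := by
  rw [Dt, norm_mul, norm_pow, Ft_norm he, Complex.norm_real, Real.norm_of_nonneg (log_nn_nonneg _)]

lemma PP_ge (q : PP) : (4:ℝ) ≤ nn q.1 := by
  have : q.1 ≠ 0 := by
    intro h
    have := q.2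
    rw [h] at this
    exact this.not_isUnit (by simp [M])
  exact_mod_cast nn_ge_four this

lemma PP_rpow_le (q : PP) {σ : ℝ} (hσ : 1 ≤ σ) : (nn q.1 : ℝ) ^ (-σ) ≤ 1/4 := by
  have h := PP_ge q
  calc (nn q.1 : ℝ) ^ (-σ) ≤ (nn q.1 : ℝ) ^ (-1:ℝ) := by
        apply Real.rpow_le_rpow_of_exponent_le <;> linarith
    _ = (nn q.1 : ℝ)⁻¹ := Real.rpow_neg_one _
    _ ≤ 4⁻¹ := by gcongr
    _ = 1/4 := by norm_num

lemma summable_half (f : E → ℝ) (hf : Summable f) (hf0 : ∀ x, 0 ≤ f x) :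
    Summable fun q : PP × ℕ => f q.1.1 * (1/2 : ℝ) ^ q.2 := by
  have h1 : Summable fun q : PP => f q.1 := hf.comp_injective Subtype.val_injective
  exact h1.mul_of_nonneg (summable_geometric_two) (fun q => hf0 _) (fun k => by positivity)

lemma summable_Dt {e : E → ℂ} (he : IsCh e) {s : ℂ} (hs : 1 < s.re) : Summable fun q => ‖Dt e s q‖ := by
  refine Summable.of_nonneg_of_le (fun q => _root_.norm_nonneg _) (fun q => ?_)
    (summable_half _ (summable_log_nn hs) (fun x => mul_nonneg (log_nn_nonneg x) (by positivity)))
  rw [Dt_norm he, pow_succ', ← mul_assoc]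
  have := log_nn_nonneg q.1.1
  gcongr
  exact (PP_rpow_le q.1 hs.le).trans (by norm_num)

lemma deriv_Lf {e : E → ℂ} (he : IsCh e) {s : ℂ} (hs : 1 < s.re) :
    HasSum (fun β => -((Real.log (nn β) : ℂ) * Ft e s β)) (deriv (Lf e) s) := by
  set a := (1 + s.re) / 2
  have ha : 1 < a := by simp only [a]; linarith
  have ha' : a < s.re := by simp only [a]; linarith
  have h := Complex.hasSum_deriv_of_summable_norm (F := fun β s => Ft e s β) (U := {s | a < s.re}) (z := s)
    (u := fun β => (nn β : ℝ) ^ (-a)) (summable_nn ha)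
    (fun β => ((cpow_diffble β).const_mul _).differentiableOn)
    (isOpen_lt continuous_const Complex.continuous_re)
    (fun β w hw => by
      rw [Ft_norm he]
      have := one_le_nn β
      have hw' : a < w.re := hw
      gcongr) ha'
  have key : (fun β => -((Real.log (nn β) : ℂ) * Ft e s β)) = fun β => deriv (fun s => Ft e s β) s := by
   ext β
   have h0 : (nn β : ℂ) ≠ 0 := by exact_mod_cast (nn_pos β).ne'
   have h1 : HasDerivAt (fun s : ℂ => e β * (nn β : ℂ) ^ (-s)) (e β * ((nn β : ℂ) ^ (-s) * Complex.log (nn β) * (-1))) s :=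
    (((hasDerivAt_id s).neg).const_cpow (Or.inl h0)).const_mul _
   change _ = deriv (fun s : ℂ => e β * (nn β : ℂ) ^ (-s)) s
   rw [h1.deriv, Ft, Complex.natCast_log]; ring
  rw [key]; exact h

open scoped Classical in
lemma D_mul_L {e : E → ℂ} (he : IsCh e) {s : ℂ} (hs : 1 < s.re) : Dd e s * Lf e s = - deriv (Lf e) s := by
  have hD := summable_Dt he hs
  have hL := summable_Lf he hs
  -- double family
  let f : PP × ℕ → E → ℂ := fun q x => if M q.1.1 ^ (q.2 + 1) ∣ M x then (Real.log (nn q.1.1) : ℂ) * Ft e s x else 0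
  let g : (PP × ℕ) × E → (PP × ℕ) × E := fun z => (z.1, op (pw z.1.1.1 z.1.2) z.2)
  have hginj0 : ∀ q : PP × ℕ, Function.Injective fun y => op (pw q.1.1 q.2) y := by
    intro q y y' h
    have h2 := congrArg M h
    simp only [M_op] at h2
    exact M_inj (mul_left_cancel₀ (M_ne_zero _) h2)
  have hginj : Function.Injective g := by
    rintro ⟨q, y⟩ ⟨q', y'⟩ h
    simp only [g, Prod.mk.injEq] at h
    obtain ⟨rfl, h⟩ := h
    rw [hginj0 q h]
  have hfg0 : ∀ q y, f q (op (pw q.1.1 q.2) y) = Dt e s q * Ft e s y := by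
    intro q y
    simp only [f]
    rw [if_pos (by rw [M_op, M_pw]; exact dvd_mul_right _ _), Ft_op he, Ft_pw he, Dt]; ring
  have hsupp : ∀ q x, x ∉ Set.range (fun y => op (pw q.1.1 q.2) y) → f q x = 0 := by
    intro q x hx
    simp only [f]
    rw [if_neg]
    rintro ⟨y, hy⟩
    rw [← M_pw] at hy
    obtain ⟨δ, rfl⟩ := M_of_mul hy.symm
    rw [← M_op] at hy
    exact hx ⟨δ, (M_inj hy).symm⟩
  have hsum : Summable (Function.uncurry f) := by
    rw [← hginj.summable_iff]
    · have : Summable fun z : (PP × ℕ) × E => Dt e s z.1 * Ft e s z.2 :=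
        summable_mul_of_summable_norm hD hL
      refine this.congr fun z => ?_
      simp only [g, Function.comp, Function.uncurry]
      rw [hfg0]
    · rintro ⟨q, x⟩ hz
      refine hsupp q x fun hx => ?_
      obtain ⟨y, hy⟩ := hx
      exact hz ⟨(q, y), by simp only [g]; rw [← hy]⟩
  have h1 : Dd e s * Lf e s = ∑' q, ∑' x, f q x := by
    have e1 : ∀ q, ∑' x, f q x = Dt e s q * Lf e s := by
      intro q
      rw [← (hginj0 q).tsum_eq]
      · simp_rw [hfg0]
        rw [tsum_mul_left]; rfl
      · intro x hx
        by_contra h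
        exact hx (hsupp q x h)
    simp_rw [e1]
    rw [tsum_mul_right]; rfl
  have h2 : ∀ x, ∑' q, f q x = (Real.log (nn x) : ℂ) * Ft e s x := by
    intro x
    have h := log_hasSum (M x) (M_ne_zero x) (by have := norm_M_mod x; omega)
    rw [← nn_real] at h
    have h' := (Complex.hasSum_ofReal.2 h).mul_right (Ft e s x)
    rw [← h'.tsum_eq]
    congr 1
    ext q
    simp only [f]
    split_ifs <;> simp
  rw [h1, ← hsum.tsum_comm]
  simp_rw [h2]
  rw [← (deriv_Lf he hs).tsum_eq, tsum_neg, neg_neg]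

/-- degree one part -/
noncomputable def D1 (e : E → ℂ) (s : ℂ) : ℂ :=
  ∑' β, if (nn β).Prime then (Real.log (nn β) : ℂ) * Ft e s β else 0

noncomputable def Rr (e : E → ℂ) (s : ℂ) : ℂ :=
  ∑' q : PP × ℕ, if q.2 = 0 ∧ (nn q.1.1).Prime then 0 else Dt e s q

lemma Dd_split {e : E → ℂ} (he : IsCh e) {s : ℂ} (hs : 1 < s.re) : Dd e s = D1 e s + Rr e s := by
  have h0 := (summable_Dt he hs).of_norm
  have hn := summable_Dt he hs
  have hA : Summable fun q : PP × ℕ => if q.2 = 0 ∧ (nn q.1.1).Prime then Dt e s q else 0 := by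
    refine Summable.of_norm_bounded hn fun q => ?_
    split_ifs <;> simp
  have hB : Summable fun q : PP × ℕ => if q.2 = 0 ∧ (nn q.1.1).Prime then 0 else Dt e s q := by
    refine Summable.of_norm_bounded hn fun q => ?_
    split_ifs <;> simp
  have e1 : D1 e s = ∑' q : PP × ℕ, if q.2 = 0 ∧ (nn q.1.1).Prime then Dt e s q else 0 := by
    let i : {β : E // (nn β).Prime} → PP × ℕ := fun β => (⟨β.1, prime_of_nn β.2⟩, 0)
    have hi : Function.Injective i := by
      rintro ⟨a, _⟩ ⟨b, _⟩ h
      simp only [i, Prod.mk.injEq, Subtype.mk.injEq] at h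
      exact Subtype.ext h.1
    rw [← hi.tsum_eq, D1, ← (Subtype.val_injective (p := fun β : E => (nn β).Prime)).tsum_eq]
    · congr 1; ext ⟨β, hβ⟩
      simp [i, Dt, hβ]
    · intro β hβ
      simp only [Subtype.range_coe_subtype]
      by_contra h
      exact hβ (if_neg h)
    · rintro ⟨⟨β, hp⟩, k⟩ hβ
      by_contra h
      apply hβ
      refine if_neg ?_
      rintro ⟨rfl : k = 0, h2⟩
      exact h ⟨⟨β, h2⟩, rfl⟩
  rw [e1, Rr, ← hA.tsum_add hB, Dd]
  congr 1; ext q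
  split_ifs <;> simp

lemma summable_inert : Summable fun β : E => if β.im = 0 then Real.log (nn β) * (nn β : ℝ)⁻¹ else 0 := by
  let i : ℤ → E := fun u => ⟨u, 0⟩
  have hi : Function.Injective i := fun a b h => congrArg QuadraticAlgebra.re h
  rw [← hi.summable_iff]
  · have h1 := Real.summable_abs_int_rpow (b := 3/2) (by norm_num)
    have h2 : Function.Injective fun u : ℤ => 1 + 3 * u := by intro a b h; simp at h; exact h
    have h3 := (h1.comp_injective h2).mul_left 4
    refine Summable.of_nonneg_of_le (fun u => ?_) (fun u => ?_) h3
    · simp only [Function.comp, i, if_true]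
      exact mul_nonneg (log_nn_nonneg _) (by positivity)
    · simp only [Function.comp, i, if_true]
      have e : (nn (⟨u, 0⟩ : E) : ℝ) = |((1 + 3 * u : ℤ) : ℝ)| ^ (2:ℝ) := by
        rw [nn_real, norm_eq]
        simp
      have hp : 0 < |((1 + 3 * u : ℤ) : ℝ)| := by
        rw [abs_pos]
        have : 1 + 3 * u ≠ 0 := by omega
        exact_mod_cast this
      set t := |((1 + 3 * u : ℤ) : ℝ)|
      have hl := Real.log_le_rpow_div (x := t ^ (2:ℝ)) (ε := 1/4) (by positivity) (by norm_num)
      rw [e]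
      calc _ ≤ ((t ^ (2:ℝ)) ^ (1/4 : ℝ) / (1/4)) * (t ^ (2:ℝ))⁻¹ := by gcongr
        _ = _ := by
          rw [← Real.rpow_mul hp.le, ← Real.rpow_neg hp.le, show (-(3/2) : ℝ) = 2 * (1/4) + -2 by norm_num,
            Real.rpow_add hp]; ring
  · intro x hx
    rw [if_neg]
    intro h
    exact hx ⟨x.re, by ext <;> simp [i, h]⟩

lemma Rr_cont {e : E → ℂ} (he : IsCh e) : ContinuousOn (Rr e) {s | 1 ≤ s.re} := by
  let v : E → ℝ := fun β => 4 * (Real.log (nn β) * (nn β : ℝ) ^ (-2:ℝ)) + (if β.im = 0 then Real.log (nn β) * (nn β : ℝ)⁻¹ else 0)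
  have hv : Summable v := ((summable_log_nn (by norm_num)).mul_left 4).add summable_inert
  have hv1 : ∀ β : E, 0 ≤ Real.log (nn β) * (nn β : ℝ) ^ (-2:ℝ) := fun β => mul_nonneg (log_nn_nonneg _) (by positivity)
  have hv2 : ∀ β : E, 0 ≤ (if β.im = 0 then Real.log (nn β) * (nn β : ℝ)⁻¹ else 0) := by
    intro β
    split_ifs
    · exact mul_nonneg (log_nn_nonneg _) (by positivity)
    · exact le_rfl
  have hv0 : ∀ β, 0 ≤ v β := fun β => by have := hv1 β; have := hv2 β; simp only [v]; linarith
  refine continuousOn_tsum (u := fun q : PP × ℕ => v q.1.1 * (1/2 : ℝ) ^ q.2) (fun q => ?_) (summable_half v hv hv0) ?_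
  · split_ifs
    · exact continuousOn_const
    · exact ((((cpow_diffble q.1.1).const_mul _).pow _).const_mul _).continuous.continuousOn
  · rintro ⟨q, k⟩ s hs
    have hs' : 1 ≤ s.re := hs
    have hl := log_nn_nonneg q.1
    have h1 := one_le_nn q.1
    split_ifs with hc
    · rw [_root_.norm_zero]
      exact mul_nonneg (hv0 _) (by positivity)
    · rw [Dt_norm he]
      simp only [not_and] at hc
      have hb1 : (nn q.1 : ℝ) ^ (-s.re) ≤ (nn q.1 : ℝ)⁻¹ := by
        rw [← Real.rpow_neg_one]
        gcongr
      have hb2 := PP_rpow_le q hs'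
      rcases k with _ | k
      · have him := inert_im q.2 (hc rfl)
        simp only [zero_add, pow_one, pow_zero, mul_one, v, him, if_true]
        have := hv1 q.1
        have : Real.log (nn q.1) * (nn q.1 : ℝ) ^ (-s.re) ≤ Real.log (nn q.1) * (nn q.1 : ℝ)⁻¹ := by gcongr
        linarith
      · have e1 : Real.log (nn q.1) * ((nn q.1 : ℝ) ^ (-s.re)) ^ (k + 1 + 1) ≤
            Real.log (nn q.1) * (nn q.1 : ℝ) ^ (-2:ℝ) * (1/4)^k := by
          have e2 : (nn q.1 : ℝ) ^ (-2:ℝ) = (nn q.1 : ℝ)⁻¹ * (nn q.1 : ℝ)⁻¹ := by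
            rw [show (-2:ℝ) = -1 + -1 by norm_num, Real.rpow_add (by linarith), Real.rpow_neg_one]
          rw [e2, mul_assoc]
          gcongr
          rw [pow_succ, pow_succ, mul_assoc, mul_comm]
          gcongr
        refine e1.trans ?_
        have e3 : ((1:ℝ)/4)^k ≤ 4 * (1/2)^(k+1) := by
          have h4 : ((1:ℝ)/4)^k ≤ (1/2)^k := by gcongr; norm_num
          rw [pow_succ]
          have : (0:ℝ) ≤ (1/2)^k := by positivity
          linarith
        calc _ ≤ Real.log (nn q.1) * (nn q.1 : ℝ) ^ (-2:ℝ) * (4 * (1/2)^(k+1)) := by gcongr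
          _ ≤ _ := by
            have h5 : (0:ℝ) ≤ (1/2)^(k+1) := by positivity
            have := mul_nonneg (hv2 q.1) h5
            simp only [v]
            nlinarith

end E
end HeckeD
end S11
end

section
namespace S11
section HeckeT
open QuadraticAlgebra Filter Topology ArithmeticFunction

open vonMangoldt in
lemma prime_class (q : ℕ) [NeZero q] {a : ZMod q} (ha : IsUnit a) :
    ∃ G : ℂ → ℂ, ContinuousOn G {s | 1 ≤ s.re} ∧ ∀ s : ℂ, 1 < s.re →
      LSeries (fun n => ((({n : ℕ | n.Prime ∧ (n : ZMod q) = a}.indicator (fun k => Real.log k) n : ℝ)) : ℂ)) s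
        = ((q.totient : ℂ)⁻¹) / (s - 1) + G s := by
  classical
  let H : ℂ → ℂ := fun s => ∑' n : ℕ, LSeries.term (fun n => ((if n.Prime then 0 else residueClass a n : ℝ) : ℂ)) s n
  have hbd : ∀ n : ℕ, ∀ s ∈ {s : ℂ | 1 ≤ s.re}, ‖LSeries.term (fun n => ((if n.Prime then 0 else residueClass a n : ℝ) : ℂ)) s n‖
      ≤ (if n.Prime then 0 else residueClass a n) / n := by
    intro n s hs
    have hs' : 1 ≤ s.re := hs
    have h0 : 0 ≤ (if n.Prime then 0 else residueClass a n) := by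
      split_ifs
      · exact le_rfl
      · exact residueClass_nonneg a n
    rcases Nat.eq_zero_or_pos n with rfl | hn
    · simp
    · rw [LSeries.term_of_ne_zero hn.ne', norm_div, Complex.norm_real, Real.norm_of_nonneg h0,
        Complex.norm_natCast_cpow_of_pos hn]
      have h1 : (1:ℝ) ≤ n := by exact_mod_cast hn
      gcongr
      calc (n:ℝ) = (n:ℝ) ^ (1:ℝ) := (Real.rpow_one _).symm
        _ ≤ _ := by gcongr
  have hH : ContinuousOn H {s | 1 ≤ s.re} := by
    refine continuousOn_tsum (fun n => ?_) (summable_residueClass_non_primes_div a) hbd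
    rcases Nat.eq_zero_or_pos n with rfl | hn
    · simp only [LSeries.term_zero]; exact continuousOn_const
    · simp only [LSeries.term_of_ne_zero hn.ne']
      have h0 : (n:ℂ) ≠ 0 := by exact_mod_cast hn.ne'
      have : Continuous fun s : ℂ => (n:ℂ) ^ s := (differentiable_id.const_cpow (Or.inl h0)).continuous
      exact (continuous_const.div this (fun s => by simp [Complex.cpow_eq_zero_iff, h0])).continuousOn
  refine ⟨fun s => LFunctionResidueClassAux a s - H s, (continuousOn_LFunctionResidueClassAux a).sub hH, fun s hs => ?_⟩
  have h1 := eqOn_LFunctionResidueClassAux ha (show s ∈ {s : ℂ | 1 < s.re} from hs)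
  simp only at h1
  beta_reduce
  rw [h1]
  have hs1 : LSeriesSummable (fun n => ((residueClass a n : ℝ) : ℂ)) s :=
    LSeriesSummable_of_abscissaOfAbsConv_lt_re ((abscissaOfAbsConv_residueClass_le_one a).trans_lt (by exact_mod_cast hs))
  have hs2 : LSeriesSummable (fun n => ((if n.Prime then 0 else residueClass a n : ℝ) : ℂ)) s :=
    Summable.of_norm_bounded (summable_residueClass_non_primes_div a) (fun n => hbd n s (by exact hs.le))
  have e1 : LSeries (fun n => ((({n : ℕ | n.Prime ∧ (n : ZMod q) = a}.indicator (fun k => Real.log k) n : ℝ)) : ℂ)) s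
      = LSeries (fun n => ((residueClass a n : ℝ) : ℂ)) s - H s := by
    change _ = _ - LSeries _ s
    rw [← LSeries_sub hs1 hs2]
    congr 1
    ext n
    simp only [Pi.sub_apply, residueClass, Set.indicator_apply, Set.mem_ofPred_eq]
    by_cases hp : n.Prime
    · simp [hp, vonMangoldt_apply_prime hp]
    · simp [hp]
  rw [e1]; ring

namespace E

open scoped Classical in
lemma fiber_sum (W : ℕ → ℝ) (hW : ∀ n, |W n| ≤ 1) {s : ℂ} (hs : 1 < s.re) :
    (∑' β : E, if (nn β).Prime then ((W (nn β) : ℝ) : ℂ) * ((Real.log (nn β) : ℂ) * (nn β : ℂ) ^ (-s)) else 0) =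
    2 * LSeries (fun n => ((if n.Prime ∧ n % 3 = 1 then W n * Real.log n else 0 : ℝ) : ℂ)) s := by
  set f : E → ℂ := fun β => if (nn β).Prime then ((W (nn β) : ℝ) : ℂ) * ((Real.log (nn β) : ℂ) * (nn β : ℂ) ^ (-s)) else 0
  have hf : Summable f := by
    refine Summable.of_norm_bounded (summable_log_nn hs) fun β => ?_
    simp only [f]
    split_ifs
    · rw [norm_mul, norm_mul, norm_cpow, Complex.norm_real, Complex.norm_real, Real.norm_of_nonneg (log_nn_nonneg β)]
      have := mul_nonneg (log_nn_nonneg β) (Real.rpow_nonneg (nn_rpos β).le (-s).re)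
      calc _ ≤ 1 * (Real.log (nn β) * (nn β : ℝ) ^ (-s).re) := by gcongr; exact hW _
        _ = _ := by simp
    · rw [_root_.norm_zero]
      exact mul_nonneg (log_nn_nonneg β) (by positivity)
  have h := hf.hasSum.tsum_fiberwise nn
  rw [← h.tsum_eq, LSeries, ← tsum_mul_left]
  congr 1; ext n
  by_cases hn : n.Prime ∧ n % 3 = 1
  · obtain ⟨β, hβ⟩ := exists_nn hn.1 hn.2
    have hset : nn ⁻¹' {n} = (({β, star β} : Finset E) : Set E) := by
      ext γ
      simp only [Set.mem_preimage, Set.mem_singleton_iff, Finset.coe_insert, Finset.coe_singleton, Set.mem_insert_iff]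
      constructor
      · intro h
        exact nn_fiber (hβ ▸ hn.1) (h.trans hβ.symm)
      · rintro (rfl | rfl)
        · exact hβ
        · rw [nn_star, hβ]
    have hne : β ≠ star β := (star_ne (hβ ▸ hn.1)).symm
    rw [hset, Finset.tsum_subtype', Finset.sum_pair hne, LSeries.term_of_ne_zero hn.1.ne_zero]
    simp only [f, nn_star, hβ]
    rw [if_pos hn.1, if_pos hn, Complex.cpow_neg]
    push_cast
    ring
  · have h0 : ∀ b : nn ⁻¹' {n}, f b = 0 := by
      rintro ⟨b, hb : nn b = n⟩
      simp only [f]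
      rw [if_neg]
      intro hp
      exact hn ⟨hb ▸ hp, hb ▸ nn_mod b⟩
    simp_rw [h0]
    rw [tsum_zero]
    simp [LSeries.term, hn]

lemma isCh_one : IsCh (fun _ => 1) := ⟨fun _ _ => by simp, fun _ => rfl, fun _ => by simp⟩

lemma D1_triv : ∃ G : ℂ → ℂ, ContinuousOn G {s | 1 ≤ s.re} ∧ ∀ s : ℂ, 1 < s.re →
    D1 (fun _ => 1) s = 1 / (s - 1) + G s := by
  obtain ⟨G, hG, h⟩ := prime_class 3 (a := 1) isUnit_one
  refine ⟨fun s => 2 * G s, continuousOn_const.mul hG, fun s hs => ?_⟩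
  have h1 := fiber_sum (fun _ => 1) (fun _ => by simp) hs
  have h2 : D1 (fun _ => 1) s = 2 * LSeries (fun n => ((if n.Prime ∧ n % 3 = 1 then Real.log n else 0 : ℝ) : ℂ)) s := by
    rw [D1]
    simp only [Ft, one_mul]
    simp only [Complex.ofReal_one, one_mul] at h1
    exact h1
  rw [h2]
  have h3 := h s hs
  have e : (fun n : ℕ => ((if n.Prime ∧ n % 3 = 1 then Real.log n else 0 : ℝ) : ℂ)) =
      (fun n => ((({n : ℕ | n.Prime ∧ (n : ZMod 3) = 1}.indicator (fun k => Real.log k) n : ℝ)) : ℂ)) := by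
    classical
    ext n
    simp only [Set.indicator_apply, Set.mem_ofPred_eq]
    have : (n : ZMod 3) = 1 ↔ n % 3 = 1 := by
      rw [← Nat.cast_one, ZMod.natCast_eq_natCast_iff']
    simp only [this]
  rw [e, h3]
  have : Nat.totient 3 = 2 := by decide
  rw [this]
  push_cast; ring

end E
end HeckeT
end S11
end

section
namespace S11
section HeckeN
open QuadraticAlgebra Filter Topology

lemma order_lim {f : ℂ → ℂ} {s0 : ℂ} (hf : AnalyticAt ℂ f s0) (h0 : ¬ ∀ᶠ z in 𝓝 s0, f z = 0) :
    ∃ m : ℕ, (f s0 = 0 → 1 ≤ m) ∧ (∀ᶠ z in 𝓝[≠] s0, f z ≠ 0) ∧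
      Tendsto (fun s => (s - s0) * (deriv f s / f s)) (𝓝[≠] s0) (𝓝 (m:ℂ)) := by
  obtain ⟨n, g, hg, hg0, hfg⟩ := hf.exists_eventuallyEq_pow_smul_nonzero_iff.2 h0
  have hne : ∀ᶠ z in 𝓝 s0, g z ≠ 0 := hg.continuousAt.eventually_ne hg0
  have hmem : ∀ᶠ z in 𝓝[≠] s0, z ≠ s0 := eventually_mem_nhdsWithin
  refine ⟨n, fun hz => ?_, ?_, ?_⟩
  · by_contra hn
    have : n = 0 := by omega
    subst this
    have := hfg.self_of_nhds
    simp [hz] at this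
    exact hg0 this.symm
  · filter_upwards [hfg.filter_mono nhdsWithin_le_nhds, hne.filter_mono nhdsWithin_le_nhds, hmem] with z h1 h2 h3
    rw [h1]
    exact smul_ne_zero (pow_ne_zero _ (sub_ne_zero.2 h3)) h2
  · have hd : ∀ᶠ z in 𝓝 s0, deriv f z = deriv (fun z => (z - s0) ^ n * g z) z := by
      have : f =ᶠ[𝓝 s0] fun z => (z - s0) ^ n * g z := hfg
      exact this.deriv
    have hga := hg.eventually_analyticAt
    have hT : Tendsto (fun s => (n:ℂ) + (s - s0) * (deriv g s / g s)) (𝓝[≠] s0) (𝓝 (n:ℂ)) := by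
      have hc : ContinuousAt (fun s => (n:ℂ) + (s - s0) * (deriv g s / g s)) s0 := by
        have := hg.deriv.continuousAt
        have h2 := hg.continuousAt
        exact continuousAt_const.add ((continuousAt_id.sub continuousAt_const).mul (this.div h2 hg0))
      have := hc.tendsto
      simp only [sub_self, zero_mul, add_zero] at this
      exact this.mono_left nhdsWithin_le_nhds
    refine hT.congr' ?_
    filter_upwards [hfg.filter_mono nhdsWithin_le_nhds, hne.filter_mono nhdsWithin_le_nhds, hmem,
      hd.filter_mono nhdsWithin_le_nhds, hga.filter_mono nhdsWithin_le_nhds] with z h1 h2 h3 h4 h5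
    rw [h4, h1]
    have hz := sub_ne_zero.2 h3
    have hD : HasDerivAt (fun z => (z - s0) ^ n * g z) ((n * (z - s0)^(n-1)) * g z + (z - s0)^n * deriv g z) z := by
      have e1 : HasDerivAt (fun z => (z - s0) ^ n) (n * (z - s0)^(n-1)) z := by
        have := ((hasDerivAt_id z).sub_const s0).pow n
        simp only [mul_one, id] at this
        exact this
      exact e1.mul h5.differentiableAt.hasDerivAt
    rw [hD.deriv, smul_eq_mul]
    rcases n with _ | k
    · simp
    · simp only [Nat.add_sub_cancel]
      field_simp
      ring

namespace E

lemma IsCh.zero {e : E → ℂ} (he : IsCh e) : e 0 = 1 := by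
  have h := he.add 0 0
  rw [add_zero] at h
  have h1 : e 0 ≠ 0 := by
    intro h0
    have := he.norm 0
    simp [h0] at this
  exact (mul_left_cancel₀ h1 (by rw [← h, mul_one])).symm

lemma Lf_ne {e : E → ℂ} (he : IsCh e) : ∃ σ : ℝ, 1 < σ ∧ Lf e σ ≠ 0 := by
  have hT : Tendsto (fun σ : ℝ => Lf e σ) atTop (𝓝 (∑' β : E, if β = 0 then 1 else 0)) := by
    refine tendsto_tsum_of_dominated_convergence (summable_nn (σ := 2) (by norm_num)) (fun β => ?_) ?_
    · by_cases hb : β = 0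
      · subst hb
        have : nn 0 = 1 := by simp [nn, M, QuadraticAlgebra.norm_one]
        simp [this, he.zero]
      · rw [if_neg hb, tendsto_zero_iff_norm_tendsto_zero]
        have h4 := nn_ge_four hb
        have h4' : (4:ℝ) ≤ nn β := by exact_mod_cast h4
        simp only [norm_mul, he.norm, one_mul, norm_cpow]
        simp only [Complex.neg_re, Complex.ofReal_re]
        exact (tendsto_rpow_atBot_of_base_gt_one _ (by linarith)).comp tendsto_neg_atTop_atBot
    · filter_upwards [eventually_ge_atTop 2] with σ hσ β
      rw [norm_mul, he.norm, one_mul, norm_cpow]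
      have := one_le_nn β
      simp only [Complex.neg_re, Complex.ofReal_re]
      gcongr
  rw [tsum_ite_eq] at hT
  have := (hT.eventually_ne one_ne_zero).and (eventually_gt_atTop 1)
  obtain ⟨σ, h1, h2⟩ := this.exists
  exact ⟨σ, h2, h1⟩

lemma isOpen_half (a : ℝ) : IsOpen {s : ℂ | a < s.re} := isOpen_lt continuous_const Complex.continuous_re

lemma Lc_analytic {e : E → ℂ} (he : IsCh e) (d : E) : AnalyticOnNhd ℂ (Lc d e) {s | 1/2 < s.re} :=
  (Lc_diff he d).analyticOnNhd (isOpen_half _)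

lemma Lc_not_zero {e : E → ℂ} (he : IsCh e) {d : E} (hd : e d ≠ 1) {s : ℂ} (hs : 1 ≤ s.re) :
    ¬ ∀ᶠ z in 𝓝 s, Lc d e z = 0 := by
  intro h
  have h1 := (Lc_analytic he d).eqOn_zero_of_preconnected_of_eventuallyEq_zero
    (convex_halfSpace_re_gt (1/2)).isPreconnected (show s ∈ {s : ℂ | 1/2 < s.re} from by
      simp only [Set.mem_ofPred_eq]; linarith) h
  obtain ⟨σ, hσ, h2⟩ := Lf_ne he
  apply h2
  rw [← Lc_eq he hd (by simpa using hσ)]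
  exact h1 (by simp only [Set.mem_ofPred_eq, Complex.ofReal_re]; linarith)

lemma Dd_Lc {e : E → ℂ} (he : IsCh e) {d : E} (hd : e d ≠ 1) {s : ℂ} (hs : 1 < s.re) :
    Dd e s * Lc d e s = - deriv (Lc d e) s := by
  rw [Lc_eq he hd hs, D_mul_L he hs]
  congr 1
  apply Filter.EventuallyEq.deriv_eq
  filter_upwards [(isOpen_half 1).mem_nhds hs] with z hz
  exact (Lc_eq he hd hz).symm

/-- approach from the right -/
lemma ray (s0 : ℂ) : Tendsto (fun ε : ℝ => s0 + ε) (𝓝[>] 0) (𝓝[≠] s0) := by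
  refine tendsto_nhdsWithin_iff.2 ⟨?_, ?_⟩
  · have : Continuous fun ε : ℝ => s0 + ε := by fun_prop
    have := this.tendsto 0
    simp only [Complex.ofReal_zero, add_zero] at this
    exact this.mono_left nhdsWithin_le_nhds
  · filter_upwards [self_mem_nhdsWithin] with ε hε
    have : (0:ℝ) < ε := hε
    simp [this.ne']

lemma Dd_lim {e : E → ℂ} (he : IsCh e) {d : E} (hd : e d ≠ 1) {s : ℂ} (hs : 1 ≤ s.re) :
    ∃ m : ℕ, (Lc d e s = 0 → 1 ≤ m) ∧ Tendsto (fun ε : ℝ => (ε:ℂ) * Dd e (s + ε)) (𝓝[>] 0) (𝓝 (-(m:ℂ))) := by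
  obtain ⟨m, hm, h1, h2⟩ := order_lim (Lc_analytic he d s (by simp only [Set.mem_ofPred_eq]; linarith)) (Lc_not_zero he hd hs)
  refine ⟨m, hm, ?_⟩
  refine (h2.comp (ray s)).neg.congr' ?_
  filter_upwards [(ray s).eventually h1, self_mem_nhdsWithin] with ε h3 h4
  have h4' : (0:ℝ) < ε := h4
  have h5 := Dd_Lc he hd (s := s + ε) (by simp; linarith)
  have : Dd e (s + ε) = - deriv (Lc d e) (s + ε) / Lc d e (s + ε) := by
    rw [← h5, mul_div_cancel_right₀ _ h3]
  rw [this]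
  simp only [Function.comp, add_sub_cancel_left]
  ring

lemma Lc_ne_gt {e : E → ℂ} (he : IsCh e) {d : E} (hd : e d ≠ 1) {s : ℂ} (hs : 1 < s.re) : Lc d e s ≠ 0 := by
  intro h0
  obtain ⟨m, hm, h⟩ := Dd_lim he hd hs.le
  have h1 := hm h0
  have hz : Tendsto (fun ε : ℝ => (ε:ℂ) * Dd e (s + ε)) (𝓝[>] 0) (𝓝 0) := by
    rw [tendsto_zero_iff_norm_tendsto_zero]
    have hb : Tendsto (fun ε : ℝ => ε * ∑' q, ‖Dt e s q‖) (𝓝[>] 0) (𝓝 0) := by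
      have : Continuous fun ε : ℝ => ε * ∑' q, ‖Dt e s q‖ := by fun_prop
      have := this.tendsto 0
      rw [zero_mul] at this
      exact this.mono_left nhdsWithin_le_nhds
    refine squeeze_zero' (Eventually.of_forall fun _ => _root_.norm_nonneg _) ?_ hb
    filter_upwards [self_mem_nhdsWithin] with ε hε
    have hε' : (0:ℝ) < ε := hε
    rw [norm_mul, Complex.norm_real, Real.norm_of_nonneg hε'.le]
    have hs' : 1 < (s + ε).re := by simp; linarith
    gcongr
    refine (norm_tsum_le_tsum_norm (summable_Dt he hs')).trans ?_
    refine (summable_Dt he hs').tsum_le_tsum (fun q => ?_) (summable_Dt he hs)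
    rw [Dt_norm he, Dt_norm he]
    have := one_le_nn q.1.1
    have := log_nn_nonneg q.1.1
    rw [Complex.add_re, Complex.ofReal_re]
    gcongr
    linarith
  have := tendsto_nhds_unique h hz
  have : m = 0 := by simpa using this
  omega

lemma tfo {c : ℝ} (hc : 0 < c) {A B : ℂ} (hA : ‖A‖ = c) (hB : B * c = A ^ 2) : 0 ≤ 3 * c + 4 * A.re + B.re := by
  have h1 : B.re * c = A.re ^ 2 - A.im ^ 2 := by
    have := congrArg Complex.re hB
    simp [pow_two] at this
    rw [this]; ring
  have h2 : A.re ^ 2 + A.im ^ 2 = c ^ 2 := by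
    rw [← hA, ← Complex.normSq_eq_norm_sq, Complex.normSq_apply]; ring
  have h3 : 0 ≤ (3 * c + 4 * A.re + B.re) * c := by
    have : (3 * c + 4 * A.re + B.re) * c = 2 * (c + A.re)^2 := by linear_combination h1 - h2
    rw [this]; positivity
  exact nonneg_of_mul_nonneg_left h3 hc

lemma IsCh.sq {e : E → ℂ} (he : IsCh e) : IsCh (fun β => e β ^ 2) :=
  ⟨fun a b => by rw [he.add, mul_pow], fun a => by rw [he.three, one_pow], fun a => by rw [norm_pow, he.norm, one_pow]⟩

lemma IsCh.sq_ne {e : E → ℂ} (he : IsCh e) {d : E} (hd : e d ≠ 1) : e d ^ 2 ≠ 1 := by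
  intro h
  have h3 : e d ^ 3 = 1 := by
    rw [← he.three d, show (3:E) * d = d + d + d by ring, he.add, he.add]; ring
  apply hd
  rw [pow_succ, h, one_mul] at h3
  exact h3

lemma tfo_Dd {e : E → ℂ} (he : IsCh e) (t : ℝ) {ε : ℝ} (hε : 0 < ε) :
    0 ≤ 3 * (Dd (fun _ => 1) (1 + ε)).re + 4 * (Dd e (1 + t * Complex.I + ε)).re
      + (Dd (fun β => e β ^ 2) (1 + (2 * t : ℝ) * Complex.I + ε)).re := by
  have hs0 : 1 < (1 + (ε:ℂ)).re := by simpa using hε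
  have hs1 : 1 < (1 + t * Complex.I + (ε:ℂ)).re := by simpa using hε
  have hs2 : 1 < (1 + (2 * t : ℝ) * Complex.I + (ε:ℂ)).re := by simpa using hε
  have k0 := Complex.hasSum_re (summable_Dt isCh_one hs0).of_norm.hasSum
  have k1 := Complex.hasSum_re (summable_Dt he hs1).of_norm.hasSum
  have k2 := Complex.hasSum_re (summable_Dt he.sq hs2).of_norm.hasSum
  have k := ((k0.mul_left 3).add (k1.mul_left 4)).add k2
  refine k.nonneg fun q => ?_
  set β := q.1.1
  have hl := log_nn_nonneg β
  have hx := nn_rpos β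
  set x : ℝ := (nn β : ℝ) ^ (-(1 + ε)) with hxdef
  have hxp : 0 < x := by positivity
  have f0 : Ft (fun _ => 1) (1 + ε) β = x := by
    rw [Ft, one_mul, hxdef, Complex.ofReal_cpow hx.le]; push_cast; rfl
  have f1 : ‖Ft e (1 + t * Complex.I + ε) β‖ = x := by
    rw [Ft_norm he]; simp [hxdef]
  have hnz : (nn β : ℂ) ≠ 0 := by exact_mod_cast (nn_pos β).ne'
  have f2 : Ft (fun β => e β ^ 2) (1 + (2 * t : ℝ) * Complex.I + ε) β * x = Ft e (1 + t * Complex.I + ε) β ^ 2 := by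
    rw [← f0, Ft, Ft, Ft, one_mul, mul_assoc, ← Complex.cpow_add _ _ hnz, mul_pow, pow_two ((nn β : ℂ) ^ _), ← Complex.cpow_add _ _ hnz]
    congr 2
    push_cast; ring
  simp only [Dt, Complex.re_ofReal_mul]
  rw [f0]
  have := tfo (c := x ^ (q.2 + 1)) (by positivity) (A := Ft e (1 + t * Complex.I + ε) β ^ (q.2 + 1))
    (B := Ft (fun β => e β ^ 2) (1 + (2 * t : ℝ) * Complex.I + ε) β ^ (q.2 + 1)) (by rw [norm_pow, f1])
    (by rw [Complex.ofReal_pow, ← mul_pow, f2, ← pow_mul, ← pow_mul, mul_comm 2])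
  rw [← Complex.ofReal_pow, Complex.ofReal_re]
  calc 0 ≤ Real.log (nn β) * _ := mul_nonneg hl this
    _ = _ := by ring

lemma Dd_one_lim : Tendsto (fun ε : ℝ => (ε:ℂ) * Dd (fun _ => 1) (1 + ε)) (𝓝[>] 0) (𝓝 1) := by
  obtain ⟨G, hG, h⟩ := D1_triv
  have hR := Rr_cont isCh_one
  have hc := (hG.add hR) 1 (by simp)
  have hr : Tendsto (fun ε : ℝ => (1:ℂ) + ε) (𝓝[>] 0) (𝓝[{s : ℂ | 1 ≤ s.re}] 1) := by
    refine tendsto_nhdsWithin_iff.2 ⟨(ray 1).mono_right nhdsWithin_le_nhds, ?_⟩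
    filter_upwards [self_mem_nhdsWithin] with ε hε
    have : (0:ℝ) < ε := hε
    simpa using this.le
  have h1 := hc.tendsto.comp hr
  have h0 : Tendsto (fun ε : ℝ => (ε:ℂ)) (𝓝[>] 0) (𝓝 0) := by
    have : Continuous fun ε : ℝ => (ε:ℂ) := by fun_prop
    have := this.tendsto 0
    simp only [Complex.ofReal_zero] at this
    exact this.mono_left nhdsWithin_le_nhds
  have h2 := (h0.mul h1).const_add 1
  rw [zero_mul, add_zero] at h2
  refine h2.congr' ?_
  filter_upwards [self_mem_nhdsWithin] with ε hε
  have hε' : (0:ℝ) < ε := hε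
  have hs0 : 1 < (1 + (ε:ℂ)).re := by simpa using hε'
  rw [Dd_split isCh_one hs0, h _ hs0]
  have : (ε:ℂ) ≠ 0 := by exact_mod_cast hε'.ne'
  simp only [Function.comp, Pi.add_apply, add_sub_cancel_left]
  field_simp
  ring

lemma Lc_ne {e : E → ℂ} (he : IsCh e) {d : E} (hd : e d ≠ 1) {s : ℂ} (hs : 1 ≤ s.re) : Lc d e s ≠ 0 := by
  rcases hs.lt_or_eq with hs | hs
  · exact Lc_ne_gt he hd hs
  intro h0
  have hst : s = 1 + s.im * Complex.I := by
    apply Complex.ext <;> simp [← hs]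
  set t := s.im
  obtain ⟨m, hm, h1⟩ := Dd_lim he hd hs.le
  obtain ⟨m', -, h2⟩ := Dd_lim he.sq (he.sq_ne hd) (s := 1 + (2 * t : ℝ) * Complex.I) (by simp)
  have hm1 := hm h0
  have k := (((Complex.continuous_re.tendsto _).comp Dd_one_lim).const_mul 3).add
    ((((Complex.continuous_re.tendsto _).comp h1).const_mul 4).add ((Complex.continuous_re.tendsto _).comp h2))
  have : 0 ≤ 3 * (1:ℂ).re + (4 * (-(m:ℂ)).re + (-(m':ℂ)).re) := by
    refine ge_of_tendsto k ?_
    filter_upwards [self_mem_nhdsWithin] with ε hε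
    have hε' : (0:ℝ) < ε := hε
    have := tfo_Dd he t hε'
    rw [← hst] at this
    simp only [Function.comp, Complex.re_ofReal_mul]
    calc 0 ≤ ε * _ := mul_nonneg hε'.le this
      _ = _ := by ring
  simp at this
  have h3 : (1:ℝ) ≤ m := by exact_mod_cast hm1
  have h4 : (0:ℝ) ≤ m' := by positivity
  linarith

lemma D1_nontriv {e : E → ℂ} (he : IsCh e) {d : E} (hd : e d ≠ 1) :
    ∃ G : ℂ → ℂ, ContinuousOn G {s | 1 ≤ s.re} ∧ ∀ s : ℂ, 1 < s.re → D1 e s = G s := by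
  refine ⟨fun s => - deriv (Lc d e) s / Lc d e s - Rr e s, ?_, fun s hs => ?_⟩
  · have hsub : {s : ℂ | 1 ≤ s.re} ⊆ {s : ℂ | 1/2 < s.re} := by
      intro s hs
      simp only [Set.mem_ofPred_eq] at hs ⊢
      linarith
    have h1 := ((Lc_analytic he d).deriv.continuousOn).mono hsub
    have h2 := ((Lc_analytic he d).continuousOn).mono hsub
    exact (h1.neg.div h2 (fun s hs => Lc_ne he hd hs)).sub (Rr_cont he)
  · have h := Dd_Lc he hd hs
    beta_reduce
    rw [← h, mul_div_cancel_right₀ _ (Lc_ne he hd hs.le), Dd_split he hs]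
    ring

end E
end HeckeN
end S11
end

section
namespace S11
section HeckeD
open QuadraticAlgebra Filter Topology
namespace E

noncomputable def ch (p : ZMod 3 × ZMod 3) (β : E) : ℂ := ZMod.stdAddChar (p.1 * (β.re : ZMod 3) + p.2 * (β.im : ZMod 3))

lemma isCh_ch (p : ZMod 3 × ZMod 3) : IsCh (ch p) where
  add a b := by
    simp only [ch, re_add, im_add]
    rw [← AddChar.map_add_eq_mul]; congr 1; push_cast; ring
  three a := by
    have h : (3 : E) * a = ⟨3 * a.re, 3 * a.im⟩ := by
      ext <;> simp [show (3:E) = (⟨3, 0⟩ : E) from rfl]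
    have h3 : (3 : ZMod 3) = 0 := rfl
    simp only [ch, h]
    push_cast
    simp [h3]
  norm a := AddChar.norm_apply _ _

lemma ch_ne {p : ZMod 3 × ZMod 3} (hp : p ≠ 0) : ∃ d, ch p d ≠ 1 := by
  refine ⟨⟨p.1.val, p.2.val⟩, ?_⟩
  simp only [ch]
  intro h
  rw [← AddChar.map_zero_eq_one (ZMod.stdAddChar (N := 3))] at h
  have := ZMod.injective_stdAddChar h
  have key : ∀ p : ZMod 3 × ZMod 3, p.1 * (((p.1.val : ℕ) : ℤ) : ZMod 3) + p.2 * (((p.2.val : ℕ) : ℤ) : ZMod 3) = 0 → p = 0 := by decide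
  exact hp (key p this)

lemma fourier (u v : ZMod 3) : (∑ p : ZMod 3 × ZMod 3, ((ZMod.stdAddChar p.1 + ZMod.stdAddChar (-p.1) : ℂ) / 9) *
    ZMod.stdAddChar (p.1 * u + p.2 * v)) = if v = 0 ∧ u ≠ 0 then (1:ℂ) else 0 := by
  have h := fun b : ZMod 3 => AddChar.sum_mulShift b (ZMod.isPrimitive_stdAddChar 3)
  have e : ∀ p : ZMod 3 × ZMod 3, ((ZMod.stdAddChar p.1 + ZMod.stdAddChar (-p.1) : ℂ) / 9) *
    ZMod.stdAddChar (p.1 * u + p.2 * v) = (1/9) * ((ZMod.stdAddChar (p.1 * (u + 1)) + ZMod.stdAddChar (p.1 * (u - 1))) * ZMod.stdAddChar (p.2 * v)) := by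
    intro p
    rw [mul_add, mul_sub, mul_one, sub_eq_add_neg, AddChar.map_add_eq_mul, AddChar.map_add_eq_mul, AddChar.map_add_eq_mul]
    ring
  simp_rw [e]
  rw [← Finset.mul_sum, Fintype.sum_prod_type]
  simp only
  simp_rw [← Finset.mul_sum]
  rw [← Finset.sum_mul, Finset.sum_add_distrib, h, h, h]
  simp only [ZMod.card]
  have key : ∀ u v : ZMod 3, ((if u + 1 = 0 then 3 else 0) + (if u - 1 = 0 then 3 else 0)) * (if v = 0 then 3 else 0) =
      if v = 0 ∧ u ≠ 0 then 9 else (0:ℕ) := by decide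
  rw [← Nat.cast_add, ← Nat.cast_mul, key u v]
  split_ifs <;> norm_num

lemma theta_bound (S : Set ℕ) (hS : ∀ n ∈ S, n.Prime) (n : ℕ) :
    ∑ k ∈ Finset.Icc 1 n, S.indicator (fun k => Real.log k) k ≤ Real.log 4 * n := by
  classical
  refine le_trans ?_ (Chebyshev.theta_le_log4_mul_x (x := n) (by positivity))
  rw [Chebyshev.theta_eq_sum_Icc, Nat.floor_natCast, Finset.sum_filter]
  refine (Finset.sum_le_sum_of_subset_of_nonneg (t := Finset.Icc 0 n) ?_ ?_).trans (Finset.sum_le_sum fun k _ => ?_)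
  · exact Finset.Icc_subset_Icc_left (by norm_num)
  · intro i _ _
    exact Set.indicator_nonneg (fun k _ => Real.log_natCast_nonneg k) _
  · by_cases hk : k ∈ S
    · rw [Set.indicator_of_mem hk, if_pos (hS k hk)]
    · rw [Set.indicator_of_notMem hk]
      split_ifs
      · exact Real.log_natCast_nonneg k
      · exact le_rfl

lemma theta_lim (S : Set ℕ) (hS : ∀ n ∈ S, n.Prime) {c : ℝ} {G : ℂ → ℂ} (hG : ContinuousOn G {s | 1 ≤ s.re})
    (h : ∀ s : ℂ, 1 < s.re → LSeries (fun n => ((S.indicator (fun k => Real.log k) n : ℝ) : ℂ)) s = c / (s - 1) + G s) :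
    Tendsto (fun n : ℕ => (∑ k ∈ Finset.Icc 1 n, S.indicator (fun k => Real.log k) k) / (n : ℝ)) atTop (𝓝 c) :=
  wiener_ikehara _ (fun n => Set.indicator_nonneg (fun k _ => Real.log_natCast_nonneg k) _) (theta_bound S hS) hG h

lemma S2_lim (S : Set ℕ) (hS : ∀ n ∈ S, n.Prime ∧ n % 3 = 1)
    (hc : ∀ β : E, (nn β).Prime → (nn β ∈ S ↔ ((β.im : ZMod 3) = 0 ∧ (β.re : ZMod 3) ≠ 0))) :
    Tendsto (fun n : ℕ => (∑ k ∈ Finset.Icc 1 n, S.indicator (fun k => Real.log k) k) / (n : ℝ)) atTop (𝓝 (1/9)) := by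
  classical
  have hex : ∀ p : ZMod 3 × ZMod 3, ∃ G : ℂ → ℂ, ContinuousOn G {s | 1 ≤ s.re} ∧ ∀ s : ℂ, 1 < s.re →
      D1 (ch p) s = (if p = 0 then 1 else 0) / (s - 1) + G s := by
    intro p
    by_cases hp : p = 0
    · obtain ⟨G, h1, h2⟩ := D1_triv
      refine ⟨G, h1, fun s hs => ?_⟩
      have : ch p = fun _ => 1 := by ext β; simp [ch, hp]
      rw [this, if_pos hp, h2 s hs]
    · obtain ⟨d, hd⟩ := ch_ne hp
      obtain ⟨G, h1, h2⟩ := D1_nontriv (isCh_ch p) hd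
      refine ⟨G, h1, fun s hs => ?_⟩
      rw [if_neg hp, h2 s hs]; simp
  choose G hG hGs using hex
  set c : ZMod 3 × ZMod 3 → ℂ := fun p => (ZMod.stdAddChar p.1 + ZMod.stdAddChar (-p.1) : ℂ) / 9
  refine theta_lim S (fun n hn => (hS n hn).1) (G := fun s => (1/2) * ∑ p, c p * G p s) ?_ ?_
  · exact continuousOn_const.mul (continuousOn_finsetSum _ fun p _ => continuousOn_const.mul (hG p))
  intro s hs
  have h1 := fiber_sum (fun n => S.indicator 1 n) (fun n => by
    by_cases hn : n ∈ S <;> simp [hn]) hs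
  have e1 : (fun n : ℕ => ((if n.Prime ∧ n % 3 = 1 then S.indicator 1 n * Real.log n else 0 : ℝ) : ℂ)) =
      fun n => ((S.indicator (fun k => Real.log k) n : ℝ) : ℂ) := by
    ext n
    by_cases hn : n ∈ S
    · simp [hn, hS n hn]
    · simp [hn]
  rw [e1] at h1
  have hsum : ∀ p, Summable fun β : E => (if (nn β).Prime then (Real.log (nn β) : ℂ) * Ft (ch p) s β else 0) := by
    intro p
    refine Summable.of_norm_bounded (summable_log_nn hs) fun β => ?_
    split_ifs
    · rw [norm_mul, Ft_norm (isCh_ch p), Complex.norm_real, Real.norm_of_nonneg (log_nn_nonneg β)]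
    · rw [_root_.norm_zero]
      exact mul_nonneg (log_nn_nonneg β) (by positivity)
  have h2 : (∑' β : E, if (nn β).Prime then ((S.indicator 1 (nn β) : ℝ) : ℂ) * ((Real.log (nn β) : ℂ) * (nn β : ℂ) ^ (-s)) else 0)
      = ∑ p, c p * D1 (ch p) s := by
    simp_rw [D1, ← tsum_mul_left]
    rw [← Summable.tsum_finsetSum (fun p _ => (hsum p).mul_left _)]
    congr 1; ext β
    by_cases hp : (nn β).Prime
    · simp only [if_pos hp]
      have hf := fourier (β.re : ZMod 3) (β.im : ZMod 3)
      have : ((S.indicator 1 (nn β) : ℝ) : ℂ) = if (β.im : ZMod 3) = 0 ∧ (β.re : ZMod 3) ≠ 0 then (1:ℂ) else 0 := by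
        by_cases hn : nn β ∈ S
        · rw [if_pos ((hc β hp).1 hn)]; simp [hn]
        · rw [if_neg (fun h => hn ((hc β hp).2 h))]; simp [hn]
      rw [this, ← hf, Finset.sum_mul]
      refine Finset.sum_congr rfl fun p _ => ?_
      simp only [Ft, ch, c]
      ring
    · simp [hp]
  have h3 : LSeries (fun n => ((S.indicator (fun k => Real.log k) n : ℝ) : ℂ)) s = (1/2) * ∑ p, c p * D1 (ch p) s := by
    rw [← h2, h1]; ring
  rw [h3]
  have h4 : ∑ p, c p * D1 (ch p) s = (2/9) / (s - 1) + ∑ p, c p * G p s := by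
    have : ∀ p, c p * D1 (ch p) s = (if p = 0 then c p / (s - 1) else 0) + c p * G p s := by
      intro p
      rw [hGs p s hs]
      split_ifs <;> ring
    simp_rw [this]
    rw [Finset.sum_add_distrib, Finset.sum_ite_eq' Finset.univ 0, if_pos (Finset.mem_univ _)]
    have c0 : c 0 = 2/9 := by simp [c]; norm_num
    rw [c0]
  rw [h4]
  push_cast
  ring

def S1 : Set ℕ := {n | n.Prime ∧ (n % 9 = 4 ∨ n % 9 = 7)}

lemma S1_lim : Tendsto (fun n : ℕ => (∑ k ∈ Finset.Icc 1 n, S1.indicator (fun k => Real.log k) k) / (n : ℝ)) atTop (𝓝 (1/3)) := by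
  have u4 : IsUnit (4 : ZMod 9) := IsUnit.of_mul_eq_one 7 (by decide)
  have u7 : IsUnit (7 : ZMod 9) := IsUnit.of_mul_eq_one 4 (by decide)
  obtain ⟨G, hG, h⟩ := prime_class 9 u4
  obtain ⟨H, hH, h'⟩ := prime_class 9 u7
  have ht : Nat.totient 9 = 6 := by decide
  have k1 := theta_lim {n : ℕ | n.Prime ∧ (n : ZMod 9) = 4} (c := 1/6) (fun n hn => hn.1) hG (fun s hs => by
    rw [h s hs, ht]; push_cast; ring)
  have k2 := theta_lim {n : ℕ | n.Prime ∧ (n : ZMod 9) = 7} (c := 1/6) (fun n hn => hn.1) hH (fun s hs => by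
    rw [h' s hs, ht]; push_cast; ring)
  have k := k1.add k2
  rw [show (1/6 + 1/6 : ℝ) = 1/3 by norm_num] at k
  refine k.congr fun n => ?_
  rw [← add_div, ← Finset.sum_add_distrib]
  congr 1
  refine Finset.sum_congr rfl fun m _ => ?_
  classical
  have h4 : (m : ZMod 9) = 4 ↔ m % 9 = 4 := by
    rw [show (4 : ZMod 9) = ((4:ℕ) : ZMod 9) from rfl, ZMod.natCast_eq_natCast_iff']
  have h7 : (m : ZMod 9) = 7 ↔ m % 9 = 7 := by
    rw [show (7 : ZMod 9) = ((7:ℕ) : ZMod 9) from rfl, ZMod.natCast_eq_natCast_iff']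
  simp only [S1, Set.indicator_apply, Set.mem_ofPred_eq, h4, h7]
  by_cases hp : m.Prime <;> by_cases a4 : m % 9 = 4 <;> by_cases a7 : m % 9 = 7 <;> simp_all

lemma ratio_final (S : Set ℕ) (hS : S ⊆ S1)
    (hc : ∀ β : E, (nn β).Prime → nn β ∈ S1 → (nn β ∈ S ↔ (β.im : ZMod 3) = 0)) :
    Tendsto (fun n : ℕ => (({N | N ≤ n ∧ N ∈ S}.ncard : ℕ) : ℝ) / (({N | N ≤ n ∧ N ∈ S1}.ncard : ℕ) : ℝ)) atTop (𝓝 (1/3)) ∧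
    Tendsto (fun n : ℕ => (({N | N ≤ n ∧ N ∈ S1 \ S}.ncard : ℕ) : ℝ) / (({N | N ≤ n ∧ N ∈ S1}.ncard : ℕ) : ℝ)) atTop (𝓝 (2/3)) := by
  have h0 : 0 ∉ S1 := fun h => Nat.not_prime_zero h.1
  have l2 := S2_lim S (fun n hn => ⟨(hS hn).1, by have := (hS hn).2; omega⟩) (by
    intro β hp
    have hm := norm_M_mod9 β
    rw [← nn_cast] at hm
    have hz : nn β ∈ S1 ↔ ((2 * β.re - β.im : ℤ) : ZMod 3) ≠ 0 := by
      rw [Ne, ZMod.intCast_zmod_eq_zero_iff_dvd]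
      simp only [S1, Set.mem_ofPred_eq]
      constructor
      · rintro ⟨-, h⟩ hd
        obtain ⟨k, hk⟩ := hd
        push_cast at hk
        rw [hk] at hm
        omega
      · intro h
        refine ⟨hp, ?_⟩
        push_cast at h
        omega
    by_cases h1 : nn β ∈ S1
    · rw [hc β hp h1]
      constructor
      · intro h
        refine ⟨h, fun hr => hz.1 h1 ?_⟩
        push_cast; rw [h, hr]; rfl
      · exact fun h => h.1
    · refine ⟨fun h => absurd (hS h) h1, fun h => absurd (hz.2 ?_) h1⟩
      push_cast
      rw [h.1]
      have := h.2
      revert this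
      generalize (β.re : ZMod 3) = x
      revert x
      decide)
  have l1 := S1_lim
  have l3 : Tendsto (fun n : ℕ => (∑ k ∈ Finset.Icc 1 n, (S1 \ S).indicator (fun k => Real.log k) k) / (n : ℝ)) atTop (𝓝 (2/9)) := by
    have := l1.sub l2
    rw [show (1/3 - 1/9 : ℝ) = 2/9 by norm_num] at this
    refine this.congr fun n => ?_
    rw [← sub_div, ← Finset.sum_sub_distrib]
    congr 1
    refine Finset.sum_congr rfl fun m _ => ?_
    by_cases h1 : m ∈ S
    · simp [h1, hS h1]
    · by_cases h2 : m ∈ S1 <;> simp [h1, h2]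
  have a := ratio_of_theta S S1 (fun h => h0 (hS h)) h0 (by norm_num) l2 l1
  have b := ratio_of_theta (S1 \ S) S1 (fun h => h0 h.1) h0 (by norm_num) l3 l1
  norm_num at a b ⊢
  exact ⟨a, b⟩

end E
end HeckeD
end S11
end

section
namespace S11
section Recip
open QuadraticAlgebra
namespace E

variable {p : ℕ} [Fact p.Prime]

/-- triple sum -/
lemma triple (a b c : MulChar (ZMod p) E) :
    ∑ x, ∑ y, a x * b y * c (1 - x - y) = jacobiSum a (b * c) * jacobiSum b c + c (-1) * ∑ y, (b * c) y := by
  have h : ∀ s : ZMod p, ∑ y, b y * c (s - y) = (b * c) s * jacobiSum b c + if s = 0 then c (-1) * ∑ y, (b * c) y else 0 := by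
    intro s
    by_cases hs : s = 0
    · subst hs
      rw [if_pos rfl, MulChar.map_zero, zero_mul, zero_add, Finset.mul_sum]
      refine Finset.sum_congr rfl fun y _ => ?_
      rw [zero_sub, show -y = (-1) * y by ring, map_mul, MulChar.mul_apply]; ring
    · rw [if_neg hs, add_zero, jacobiSum, Finset.mul_sum]
      refine (Fintype.sum_equiv (Equiv.mulLeft₀ s hs) _ _ fun y => ?_).symm
      simp only [Equiv.mulLeft₀_apply]
      rw [show s - s * y = s * (1 - y) by ring, map_mul, map_mul, MulChar.mul_apply]; ring
  simp_rw [mul_assoc, ← Finset.mul_sum, h, mul_add]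
  rw [Finset.sum_add_distrib, jacobiSum.eq_def a, Finset.sum_mul]
  congr 1
  · refine Finset.sum_congr rfl fun y _ => by ring
  · rw [Finset.sum_eq_single 1]
    · simp
    · intro x _ hx
      rw [if_neg (sub_ne_zero.2 (Ne.symm hx)), mul_zero]
    · simp

variable {χ : MulChar (ZMod p) E}

lemma chi3 (hχ : orderOf χ = 3) : χ ^ 3 = 1 := hχ ▸ pow_orderOf_eq_one χ

lemma chi_inv (hχ : orderOf χ = 3) : χ⁻¹ = χ ^ 2 := by
  rw [inv_eq_iff_mul_eq_one, ← pow_succ', chi3 hχ]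

lemma chi_ne (hχ : orderOf χ = 3) : χ ≠ 1 := by
  intro h; rw [h, orderOf_one] at hχ; omega

lemma chi_cube (hχ : orderOf χ = 3) {x : ZMod p} (hx : x ≠ 0) : χ x ^ 3 = 1 := by
  rw [← MulChar.pow_apply' _ (by norm_num), chi3 hχ, MulChar.one_apply hx.isUnit]

lemma chi_star (hχ : orderOf χ = 3) (x : ZMod p) : star (χ x) = χ⁻¹ x := by
  by_cases hx : x = 0
  · rw [hx, MulChar.map_zero, MulChar.map_zero, star_zero]
  have h := chi_cube hχ hx
  have h1 : (χ x).norm ^ 3 = 1 := by rw [← map_pow, h, map_one]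
  have h2 : (χ x).norm = 1 := by
    have := norm_nonneg (χ x)
    exact (pow_eq_one_iff_of_nonneg this (by norm_num)).1 h1
  have h3 := mul_star_eq (χ x)
  rw [h2, Int.cast_one] at h3
  rw [chi_inv hχ, MulChar.pow_apply' _ (by norm_num)]
  have h4 : χ x ≠ 0 := by intro h0; rw [h0] at h; norm_num at h
  apply mul_left_cancel₀ h4
  rw [h3, ← h]; ring

lemma J_star (hχ : orderOf χ = 3) : star (jacobiSum χ χ) = jacobiSum χ⁻¹ χ⁻¹ := by
  simp only [jacobiSum, star_sum, star_mul', chi_star hχ]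

lemma J_norm (hχ : orderOf χ = 3) : jacobiSum χ χ * jacobiSum χ⁻¹ χ⁻¹ = p := by
  let i := algebraMap E (FractionRing E)
  have hi : Function.Injective i := IsFractionRing.injective E (FractionRing E)
  apply hi
  have hne : χ.ringHomComp i ≠ 1 := (MulChar.ringHomComp_ne_one_iff hi).2 (chi_ne hχ)
  have hne2 : (χ * χ).ringHomComp i ≠ 1 := (MulChar.ringHomComp_ne_one_iff hi).2 (by
    rw [← pow_two, ← chi_inv hχ]; simpa using chi_ne hχ)
  have h := jacobiSum_mul_jacobiSum_inv (F := ZMod p) (F' := FractionRing E) (χ := χ.ringHomComp i) (φ := χ.ringHomComp i)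
    (by
      have : CharZero (FractionRing E) := by
        have : CharZero E := inferInstance
        infer_instance
      rw [ringChar.eq_zero, ZMod.ringChar_zmod_n]
      exact (Fact.out : p.Prime).ne_zero.symm) hne hne (by rw [← MulChar.ringHomComp_mul]; exact hne2)
  rw [MulChar.ringHomComp_inv, jacobiSum_ringHomComp, jacobiSum_ringHomComp, ← map_mul] at h
  rw [h, ZMod.card]; simp

lemma chi_neg (hχ : orderOf χ = 3) : χ (-1) = 1 := by
  have h := chi_cube hχ (x := -1) (by simp)
  rw [← map_pow] at h
  simpa [pow_succ] using h

lemma sum27 (hχ : orderOf χ = 3) : ∑ x, ∑ y, ((1:MulChar (ZMod p) E) x + χ x + χ⁻¹ x) * ((1:MulChar (ZMod p) E) y + χ y + χ⁻¹ y) *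
      ((1:MulChar (ZMod p) E) (1 - x - y) + χ (1 - x - y) + χ⁻¹ (1 - x - y)) =
      (p:E)^2 + 3 * p + 15 - 4 * (jacobiSum χ χ + jacobiSum χ⁻¹ χ⁻¹) := by
  have hn := chi_ne hχ
  have hn' : χ⁻¹ ≠ 1 := by simpa using hn
  have hm : χ⁻¹ (-1) = 1 := by rw [MulChar.inv_apply']; simpa using chi_neg hχ
  have e1 : χ * χ = χ⁻¹ := by rw [chi_inv hχ, pow_two]
  have e2 : χ⁻¹ * χ⁻¹ = χ := by rw [← mul_inv, e1, inv_inv]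
  have j1 : jacobiSum 1 χ = -1 := jacobiSum_one_nontrivial hn
  have j2 : jacobiSum χ 1 = -1 := by rw [jacobiSum_comm, j1]
  have j3 : jacobiSum 1 χ⁻¹ = -1 := jacobiSum_one_nontrivial hn'
  have j4 : jacobiSum χ⁻¹ 1 = -1 := by rw [jacobiSum_comm, j3]
  have j5 : jacobiSum χ χ⁻¹ = -1 := by rw [jacobiSum_nontrivial_inv hn, chi_neg hχ]
  have j6 : jacobiSum χ⁻¹ χ = -1 := by rw [jacobiSum_comm, j5]
  have j7 : jacobiSum (1 : MulChar (ZMod p) E) 1 = p - 2 := by rw [jacobiSum_one_one, ZMod.card]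
  have s1 : ∑ y, χ y = 0 := MulChar.sum_eq_zero_of_ne_one hn
  have s2 : ∑ y, χ⁻¹ y = 0 := MulChar.sum_eq_zero_of_ne_one hn'
  have s3 : ∑ y, (1 : MulChar (ZMod p) E) y = p - 1 := by
    rw [MulChar.sum_one_eq_card_units, ZMod.card_units, Nat.cast_sub (Fact.out : p.Prime).one_le]; simp
  have hJ := J_norm hχ
  have m1 : (1 : MulChar (ZMod p) E) (-1) = 1 := by
    rw [MulChar.one_apply]; exact isUnit_one.neg
  simp only [add_mul, mul_add, Finset.sum_add_distrib, triple, one_mul, mul_one, e1, e2, mul_inv_cancel, inv_mul_cancel,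
    j1, j2, j3, j4, j5, j6, j7, s1, s2, s3, chi_neg hχ, hm, m1]
  linear_combination 2 * hJ

lemma f_eq (hχ : orderOf χ = 3) (x : ZMod p) :
    (1:MulChar (ZMod p) E) x + χ x + χ⁻¹ x = if x ≠ 0 ∧ χ x = 1 then 3 else 0 := by
  by_cases hx : x = 0
  · subst hx; simp [MulChar.map_zero]
  have h := chi_cube hχ hx
  rw [MulChar.one_apply (isUnit_iff_ne_zero.2 hx), chi_inv hχ, MulChar.pow_apply' _ (by norm_num)]
  by_cases h1 : χ x = 1
  · rw [if_pos ⟨hx, h1⟩, h1]; norm_num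
  · rw [if_neg (fun h => h1 h.2)]
    have : (χ x - 1) * (1 + χ x + χ x ^ 2) = 0 := by linear_combination h
    exact (mul_eq_zero.1 this).resolve_left (sub_ne_zero.2 h1)

/-- the triples of cubes with sum one -/
abbrev TT (χ : MulChar (ZMod p) E) := {q : ZMod p × ZMod p // (q.1 ≠ 0 ∧ χ q.1 = 1) ∧ (q.2 ≠ 0 ∧ χ q.2 = 1) ∧
  (1 - q.1 - q.2 ≠ 0 ∧ χ (1 - q.1 - q.2) = 1)}

open scoped Classical in
lemma count (hχ : orderOf χ = 3) : (27 * Fintype.card (TT χ) : E) = (p:E)^2 + 3 * p + 15 - 4 * (jacobiSum χ χ + jacobiSum χ⁻¹ χ⁻¹) := by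
  rw [← sum27 hχ]
  simp only [f_eq hχ]
  rw [Fintype.card_subtype, ← Fintype.sum_prod_type', Finset.card_filter]
  push_cast
  rw [Finset.mul_sum]
  refine Finset.sum_congr rfl fun q _ => ?_
  by_cases h1 : q.1 ≠ 0 ∧ χ q.1 = 1 <;> by_cases h2 : q.2 ≠ 0 ∧ χ q.2 = 1 <;>
    by_cases h3 : 1 - q.1 - q.2 ≠ 0 ∧ χ (1 - q.1 - q.2) = 1 <;> simp [h1, h2, h3] <;> norm_num

open scoped Classical in
lemma card_mod (hp3 : p ≠ 3) : Fintype.card (TT χ) ≡ (if χ 3 = 1 then 1 else 0) [MOD 3] := by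
  have : Fact (Nat.Prime 3) := ⟨Nat.prime_three⟩
  have h30 : (3 : ZMod p) ≠ 0 := by
    intro h
    rw [show (3 : ZMod p) = ((3:ℕ) : ZMod p) by norm_num, ZMod.natCast_eq_zero_iff] at h
    exact hp3 ((Nat.prime_dvd_prime_iff_eq Fact.out Nat.prime_three).1 h)
  let f : Function.End (TT χ) := fun q => ⟨(q.1.2, 1 - q.1.1 - q.1.2), q.2.2.1, q.2.2.2, by
    have : 1 - q.1.2 - (1 - q.1.1 - q.1.2) = q.1.1 := by ring
    simp only
    rw [this]; exact q.2.1⟩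
  have hf : f ^ 3 ^ 1 = 1 := by
    funext q
    apply Subtype.ext
    rw [pow_one, pow_succ, pow_two]
    change (1 - q.1.2 - (1 - q.1.1 - q.1.2), 1 - (1 - q.1.1 - q.1.2) - (1 - q.1.2 - (1 - q.1.1 - q.1.2))) = (q.1 : ZMod p × ZMod p)
    apply Prod.ext
    · simp
    · simp only; ring
  have h := Equiv.Perm.card_fixedPoints_modEq hf
  refine h.trans ?_
  have hfix : ∀ q : TT χ, q ∈ f.fixedPoints ↔ (3 * q.1.1 = 1 ∧ q.1.2 = q.1.1) := by
    intro q
    have : f q = q ↔ (q.1.2 = q.1.1 ∧ 1 - q.1.1 - q.1.2 = q.1.2) := by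
      rw [Subtype.ext_iff, Prod.ext_iff]
    change f q = q ↔ _
    rw [this]
    constructor
    · rintro ⟨h1, h2⟩
      refine ⟨?_, h1⟩
      rw [h1] at h2
      linear_combination -h2
    · rintro ⟨h1, h2⟩
      refine ⟨h2, ?_⟩
      rw [h2]
      linear_combination -h1
  have h3i : χ 3 * χ 3⁻¹ = 1 := by rw [← map_mul, mul_inv_cancel₀ h30, map_one]
  split_ifs with hc
  · have hc' : χ 3⁻¹ = 1 := by rw [hc, one_mul] at h3i; exact h3i
    have e1 : (1 - (3:ZMod p)⁻¹ - 3⁻¹) = 3⁻¹ := by field_simp; ring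
    have hi0 : (3:ZMod p)⁻¹ ≠ 0 := inv_ne_zero h30
    let q0 : TT χ := ⟨(3⁻¹, 3⁻¹), ⟨hi0, hc'⟩, ⟨hi0, hc'⟩, by simp only; rw [e1]; exact ⟨hi0, hc'⟩⟩
    have : Fintype.card f.fixedPoints = 1 := by
      rw [Fintype.card_eq_one_iff]
      refine ⟨⟨q0, (hfix q0).2 ⟨mul_inv_cancel₀ h30, rfl⟩⟩, fun y => ?_⟩
      obtain ⟨h1, h2⟩ := (hfix y.1).1 y.2
      have h4 : y.1.1.1 = 3⁻¹ := eq_inv_of_mul_eq_one_right h1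
      apply Subtype.ext
      apply Subtype.ext
      exact Prod.ext h4 (h2.trans h4)
    rw [this]
  · have : Fintype.card f.fixedPoints = 0 := by
      rw [Fintype.card_eq_zero_iff]
      refine ⟨fun y => hc ?_⟩
      obtain ⟨h1, h2⟩ := (hfix y.1).1 y.2
      have h4 : χ 3 * χ y.1.1.1 = 1 := by rw [← map_mul, h1, map_one]
      rw [y.1.2.1.2, mul_one] at h4
      exact h4
    rw [this]

def om : E := ⟨0, 1⟩

@[simp] lemma om_re : om.re = 0 := rfl
@[simp] lemma om_im : om.im = 1 := rfl

lemma om_sq : om ^ 2 = - 1 - om := by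
  rw [pow_two]; ext <;> simp

lemma omega_prim : IsPrimitiveRoot om 3 := by
  rw [IsPrimitiveRoot.iff_orderOf]
  have : Fact (Nat.Prime 3) := ⟨Nat.prime_three⟩
  refine orderOf_eq_prime ?_ ?_
  · rw [pow_succ, pow_two]; ext <;> simp
  · intro h
    have := congrArg QuadraticAlgebra.re h
    simp at this

lemma exists_gamma (hχ : orderOf χ = 3) (hp : p % 3 = 1) : ∃ γ : E, jacobiSum χ χ = - M γ ∧ nn γ = p := by
  obtain ⟨z, -, hz⟩ := exists_jacobiSum_eq_neg_one_add (F := ZMod p) (R := E) (n := 3) (χ := χ) (ψ := χ) (μ := om) (by norm_num) (chi3 hχ) (chi3 hχ) (by rw [ZMod.card]; omega) omega_prim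
  have hJ : jacobiSum χ χ = - M (om * z) := by
    rw [hz, M]
    linear_combination z * om_sq
  refine ⟨_, hJ, ?_⟩
  have h := J_norm hχ
  rw [← J_star hχ, hJ, star_neg, neg_mul_neg, mul_star_eq, ← nn_cast] at h
  have := congrArg QuadraticAlgebra.re h
  simpa using this

lemma arith {u v p T : ℤ} (hp : p = 1 + 3 * (2 * u - v) + 9 * (u^2 - u * v + v^2))
    (hT : 27 * T = p^2 + 3 * p + 15 + 4 * (2 + 3 * (2 * u - v))) : (T : ZMod 3) = 1 + 2 * (v : ZMod 3)^2 := by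
  subst hp
  have h : T = 1 + (2 * u - v) + 3 * u^2 - 3 * u * v + 2 * v^2 + 2 * (2 * u - v) * (u^2 - u * v + v^2) + 3 * (u^2 - u * v + v^2)^2 := by
    have : (27:ℤ) * T = 27 * (1 + (2 * u - v) + 3 * u^2 - 3 * u * v + 2 * v^2 + 2 * (2 * u - v) * (u^2 - u * v + v^2) + 3 * (u^2 - u * v + v^2)^2) := by
      rw [hT]; ring
    exact mul_left_cancel₀ (by norm_num) this
  rw [h]
  push_cast
  generalize (u : ZMod 3) = a
  generalize (v : ZMod 3) = b
  revert a b
  decide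

lemma chi_one_iff (hχ : orderOf χ = 3) {x : ZMod p} (hx : x ≠ 0) : χ x = 1 ↔ ∃ y, y ^ 3 = x := by
  constructor
  · intro h
    obtain ⟨g, hg⟩ := IsCyclic.exists_generator (α := (ZMod p)ˣ)
    obtain ⟨k, hk⟩ := hg (Units.mk0 x hx)
    have hg1 : χ g ≠ 1 := by
      intro h1
      apply chi_ne hχ
      apply MulChar.ext
      intro a
      obtain ⟨m, hm⟩ := hg a
      rw [← hm, MulChar.one_apply_coe]
      simp only
      have : (χ.toUnitHom g) = 1 := by ext1; simpa using h1
      have h2 : (χ.toUnitHom (g ^ m)) = 1 := by rw [map_zpow, this, one_zpow]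
      have := congrArg Units.val h2
      rw [MulChar.coe_toUnitHom] at this
      exact this
    have h3 : orderOf (χ.toUnitHom g) = 3 := by
      have : Fact (Nat.Prime 3) := ⟨Nat.prime_three⟩
      refine orderOf_eq_prime ?_ ?_
      · ext1; rw [Units.val_pow_eq_pow_val, MulChar.coe_toUnitHom, chi_cube hχ g.ne_zero]; rfl
      · intro h; apply hg1; rw [← MulChar.coe_toUnitHom, h]; rfl
    have h4 : (χ.toUnitHom g) ^ k = 1 := by
      rw [← map_zpow]; ext1; rw [MulChar.coe_toUnitHom]
      simp only at hk
      rw [hk]; simpa using h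
    rw [← orderOf_dvd_iff_zpow_eq_one, h3] at h4
    obtain ⟨j, rfl⟩ := h4
    refine ⟨((g ^ j : (ZMod p)ˣ) : ZMod p), ?_⟩
    rw [← Units.val_pow_eq_pow_val, ← zpow_natCast, ← zpow_mul, mul_comm]
    simp only at hk
    have := congrArg Units.val hk
    exact this
  · rintro ⟨y, rfl⟩
    rw [map_pow, chi_cube hχ]
    rintro rfl
    simp at hx

theorem three_cube {β : E} (hβ : nn β = p) (hp3 : p % 3 = 1) :
    (∃ x : ZMod p, x ^ 3 = 3) ↔ (β.im : ZMod 3) = 0 := by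
  classical
  obtain ⟨χ, hχ⟩ := MulChar.exists_mulChar_orderOf (ZMod p) (R := E) (n := 3) (by rw [ZMod.card]; omega) omega_prim
  have hne3 : p ≠ 3 := by omega
  have h30 : (3 : ZMod p) ≠ 0 := by
    intro h
    rw [show (3 : ZMod p) = ((3:ℕ) : ZMod p) by norm_num, ZMod.natCast_eq_zero_iff] at h
    exact hne3 ((Nat.prime_dvd_prime_iff_eq Fact.out Nat.prime_three).1 h)
  rw [← chi_one_iff hχ h30]
  obtain ⟨γ, hJ, hγ⟩ := exists_gamma hχ hp3
  have hc := count hχ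
  rw [← J_star hχ, hJ] at hc
  have hre := congrArg QuadraticAlgebra.re hc
  have hT : 27 * (Fintype.card (TT χ) : ℤ) = (p:ℤ)^2 + 3 * p + 15 + 4 * (2 + 3 * (2 * γ.re - γ.im)) := by
    have e : (27 * Fintype.card (TT χ) : E) = ((27 * Fintype.card (TT χ) : ℤ) : E) := by push_cast; rfl
    have e2 : ((p:E)^2 + 3 * p + 15 - 4 * (-M γ + star (-M γ))) = (((p:ℤ)^2 + 3 * p + 15 + 4 * (2 + 3 * (2 * γ.re - γ.im)) : ℤ) : E) := by
      have : M γ + star (M γ) = ((2 + 3 * (2 * γ.re - γ.im) : ℤ) : E) := by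
        ext <;> simp
        ring
      push_cast at this ⊢
      rw [star_neg]
      linear_combination 4 * this
    rw [e, e2, QuadraticAlgebra.re_intCast, QuadraticAlgebra.re_intCast] at hre
    exact hre
  have hP : (p:ℤ) = 1 + 3 * (2 * γ.re - γ.im) + 9 * (γ.re^2 - γ.re * γ.im + γ.im^2) := by
    have := nn_cast γ
    rw [hγ, norm_eq] at this
    simp at this
    rw [this]; ring
  have hA := arith hP hT
  have hM := card_mod (χ := χ) hne3
  rw [← ZMod.natCast_eq_natCast_iff] at hM
  rw [Int.cast_natCast, hM] at hA
  have him : (β.im : ZMod 3) = 0 ↔ (γ.im : ZMod 3) = 0 := by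
    have hpr : p.Prime := Fact.out
    rcases nn_fiber (β := γ) (γ := β) (by rw [hγ]; exact hpr) (by rw [hβ, hγ]) with h | h
    · rw [h]
    · rw [h]; simp
  rw [him]
  revert hA
  generalize (γ.im : ZMod 3) = v
  by_cases h : χ 3 = 1
  · simp only [h, if_true, true_iff]
    revert v
    decide
  · simp only [h, if_false, false_iff]
    revert v
    decide

end E
end Recip
end S11
end

section
namespace S11
section ClassGen
variable {R : Type*} [CommRing R] [IsDedekindDomain R]
open scoped nonZeroDivisors

open Classical in
noncomputable def cl (I : Ideal R) : ClassGroup R :=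
  if h : I ≠ 0 then ClassGroup.mk0 ⟨I, mem_nonZeroDivisors_of_ne_zero h⟩ else 1

lemma cl_of {I : Ideal R} (h : I ≠ 0) :
    cl I = ClassGroup.mk0 ⟨I, mem_nonZeroDivisors_of_ne_zero h⟩ := by
  simp only [cl]; rw [dif_pos h]

lemma cl_mul {I J : Ideal R} (hI : I ≠ 0) (hJ : J ≠ 0) : cl (I * J) = cl I * cl J := by
  rw [cl_of hI, cl_of hJ, cl_of (mul_ne_zero hI hJ), ← map_mul]; rfl

lemma cl_surj (c : ClassGroup R) : ∃ I : Ideal R, I ≠ 0 ∧ cl I = c := by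
  obtain ⟨⟨I, hI⟩, rfl⟩ := ClassGroup.mk0_surjective c
  have : I ≠ 0 := nonZeroDivisors.ne_zero hI
  exact ⟨I, this, cl_of this⟩

lemma cl_eq_iff {I J : Ideal R} (hI : I ≠ 0) (hJ : J ≠ 0) :
    cl I = cl J ↔ ∃ x y : R, x ≠ 0 ∧ y ≠ 0 ∧ Ideal.span {x} * I = Ideal.span {y} * J := by
  rw [cl_of hI, cl_of hJ, ClassGroup.mk0_eq_mk0_iff]
  constructor
  · rintro ⟨x, y, hx, hy, h⟩; exact ⟨x, y, hx, hy, h⟩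
  · rintro ⟨x, y, hx, hy, h⟩; exact ⟨x, y, hx, hy, h⟩

lemma cl_one_iff {I : Ideal R} (hI : I ≠ 0) : cl I = 1 ↔ ∃ x, I = Ideal.span {x} := by
  rw [cl_of hI, ClassGroup.mk0_eq_one_iff]
  constructor
  · rintro ⟨x, hx⟩; exact ⟨x, hx⟩
  · rintro ⟨x, hx⟩; exact ⟨x, hx⟩

lemma span_ne {x : R} (h : x ≠ 0) : Ideal.span {x} ≠ (0 : Ideal R) := by
  rwa [Ne, Ideal.zero_eq_bot, Ideal.span_singleton_eq_bot]

lemma cl_span {x : R} (hx : x ≠ 0) : cl (Ideal.span {x}) = 1 :=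
  (cl_one_iff (span_ne hx)).2 ⟨x, rfl⟩

lemma cl_top : cl (1 : Ideal R) = 1 := by
  rw [cl_one_iff one_ne_zero]; exact ⟨1, by simp⟩

lemma cl_pow {I : Ideal R} (hI : I ≠ 0) (n : ℕ) : cl (I ^ n) = cl I ^ n := by
  induction n with
  | zero => rw [pow_zero, pow_zero, cl_top]
  | succ n ih => rw [pow_succ, pow_succ, cl_mul (pow_ne_zero n hI) hI, ih]

lemma exists_copr {I M : Ideal R} (hI : I ≠ 0) (hM : M ≠ 0) (hM1 : M ≠ ⊤) :
    ∃ a B, a ≠ 0 ∧ a ∈ I ∧ B ≠ 0 ∧ Ideal.span {a} = I * B ∧ B ⊔ M = ⊤ := by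
  obtain ⟨a, ha⟩ := IsDedekindDomain.exists_sup_span_eq (I := I * M) (J := I) Ideal.mul_le_left
    (mul_ne_zero hI hM)
  have haI : a ∈ I := by
    rw [← ha]; exact Ideal.mem_sup_right (Ideal.mem_span_singleton_self a)
  obtain ⟨B, hB⟩ := Ideal.dvd_iff_le.2 ((Ideal.span_singleton_le_iff_mem I).2 haI)
  have h1 : B ⊔ M = ⊤ := by
    rw [hB, ← Ideal.mul_sup, sup_comm] at ha
    have := mul_left_cancel₀ hI (ha.trans (mul_one I).symm)
    simpa using this
  have hB0 : B ≠ 0 := by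
    rintro rfl
    apply hM1
    simpa using h1
  have ha0 : a ≠ 0 := by
    rintro rfl
    have : I * B = 0 := by rw [← hB]; simp
    rcases mul_eq_zero.1 this with h | h
    · exact hI h
    · exact hB0 h
  exact ⟨a, B, ha0, haI, hB0, hB, h1⟩

lemma cl_copr (c : ClassGroup R) {M : Ideal R} (hM : M ≠ 0) (hM1 : M ≠ ⊤) :
    ∃ B : Ideal R, B ≠ 0 ∧ cl B = c ∧ B ⊔ M = ⊤ := by
  obtain ⟨I, hI, h⟩ := cl_surj c⁻¹
  obtain ⟨a, B, ha, -, hB, h1, h2⟩ := exists_copr hI hM hM1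
  refine ⟨B, hB, ?_, h2⟩
  have := cl_span ha
  rw [h1, cl_mul hI hB, h] at this
  exact (eq_of_inv_mul_eq_one this).symm

lemma map_ne {I : Ideal R} (f : R ≃+* R) (hI : I ≠ 0) : Ideal.map f I ≠ 0 := by
  intro h
  apply hI
  rw [Ideal.zero_eq_bot] at h ⊢
  exact (Ideal.map_eq_bot_iff_of_injective f.injective).1 h

lemma map_span1 (f : R ≃+* R) (x : R) : Ideal.map f (Ideal.span {x}) = Ideal.span {f x} := by
  rw [Ideal.map_span]; simp

lemma cl_map_congr (f : R ≃+* R) {I J : Ideal R} (hI : I ≠ 0) (hJ : J ≠ 0) (h : cl I = cl J) :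
    cl (Ideal.map f I) = cl (Ideal.map f J) := by
  obtain ⟨x, y, hx, hy, e⟩ := (cl_eq_iff hI hJ).1 h
  rw [cl_eq_iff (map_ne f hI) (map_ne f hJ)]
  refine ⟨f x, f y, by simpa using hx, by simpa using hy, ?_⟩
  rw [← map_span1, ← map_span1, ← Ideal.map_mul, e, Ideal.map_mul]

/-- action on classes -/
noncomputable def clMap (f : R ≃+* R) : ClassGroup R →* ClassGroup R where
  toFun c := cl (Ideal.map f (cl_surj c).choose)
  map_one' := by
    obtain ⟨h1, h2⟩ := (cl_surj (1 : ClassGroup R)).choose_spec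
    rw [cl_map_congr f h1 one_ne_zero (h2.trans cl_top.symm)]
    rw [Ideal.one_eq_top, Ideal.map_top, ← Ideal.one_eq_top, cl_top]
  map_mul' a b := by
    obtain ⟨h1, h2⟩ := (cl_surj a).choose_spec
    obtain ⟨h3, h4⟩ := (cl_surj b).choose_spec
    obtain ⟨h5, h6⟩ := (cl_surj (a * b)).choose_spec
    rw [cl_map_congr f h5 (mul_ne_zero h1 h3) (by rw [h6, cl_mul h1 h3, h2, h4]), Ideal.map_mul,
      cl_mul (map_ne f h1) (map_ne f h3)]

lemma clMap_cl (f : R ≃+* R) {I : Ideal R} (hI : I ≠ 0) : clMap f (cl I) = cl (Ideal.map f I) := by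
  obtain ⟨h1, h2⟩ := (cl_surj (cl I)).choose_spec
  exact cl_map_congr f h1 hI h2

lemma cube_dvd {I J : Ideal R} (h : I ^ 3 ∣ J ^ 3) : I ∣ J :=
  (UniqueFactorizationMonoid.pow_dvd_pow_iff_dvd (by norm_num)).1 h

lemma cube_inj {I J : Ideal R} (h : I ^ 3 = J ^ 3) : I = J := by
  apply dvd_antisymm
  · exact cube_dvd h.dvd
  · exact cube_dvd h.symm.dvd

lemma triple_le {I J K M : Ideal R} (h : ∀ x ∈ I, ∀ y ∈ J, ∀ z ∈ K, x * y * z ∈ M) :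
    I * J * K ≤ M := by
  rw [Ideal.mul_le]
  intro r hr z hz
  induction hr using Submodule.mul_induction_on' with
  | mem_mul_mem x hx y hy => exact h x hx y hy z hz
  | add x _ y _ h1 h2 => rw [add_mul]; exact M.add_mem h1 h2

end ClassGen

section GroupLemma
variable {A : Type*} [CommGroup A] [Finite A]

lemma group_lemma (s : A →* A) (h1 : ∀ a, a * s a * s (s a) = 1) (H : Subgroup A)
    (hH : H ≠ ⊤) (hD : ∀ a, a / s a ∈ H) (T : Subgroup A) (hT : ∀ a, s a = a → a ∈ T)
    (hTc : Nat.card T ≤ 3) (hT2 : ∀ a ∈ T, s a = a) :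
    (T ≤ H → Nat.card {g : A // g ^ 3 = 1} = 9) ∧
    (¬ T ≤ H → Nat.card {g : A // g ^ 3 = 1} = 3) := by
  set D : A →* A := (MonoidHom.id A) / s with hDdef
  have hDa : ∀ a, D a = a / s a := fun a => rfl
  have kerD : D.ker = T := by
    ext a
    rw [MonoidHom.mem_ker, hDa, div_eq_one]
    exact ⟨fun h => hT a h.symm, fun h => (hT2 a h).symm⟩
  have sinj : Function.Injective s := by
    rw [injective_iff_map_eq_one]
    intro a ha
    have := h1 a
    simpa [ha] using this
  have D2 : ∀ a, D (D a) = ((s a) ^ 3)⁻¹ := by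
    intro a
    rw [hDa, hDa, _root_.map_div]
    have := h1 a
    have e : s (s a) = (a * s a)⁻¹ := eq_inv_of_mul_eq_one_right this
    rw [e, div_eq_mul_inv, div_eq_mul_inv, div_eq_mul_inv, pow_three]
    simp only [mul_inv_rev, inv_inv]
    have : (s a)⁻¹ * a⁻¹ = a⁻¹ * (s a)⁻¹ := mul_comm _ _
    calc a * (s a)⁻¹ * ((s a)⁻¹ * a⁻¹ * (s a)⁻¹) = (a * a⁻¹) * ((s a)⁻¹ * (s a)⁻¹ * (s a)⁻¹) := by
          simp only [mul_assoc, mul_comm, mul_left_comm]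
      _ = _ := by simp
  have t3 : ∀ a, a ^ 3 = 1 ↔ D a ∈ T := by
    intro a
    rw [← kerD, MonoidHom.mem_ker, D2, inv_eq_one, ← map_pow]
    exact ⟨fun h => by rw [h, map_one], fun h => sinj (by rw [h, map_one])⟩
  have Dle : D.range ≤ H := by rintro _ ⟨a, rfl⟩; exact hD a
  have cardk : Nat.card D.range * Nat.card T = Nat.card A := by
    rw [← kerD, mul_comm, ← Subgroup.index_ker D, Subgroup.card_mul_index]
  have idx : D.range.index = Nat.card T := by
    have := Subgroup.card_mul_index D.range
    rw [← cardk] at this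
    exact Nat.eq_of_mul_eq_mul_left Nat.card_pos this
  have T3 : ∀ a ∈ T, a ^ 3 = 1 := by
    intro a ha
    have := h1 a
    rw [hT2 a ha, hT2 a ha] at this
    rw [pow_three, ← mul_assoc]; exact this
  have Hidx : H.index ≠ 1 := fun h => hH (Subgroup.index_eq_one.1 h)
  have hdiv : H.index ∣ D.range.index := Subgroup.index_dvd_of_le Dle
  have pT : IsPGroup 3 T := by
    intro a
    refine ⟨1, ?_⟩
    ext
    simpa using T3 a a.2
  haveI : Fact (Nat.Prime 3) := ⟨by norm_num⟩
  obtain ⟨n, hn⟩ := IsPGroup.iff_card.1 pT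
  have T3c : Nat.card T = 3 := by
    rcases Nat.lt_or_ge n 1 with h | h
    · have : n = 0 := by omega
      rw [this, pow_zero] at hn
      rw [idx, hn] at hdiv
      exact absurd (Nat.dvd_one.1 hdiv) Hidx
    · rcases Nat.lt_or_ge n 2 with h' | h'
      · have : n = 1 := by omega
        rw [hn, this]; norm_num
      · have : 3 ^ 2 ≤ 3 ^ n := Nat.pow_le_pow_right (by norm_num) h'
        omega
  have HD : D.range = H := by
    rw [idx, T3c] at hdiv
    have h3 : H.index = 3 := by
      rcases (Nat.dvd_prime (by norm_num)).1 hdiv with h | h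
      · exact absurd h Hidx
      · exact h
    apply Subgroup.eq_of_le_of_card_ge Dle
    have e1 := Subgroup.card_mul_index H
    have e2 := Subgroup.card_mul_index D.range
    rw [idx, T3c, ← e1, h3] at e2
    omega
  -- count
  set B : Subgroup A := T.comap D
  have eB : Nat.card {g : A // g ^ 3 = 1} = Nat.card B :=
    Nat.card_congr (Equiv.subtypeEquivRight (fun a => t3 a))
  have cB : Nat.card B = Nat.card T * Nat.card (H ⊓ T : Subgroup A) := by
    have e := Subgroup.card_mul_index (D.subgroupMap B).ker
    have e1 : Nat.card (D.subgroupMap B).ker = Nat.card T := by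
      have : (D.subgroupMap B).ker = D.ker.subgroupOf B := by
        ext a
        rw [MonoidHom.mem_ker, Subgroup.mem_subgroupOf, MonoidHom.mem_ker, ← Subtype.coe_inj]
        rfl
      rw [this, kerD]
      apply Nat.card_congr
      apply (Subgroup.subgroupOfEquivOfLe _).toEquiv
      intro a ha
      change D a ∈ T
      rw [← kerD] at ha
      rw [MonoidHom.mem_ker.1 ha]; exact T.one_mem
    have e2 : (D.subgroupMap B).ker.index = Nat.card (H ⊓ T : Subgroup A) := by
      rw [Subgroup.index_ker, MonoidHom.range_eq_top.2 (D.subgroupMap_surjective B),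
        Subgroup.card_top]
      rw [Subgroup.map_comap_eq, HD]
    rw [← e, e1, e2]
  rw [eB, cB, T3c]
  constructor
  · intro h
    rw [inf_eq_right.2 h, T3c]
  · intro h
    have hd : Nat.card (H ⊓ T : Subgroup A) ∣ Nat.card T := Subgroup.card_dvd_of_le inf_le_right
    rw [T3c] at hd
    rcases (Nat.dvd_prime (by norm_num)).1 hd with h' | h'
    · rw [h']
    · exfalso
      apply h
      have := Subgroup.eq_of_le_of_card_ge (inf_le_right : H ⊓ T ≤ T) (by rw [T3c, h'])
      rw [← this]; exact inf_le_left

lemma closure_card {p l : A} (hp : p ^ 3 = 1) (hl : l ^ 3 = 1) {i j : ℕ}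
    (hij : p ^ i * l ^ j = 1) (hn : ¬ (3 ∣ i ∧ 3 ∣ j)) :
    Nat.card (Subgroup.closure {p, l}) ≤ 3 := by
  have key : ∀ x : A, x ^ 3 = 1 → Nat.card (Subgroup.zpowers x) ≤ 3 := by
    intro x hx
    rw [Nat.card_zpowers]
    exact orderOf_le_of_pow_eq_one (by norm_num) hx
  have red : ∀ (x : A), x ^ 3 = 1 → ∀ k, x ^ k = x ^ (k % 3) := by
    intro x hx k
    conv_lhs => rw [← Nat.div_add_mod k 3, pow_add, pow_mul, hx, one_pow, one_mul]
  by_cases hj : 3 ∣ j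
  · have hi : ¬ 3 ∣ i := fun h => hn ⟨h, hj⟩
    have h1 : l ^ j = 1 := by obtain ⟨k, rfl⟩ := hj; rw [pow_mul, hl, one_pow]
    rw [h1, mul_one] at hij
    have hp1 : p = 1 := by
      have : p ^ (i * i) = 1 := by rw [pow_mul, hij, one_pow]
      rw [red p hp] at this
      have e : i * i % 3 = 1 := by
        have : i % 3 = 1 ∨ i % 3 = 2 := by omega
        rcases this with h | h <;> simp [Nat.mul_mod, h]
      rwa [e, pow_one] at this
    refine le_trans (Subgroup.card_le_of_le (K := Subgroup.zpowers l) ?_) (key l hl)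
    rw [Subgroup.closure_le]
    rintro x (rfl | rfl)
    · rw [hp1]; exact Subgroup.one_mem _
    · exact Subgroup.mem_zpowers _
  · have hl1 : l = (p ^ (i * j))⁻¹ := by
      have h2 : (p ^ i * l ^ j) ^ j = 1 := by rw [hij, one_pow]
      rw [mul_pow, ← pow_mul, ← pow_mul, red l hl] at h2
      have e : j * j % 3 = 1 := by
        have : j % 3 = 1 ∨ j % 3 = 2 := by omega
        rcases this with h | h <;> simp [Nat.mul_mod, h]
      rw [e, pow_one] at h2
      exact (inv_eq_of_mul_eq_one_right h2).symm
    refine le_trans (Subgroup.card_le_of_le (K := Subgroup.zpowers p) ?_) (key p hp)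
    rw [Subgroup.closure_le]
    rintro x (rfl | rfl)
    · exact Subgroup.mem_zpowers _
    · rw [hl1]
      exact Subgroup.inv_mem _ (Subgroup.pow_mem _ (Subgroup.mem_zpowers _) _)

end GroupLemma
end S11
end

section
namespace S11
open E

/-- The arithmetic data used for the class group computation. -/
structure Dat (N : ℕ) (R : Type*) [CommRing R] where
  σ : R ≃+* R
  τ : R ≃+* R
  ι : E →+* R
  θ : R
  ι_inj : Function.Injective ι
  θ3 : θ ^ 3 = (N : R)
  σθ : σ θ = ι om * θ
  σι : ∀ a, σ (ι a) = ι a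
  τθ : τ θ = θ
  τι : ∀ a, τ (ι a) = ι (star a)
  σ3 : ∀ x, σ (σ (σ x)) = x
  τσ : ∀ x, τ (σ x) = σ (σ (τ x))
  fix : ∀ x, σ x = x → ∃ a, x = ι a

namespace Dat
section basic
variable {N : ℕ} {R : Type*} [CommRing R] [IsDedekindDomain R] (D : Dat N R)

lemma dvd_desc {a b : E} (h : D.ι a ∣ D.ι b) : a ∣ b := by
  obtain ⟨w, hw⟩ := h
  by_cases ha : a = 0
  · rw [ha, map_zero, zero_mul] at hw
    have : b = 0 := D.ι_inj (by rw [hw, map_zero])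
    rw [ha, this]
  have ha' : D.ι a ≠ 0 := by rwa [Ne, map_eq_zero_iff D.ι D.ι_inj]
  have : D.σ w = w := by
    apply mul_left_cancel₀ ha'
    conv_lhs => rw [← D.σι a, ← map_mul, ← hw, D.σι, hw]
  obtain ⟨c, rfl⟩ := D.fix w this
  exact ⟨c, D.ι_inj (by rw [hw, map_mul])⟩

lemma ex_nE (x : R) : ∃ ν, x * D.σ x * D.σ (D.σ x) = D.ι ν := by
  apply D.fix
  rw [map_mul, map_mul, D.σ3]; ring

noncomputable def nE (x : R) : E := (D.ex_nE x).choose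

lemma nE_spec (x : R) : D.ι (D.nE x) = x * D.σ x * D.σ (D.σ x) := (D.ex_nE x).choose_spec.symm

lemma nE_mul (x y : R) : D.nE (x * y) = D.nE x * D.nE y := by
  apply D.ι_inj
  rw [map_mul, nE_spec, nE_spec, nE_spec, map_mul, map_mul]; ring

lemma nE_ι (a : E) : D.nE (D.ι a) = a ^ 3 := by
  apply D.ι_inj
  rw [nE_spec, D.σι, D.σι, map_pow]; ring

lemma nE_neg (x : R) : D.nE (-x) = - D.nE x := by
  apply D.ι_inj
  rw [nE_spec, map_neg, map_neg, map_neg, nE_spec]; ring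

lemma nE_ne {x : R} (hx : x ≠ 0) : D.nE x ≠ 0 := by
  intro h
  have := D.nE_spec x
  rw [h, map_zero] at this
  have h1 : D.σ x ≠ 0 := by simpa using hx
  have h2 : D.σ (D.σ x) ≠ 0 := by simpa using hx
  exact mul_ne_zero (mul_ne_zero hx h1) h2 this.symm

lemma nE_unit {u : R} (hu : IsUnit u) : IsUnit (D.nE u) := by
  obtain ⟨v, hv⟩ := hu.exists_right_inv
  have := D.nE_mul u v
  rw [hv, ← map_one D.ι, nE_ι, one_pow] at this
  exact IsUnit.of_mul_eq_one _ this.symm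

lemma τnE (x : R) : D.nE (D.τ x) = star (D.nE x) := by
  apply D.ι_inj
  rw [nE_spec, ← D.τι, nE_spec, map_mul, map_mul, D.τσ, D.τσ, D.τσ, D.σ3]; ring

lemma σnE (x : R) : D.nE (D.σ x) = D.nE x := by
  apply D.ι_inj
  rw [nE_spec, nE_spec, D.σ3]; ring

/-- Ideal norm as product of conjugates -/
noncomputable def NI (I : Ideal R) : Ideal R :=
  I * Ideal.map D.σ I * Ideal.map D.σ (Ideal.map D.σ I)

lemma NI_mul (I J : Ideal R) : D.NI (I * J) = D.NI I * D.NI J := by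
  simp only [NI, Ideal.map_mul]; ring

lemma NI_span (x : R) : D.NI (Ideal.span {x}) = Ideal.span {D.ι (D.nE x)} := by
  rw [NI, map_span1, map_span1, Ideal.span_singleton_mul_span_singleton,
    Ideal.span_singleton_mul_span_singleton, nE_spec]

lemma NI_ne {I : Ideal R} (hI : I ≠ 0) : D.NI I ≠ 0 :=
  mul_ne_zero (mul_ne_zero hI (map_ne _ hI)) (map_ne _ (map_ne _ hI))

lemma map_sup_top {M B : Ideal R} (f : R ≃+* R) (hM : Ideal.map f M = M) (h : B ⊔ M = ⊤) :
    Ideal.map f B ⊔ M = ⊤ := by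
  have := congrArg (Ideal.map f) h
  rwa [Ideal.map_sup, hM, Ideal.map_top] at this

lemma NI_copr {M B : Ideal R} (hM : Ideal.map D.σ M = M) (h : B ⊔ M = ⊤) : D.NI B ⊔ M = ⊤ := by
  have h1 := map_sup_top D.σ hM h
  have h2 := map_sup_top D.σ hM h1
  rw [← Ideal.isCoprime_iff_sup_eq] at *
  exact (h.mul_left h1).mul_left h2

lemma NI_prin {I : Ideal R} (hI : I ≠ 0) : ∃ ν, ν ≠ 0 ∧ D.NI I = Ideal.span {D.ι ν} := by
  set 𝔫 : Ideal E := Ideal.span (D.nE '' (I : Set R)) with h𝔫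
  obtain ⟨ν, hν⟩ := (IsPrincipalIdealRing.principal 𝔫).principal
  rw [Ideal.submodule_span_eq] at hν
  have hle : Ideal.map D.ι 𝔫 ≤ D.NI I := by
    rw [h𝔫, Ideal.map_span, Ideal.span_le]
    rintro _ ⟨_, ⟨x, hx, rfl⟩, rfl⟩
    rw [SetLike.mem_coe, nE_spec]
    exact Ideal.mul_mem_mul (Ideal.mul_mem_mul hx (Ideal.mem_map_of_mem _ hx))
      (Ideal.mem_map_of_mem _ (Ideal.mem_map_of_mem _ hx))
  have hmap : Ideal.map D.ι 𝔫 = Ideal.span {D.ι ν} := by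
    rw [hν, Ideal.map_span]; simp
  rw [hmap] at hle
  have hν0 : ν ≠ 0 := by
    obtain ⟨x, hx, hx0⟩ := Submodule.exists_mem_ne_zero_of_ne_bot (hI : I ≠ ⊥)
    rintro rfl
    have : D.nE x ∈ 𝔫 := Ideal.subset_span ⟨x, hx, rfl⟩
    rw [hν] at this
    simp at this
    exact D.nE_ne hx0 this
  have hιν : D.ι ν ≠ 0 := by rwa [Ne, map_eq_zero_iff D.ι D.ι_inj]
  refine ⟨ν, hν0, le_antisymm ?_ hle⟩
  by_cases ht : Ideal.span {D.ι ν} = ⊤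
  · rw [ht]; exact le_top
  obtain ⟨a, B, ha, haI, hB, haB, hBM⟩ := exists_copr hI (span_ne hιν) ht
  have h1 : D.NI (Ideal.span {a}) ≤ Ideal.span {D.ι ν} := by
    rw [NI_span, Ideal.span_singleton_le_span_singleton]
    have : D.nE a ∈ 𝔫 := Ideal.subset_span ⟨a, haI, rfl⟩
    rw [hν, Ideal.mem_span_singleton] at this
    exact map_dvd _ this
  rw [haB, NI_mul] at h1
  have h2 := D.NI_copr (by rw [map_span1, D.σι]) hBM
  calc D.NI I = D.NI I * (D.NI B ⊔ Ideal.span {D.ι ν}) := by rw [h2, Ideal.mul_top]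
    _ = D.NI I * D.NI B ⊔ D.NI I * Ideal.span {D.ι ν} := Ideal.mul_sup _ _ _
    _ ≤ _ := sup_le h1 Ideal.mul_le_right

lemma cl_norm (c : ClassGroup R) : c * clMap D.σ c * clMap D.σ (clMap D.σ c) = 1 := by
  obtain ⟨I, hI, rfl⟩ := cl_surj c
  have h1 := map_ne D.σ hI
  have h2 := map_ne D.σ h1
  rw [clMap_cl _ hI, clMap_cl _ h1, ← cl_mul hI h1, ← cl_mul (mul_ne_zero hI h1) h2]
  obtain ⟨ν, hν, h⟩ := D.NI_prin hI
  change cl (D.NI I) = 1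
  rw [h, cl_span (by rwa [Ne, map_eq_zero_iff D.ι D.ι_inj])]

/-! trace -/
lemma ex_tr (x : R) : ∃ t, x + D.σ x + D.σ (D.σ x) = D.ι t := by
  apply D.fix
  rw [map_add, map_add, D.σ3]; ring

lemma ωrel : D.ι om ^ 2 = -1 - D.ι om := by
  rw [← map_pow, om_sq]; simp

lemma ι3 : D.ι 3 = 3 := by
  have : (3 : E) = 1 + 1 + 1 := by norm_num
  rw [this, map_add, map_add, map_one]; norm_num

lemma ιN : D.ι (N : E) = (N : R) := map_natCast _ _

lemma tr_id (x : R) : (3 * N : R) * x = N * (x + D.σ x + D.σ (D.σ x)) +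
    (x * D.θ^2 + D.σ (x * D.θ^2) + D.σ (D.σ (x * D.θ^2))) * D.θ +
    (x * D.θ + D.σ (x * D.θ) + D.σ (D.σ (x * D.θ))) * D.θ^2 := by
  simp only [map_mul, map_pow, D.σθ, D.σι]
  have h := D.θ3
  have w := D.ωrel
  rw [← h]
  generalize D.ι om = o at *
  have w3 : o ^ 3 = 1 := by linear_combination (o - 1) * w
  have w4 : o ^ 4 = o := by linear_combination o * w3
  linear_combination (-(D.θ^3 * D.σ x) - D.θ^3 * D.σ (D.σ x)) * w
   - D.θ^3 * D.σ (D.σ x) * (w4)  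

lemma rad {q : E} (hq : Prime q) (h3 : ¬ q ∣ 3 * (N : E)) {x : R}
    (hx : x ∈ (Ideal.span {D.ι q}).radical) : D.ι q ∣ x := by
  set K := Ideal.span {D.ι q} with hK
  have hσ : ∀ y ∈ K.radical, D.σ y ∈ K.radical := by
    rintro y ⟨n, hn⟩
    refine ⟨n, ?_⟩
    rw [hK, Ideal.mem_span_singleton] at hn ⊢
    rw [← map_pow, ← D.σι]
    exact map_dvd _ hn
  have htr : ∀ y ∈ K.radical, D.ι q ∣ y + D.σ y + D.σ (D.σ y) := by
    intro y hy
    obtain ⟨t, ht⟩ := D.ex_tr y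
    have : y + D.σ y + D.σ (D.σ y) ∈ K.radical :=
      add_mem (add_mem hy (hσ y hy)) (hσ _ (hσ y hy))
    obtain ⟨n, hn⟩ := this
    rw [ht, ← map_pow, hK, Ideal.mem_span_singleton] at hn
    rw [ht]
    exact map_dvd _ (hq.dvd_of_dvd_pow (D.dvd_desc hn))
  have h1 : D.ι q ∣ D.ι (3 * (N : E)) * x := by
    have e : D.ι (3 * (N : E)) = (3 * N : R) := by rw [map_mul, D.ι3, D.ιN]
    rw [e, D.tr_id]
    exact dvd_add (dvd_add (dvd_mul_of_dvd_right (htr _ hx) _)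
      (dvd_mul_of_dvd_left (htr _ (Ideal.mul_mem_right _ _ hx)) _))
      (dvd_mul_of_dvd_left (htr _ (Ideal.mul_mem_right _ _ hx)) _)
  have h2 : IsCoprime q (3 * (N : E)) := (hq.irreducible.coprime_iff_not_dvd).2 h3
  have h4 : IsCoprime (D.ι q) (D.ι (3 * (N : E))) := h2.map D.ι
  exact h4.dvd_of_dvd_mul_left h1

end basic
end Dat
end S11
end

section
namespace S11
open E
namespace Dat
section PL
variable {N : ℕ} {R : Type*} [CommRing R] [IsDedekindDomain R] (D : Dat N R)

lemma pi_facts (hp : N.Prime) (hN : N % 9 = 4 ∨ N % 9 = 7) :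
    ∃ π : E, π * star π = (N : E) ∧ Prime π ∧ IsCoprime π (star π) := by
  obtain ⟨β, hβ⟩ := exists_nn (q := N) hp (by omega)
  have hn : (M β).norm = N := by rw [← nn_cast, hβ]
  have h1 : Prime (M β) := by
    apply Irreducible.prime
    apply irreducible_of_norm
    rw [hn]; exact Nat.prime_iff_prime_int.1 hp
  refine ⟨M β, ?_, h1, ?_⟩
  · rw [mul_star_eq, hn]; simp
  · rw [h1.irreducible.coprime_iff_not_dvd]
    rintro ⟨u, hu⟩
    have hs : star (M β) = M (star β) := by
      exact (M_star β).symm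
    have hu1 : IsUnit u := by
      rw [isUnit_iff]
      have := congrArg QuadraticAlgebra.norm hu
      rw [QuadraticAlgebra.norm_star, map_mul] at this
      have h0 : (M β).norm ≠ 0 := by rw [hn]; exact_mod_cast hp.ne_zero
      exact mul_left_cancel₀ h0 (by rw [← this, mul_one])
    rw [hs] at hu
    have := unit_M hu1 hu.symm
    rw [this, mul_one, ← hs] at hu
    have him := congrArg QuadraticAlgebra.im hu
    simp at him
    have hi : β.im = 0 := by omega
    rw [norm_eq] at hn
    simp [hi] at hn
    have h2 : (N : ℤ) = (1 + 3 * β.re) * (1 + 3 * β.re) := by rw [← hn]; ring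
    have h3 : N = (1 + 3 * β.re).natAbs * (1 + 3 * β.re).natAbs := by
      rw [← Int.natAbs_mul, ← h2]; simp
    rw [h3] at hp
    exact Nat.not_prime_mul (fun h => by rw [h] at hp; norm_num at hp) (fun h => by rw [h] at hp; norm_num at hp) hp

lemma ιne {a : E} (h : a ≠ 0) : D.ι a ≠ 0 := by rwa [Ne, map_eq_zero_iff D.ι D.ι_inj]

lemma mem_cube_aux {Q : Ideal R} {x y a b : R} (e : x = a * x ^ 3 + b * y ^ 3) (hx : x ∈ Q)
    (hy : y ∈ Q) : x ∈ Q ^ 3 := by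
  have : a * x ^ 3 + b * y ^ 3 ∈ Q ^ 3 := add_mem (Ideal.mul_mem_left _ _ (Ideal.pow_mem_pow hx 3))
      (Ideal.mul_mem_left _ _ (Ideal.pow_mem_pow hy 3))
  rwa [← e] at this

lemma ex_P {π : E} (h : π * star π = (N : E)) (hc : IsCoprime π (star π)) :
    ∃ P : Ideal R, P ^ 3 = Ideal.span {D.ι π} := by
  refine ⟨Ideal.span {D.ι π, D.θ}, le_antisymm ?_ ?_⟩
  · rw [pow_three, ← mul_assoc]
    apply triple_le
    intro x hx y hy z hz
    obtain ⟨a, b, rfl⟩ := Ideal.mem_span_pair.1 hx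
    obtain ⟨c, d, rfl⟩ := Ideal.mem_span_pair.1 hy
    obtain ⟨e, f, rfl⟩ := Ideal.mem_span_pair.1 hz
    rw [Ideal.mem_span_singleton]
    have h3 : D.θ ^ 3 = D.ι π * D.ι (star π) := by rw [← map_mul, h, D.ιN, D.θ3]
    generalize D.ι (star π) = p' at *
    generalize D.ι π = p at *
    refine ⟨a * (c * p + d * D.θ) * (e * p + f * D.θ) + b * D.θ * c * (e * p + f * D.θ) +
      b * D.θ * d * D.θ * e + b * d * f * p', ?_⟩
    linear_combination b * d * f * h3
  · rw [Ideal.span_singleton_le_iff_mem]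
    obtain ⟨u, v, huv⟩ := (hc.pow_left (m := 2))
    have e : D.ι π = D.ι u * (D.ι π) ^ 3 + D.ι v * D.θ ^ 3 := by
      rw [D.θ3, ← D.ιN, ← h, ← map_pow, ← map_mul, ← map_mul, ← map_add]
      congr 1
      linear_combination -π * huv
    refine mem_cube_aux e ?_ ?_ <;> exact Ideal.subset_span (by simp)

lemma ex_Λ (hN : N % 9 = 4 ∨ N % 9 = 7) :
    ∃ Λ : Ideal R, Λ ^ 3 = Ideal.span {D.ι (1 - om)} := by
  have w := D.ωrel
  obtain ⟨m, hm, hm3⟩ : ∃ m : ℤ, (N : ℤ) = 3 * m + 1 ∧ m % 3 ≠ 0 := ⟨(N - 1) / 3, by omega, by omega⟩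
  obtain ⟨k, hk⟩ : ∃ k : ℤ, m * m = 1 + 3 * k := by
    have : m % 3 = 1 ∨ m % 3 = 2 := by omega
    refine ⟨(m * m - 1) / 3, ?_⟩
    have : m * m % 3 = 1 := by rcases this with h | h <;> simp [Int.mul_emod, h]
    omega
  have hθ : D.θ ^ 3 = 3 * (m : R) + 1 := by
    rw [D.θ3]; exact_mod_cast congrArg (Int.cast : ℤ → R) hm
  have hk' : (m : R) * m = 1 + 3 * k := by exact_mod_cast congrArg (Int.cast : ℤ → R) hk
  have el : D.ι (1 - om) = 1 - D.ι om := by simp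
  have hl0 : D.ι (1 - om) ≠ 0 := D.ιne (by
    intro h
    have := congrArg QuadraticAlgebra.re h
    simp at this
    exact absurd this (by decide))
  set o := D.ι om with ho
  rw [el] at hl0 ⊢
  set θ := D.θ
  have w3 : o ^ 3 = 1 := by linear_combination (o - 1) * w
  -- y = θ - 1
  have hy3 : (θ - 1) ^ 3 = 3 * (m - θ * (θ - 1)) := by linear_combination hθ
  have l2 : (1 - o) ^ 2 = - 3 * o := by linear_combination w
  have l2' : (3 : R) = - o ^ 2 * (1 - o) ^ 2 := by rw [l2]; linear_combination -3 * w3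
  have hdvd : (1 - o) ∣ (θ - 1) ^ 2 := by
    rw [← IsIntegrallyClosed.pow_dvd_pow_iff (n := 3) (by norm_num)]
    refine ⟨o * (1 - o) * (m - θ * (θ - 1)) ^ 2, ?_⟩
    have e1 : ((θ - 1) ^ 2) ^ 3 = 9 * (m - θ * (θ - 1)) ^ 2 := by
      rw [← pow_mul, mul_comm, pow_mul, hy3]; ring
    rw [e1]
    have e2 : (9 : R) = o * (1 - o) ^ 4 := by
      calc (9 : R) = 3 * 3 := by norm_num
        _ = (- o ^ 2 * (1 - o) ^ 2) * (- o ^ 2 * (1 - o) ^ 2) := by rw [← l2']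
        _ = _ := by linear_combination o * (1 - o) ^ 4 * w3
    rw [e2]; ring
  obtain ⟨z, hz⟩ := hdvd
  have hz3 : z ^ 3 = o * (1 - o) * (m - θ * (θ - 1)) ^ 2 := by
    apply mul_left_cancel₀ (pow_ne_zero 3 hl0)
    rw [← mul_pow, ← hz]
    have e1 : ((θ - 1) ^ 2) ^ 3 = 9 * (m - θ * (θ - 1)) ^ 2 := by
      rw [← pow_mul, mul_comm, pow_mul, hy3]; ring
    rw [e1]
    have e2 : (9 : R) = o * (1 - o) ^ 4 := by
      calc (9 : R) = 3 * 3 := by norm_num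
        _ = (- o ^ 2 * (1 - o) ^ 2) * (- o ^ 2 * (1 - o) ^ 2) := by rw [← l2']
        _ = _ := by linear_combination o * (1 - o) ^ 4 * w3
    rw [e2]; ring
  have hcop : IsCoprime ((1 - o) ^ 2) ((m - θ * (θ - 1)) ^ 2) := by
    apply IsCoprime.pow
    -- (m - θy)(m + θy) = m² - θ² (1-o) z = 1 + 3k - θ²(1-o) z
    refine ⟨o ^ 2 * (1 - o) * k + θ ^ 2 * z, m + θ * (θ - 1), ?_⟩
    linear_combination hk' - θ ^ 2 * hz + k * l2'
  refine ⟨Ideal.span {1 - o, z}, le_antisymm ?_ ?_⟩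
  · rw [pow_three, ← mul_assoc]
    apply triple_le
    intro x hx y hy t ht
    obtain ⟨a, b, rfl⟩ := Ideal.mem_span_pair.1 hx
    obtain ⟨c, d, rfl⟩ := Ideal.mem_span_pair.1 hy
    obtain ⟨e, f, rfl⟩ := Ideal.mem_span_pair.1 ht
    rw [Ideal.mem_span_singleton]
    refine ⟨a * (c * (1 - o) + d * z) * (e * (1 - o) + f * z) + b * z * c * (e * (1 - o) + f * z) +
      b * z * d * z * e + b * d * f * (o * (m - θ * (θ - 1)) ^ 2), ?_⟩
    linear_combination b * d * f * hz3
  · rw [Ideal.span_singleton_le_iff_mem]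
    obtain ⟨u, v, huv⟩ := hcop
    have e : 1 - o = u * (1 - o) ^ 3 + v * o ^ 2 * z ^ 3 := by
      rw [hz3]
      linear_combination -(1 - o) * huv - v * (1 - o) * (m - θ * (θ - 1)) ^ 2 * w3
    refine mem_cube_aux e ?_ ?_ <;> exact Ideal.subset_span (by simp)

end PL
end Dat
end S11
end

section
namespace S11
open E

/-- prime ideals above `N` and `3` -/
structure Ctx {N : ℕ} {R : Type*} [CommRing R] (D : Dat N R) where
  hp : N.Prime
  hN : N % 9 = 4 ∨ N % 9 = 7
  π : E
  hπ : π * star π = (N : E)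
  πp : Prime π
  P : Ideal R
  P3 : P ^ 3 = Ideal.span {D.ι π}
  Λ : Ideal R
  Λ3 : Λ ^ 3 = Ideal.span {D.ι (1 - om)}

namespace Ctx
section dec
variable {N : ℕ} {R : Type*} [CommRing R] [IsDedekindDomain R] {D : Dat N R} (C : Ctx D)

lemma exists_ctx (D : Dat N R) (hp : N.Prime) (hN : N % 9 = 4 ∨ N % 9 = 7) : Nonempty (Ctx D) := by
  obtain ⟨π, h1, h2, h3⟩ := Dat.pi_facts hp hN
  obtain ⟨P, hP⟩ := D.ex_P h1 h3
  obtain ⟨Λ, hΛ⟩ := D.ex_Λ hN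
  exact ⟨⟨hp, hN, π, h1, h2, P, hP, Λ, hΛ⟩⟩

lemma lam_ne : (1 - om : E) ≠ 0 := by
  intro h
  have := congrArg QuadraticAlgebra.re h
  simp at this
  exact absurd this (by decide)

lemma lam_norm : (1 - om : E).norm = 3 := by
  decide

lemma lam_prime : Prime (1 - om : E) :=
  (irreducible_of_norm (by rw [lam_norm]; exact Int.prime_three)).prime

lemma norm_π : C.π.norm = (N : ℤ) := by
  have := C.hπ
  rw [mul_star_eq] at this
  have := congrArg QuadraticAlgebra.re this
  simpa using this

lemma starπ_prime : Prime (star C.π) := by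
  apply (irreducible_of_norm _).prime
  rw [QuadraticAlgebra.norm_star, C.norm_π]
  exact Nat.prime_iff_prime_int.1 C.hp

lemma P_ne : C.P ≠ 0 := by
  intro h
  have := C.P3
  rw [h, zero_pow (by norm_num)] at this
  exact span_ne (D.ιne C.πp.ne_zero) this.symm

lemma Λ_ne : C.Λ ≠ 0 := by
  intro h
  have := C.Λ3
  rw [h, zero_pow (by norm_num)] at this
  exact span_ne (D.ιne lam_ne) this.symm

lemma σP : Ideal.map D.σ C.P = C.P := by
  apply cube_inj
  rw [← Ideal.map_pow, C.P3, map_span1, D.σι]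

lemma σΛ : Ideal.map D.σ C.Λ = C.Λ := by
  apply cube_inj
  rw [← Ideal.map_pow, C.Λ3, map_span1, D.σι]

lemma τP3 : (Ideal.map D.τ C.P) ^ 3 = Ideal.span {D.ι (star C.π)} := by
  rw [← Ideal.map_pow, C.P3, map_span1, D.τι]

lemma PτP : C.P * Ideal.map D.τ C.P = Ideal.span {D.θ} := by
  apply cube_inj
  rw [mul_pow, C.τP3, C.P3, Ideal.span_singleton_mul_span_singleton, ← map_mul, C.hπ,
    Ideal.span_singleton_pow, D.θ3, D.ιN]

lemma θne (C : Ctx D) : D.θ ≠ 0 := by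
  intro h
  have := C.PτP
  rw [h] at this
  have h2 : C.P * Ideal.map D.τ C.P = 0 := by rw [this]; simp
  exact mul_ne_zero C.P_ne (map_ne _ C.P_ne) h2

/-- good elements -/
def Good (D : Dat N R) (α : R) : Prop := α ≠ 0 ∧ ∃ k : ℕ, D.σ α = D.ι om ^ k * α

lemma good_mul {a b : R} (ha : Good D a) (hb : Good D b) : Good D (a * b) := by
  obtain ⟨h1, k, hk⟩ := ha
  obtain ⟨h2, l, hl⟩ := hb
  refine ⟨mul_ne_zero h1 h2, k + l, ?_⟩
  rw [map_mul, hk, hl]; ring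

lemma good_ι {a : E} (ha : a ≠ 0) : Good D (D.ι a) :=
  ⟨D.ιne ha, 0, by rw [D.σι]; ring⟩

lemma good_θ (C : Ctx D) : Good D D.θ := ⟨C.θne, 1, by rw [D.σθ]; ring⟩

/-- decomposition predicate -/
def Dec (I : Ideal R) : Prop := ∃ (i j : ℕ) (b a : R), Good D b ∧ Good D a ∧
  Ideal.span {b} * I = Ideal.span {a} * (C.P ^ i * C.Λ ^ j)

lemma dec_mul {I J : Ideal R} (hI : C.Dec I) (hJ : C.Dec J) : C.Dec (I * J) := by
  obtain ⟨i, j, b, a, hb, ha, h⟩ := hI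
  obtain ⟨i', j', b', a', hb', ha', h'⟩ := hJ
  refine ⟨i + i', j + j', b * b', a * a', good_mul hb hb', good_mul ha ha', ?_⟩
  rw [← Ideal.span_singleton_mul_span_singleton, ← Ideal.span_singleton_mul_span_singleton]
  calc _ = (Ideal.span {b} * I) * (Ideal.span {b'} * J) := by ring
    _ = _ := by rw [h, h']; ring

lemma dec_span {a : R} (ha : Good D a) : C.Dec (Ideal.span {a}) :=
  ⟨0, 0, D.ι 1, a, good_ι one_ne_zero, ha, by simp⟩

lemma dec_P : C.Dec C.P := ⟨1, 0, D.ι 1, D.ι 1, good_ι one_ne_zero, good_ι one_ne_zero, by simp⟩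
lemma dec_Λ : C.Dec C.Λ := ⟨0, 1, D.ι 1, D.ι 1, good_ι one_ne_zero, good_ι one_ne_zero, by simp⟩
lemma dec_τP : C.Dec (Ideal.map D.τ C.P) := by
  refine ⟨2, 0, D.ι C.π, D.θ, good_ι C.πp.ne_zero, C.good_θ, ?_⟩
  rw [← C.P3, ← C.PτP]; ring

lemma prime_cases {q : E} (hq : Prime q) (h : q ∣ 3 * (N : E)) :
    ∃ Q : Ideal R, Q ^ 3 = Ideal.span {D.ι q} ∧ C.Dec Q := by
  have e : (3 : E) = (1 - om) ^ 2 * (- om ^ 2) := by decide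
  have key : ∀ x : E, Prime x → q ∣ x → Ideal.span {D.ι q} = Ideal.span {D.ι x} := by
    intro x hx hqx
    have := (hq.dvd_prime_iff_associated hx).1 hqx
    rw [Ideal.span_singleton_eq_span_singleton]
    exact this.map D.ι
  rw [← C.hπ, e] at h
  rcases hq.dvd_or_dvd h with h | h
  · rcases hq.dvd_or_dvd h with h | h
    · exact ⟨C.Λ, by rw [C.Λ3, key _ lam_prime (hq.dvd_of_dvd_pow h)], C.dec_Λ⟩
    · exfalso
      rw [dvd_neg] at h
      have h1 := hq.dvd_of_dvd_pow h
      have : IsUnit om := by rw [isUnit_iff]; decide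
      exact hq.not_unit (isUnit_of_dvd_unit h1 this)
  · rcases hq.dvd_or_dvd h with h | h
    · exact ⟨C.P, by rw [C.P3, key _ C.πp h], C.dec_P⟩
    · exact ⟨_, by rw [C.τP3, key _ C.starπ_prime h], C.dec_τP⟩

lemma decomp : ∀ (n : ℕ) (ν : E), ν ≠ 0 → ν.norm.natAbs ≤ n → ∀ I : Ideal R,
    I ^ 3 = Ideal.span {D.ι ν} → C.Dec I := by
  intro n
  induction n with
  | zero =>
    intro ν hν h
    have := norm_pos hν
    omega
  | succ n ih =>
    intro ν hν hn I hI
    by_cases hu : IsUnit ν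
    · have h1 : I ^ 3 = (1 : Ideal R) ^ 3 := by
        rw [hI, one_pow, Ideal.one_eq_top, Ideal.span_singleton_eq_top]
        exact hu.map D.ι
      rw [cube_inj h1]
      have := C.dec_span (good_ι (D := D) (one_ne_zero (α := E)))
      simpa using this
    obtain ⟨q, hq, hqν⟩ := WfDvdMonoid.exists_irreducible_factor hu hν
    have hqp := hq.prime
    have hle : I ^ 3 ≤ Ideal.span {D.ι q} := by
      rw [hI, Ideal.span_singleton_le_span_singleton]; exact map_dvd _ hqν
    -- find Q, r with Q^3 = (ι r), Q ∣ I, r non unit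
    obtain ⟨Q, r, hr, hru, hQ3, hQI, hQd⟩ : ∃ (Q : Ideal R) (r : E), r ≠ 0 ∧ ¬ IsUnit r ∧
        Q ^ 3 = Ideal.span {D.ι r} ∧ Q ∣ I ∧ C.Dec Q := by
      by_cases h3 : q ∣ 3 * (N : E)
      · obtain ⟨Q, h1, h2⟩ := C.prime_cases hqp h3
        exact ⟨Q, q, hqp.ne_zero, hq.not_isUnit, h1,
          cube_dvd (by rw [h1]; exact Ideal.dvd_iff_le.2 hle), h2⟩
      · refine ⟨Ideal.span {D.ι q}, q ^ 3, pow_ne_zero _ hqp.ne_zero, ?_, ?_, ?_, ?_⟩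
        · intro h; exact hq.not_isUnit ((isUnit_pow_iff (by norm_num)).1 h)
        · rw [Ideal.span_singleton_pow, map_pow]
        · rw [Ideal.dvd_iff_le]
          intro x hx
          rw [Ideal.mem_span_singleton]
          exact D.rad hqp h3 ⟨3, hle (Ideal.pow_mem_pow hx 3)⟩
        · exact C.dec_span (good_ι hqp.ne_zero)
    obtain ⟨J, rfl⟩ := hQI
    refine C.dec_mul hQd ?_
    rw [mul_pow, hQ3] at hI
    have hdv : D.ι r ∣ D.ι ν := by
      rw [← Ideal.span_singleton_le_span_singleton, ← hI]
      exact Ideal.mul_le_left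
    obtain ⟨ν', rfl⟩ := D.dvd_desc hdv
    have hν' : ν' ≠ 0 := right_ne_zero_of_mul hν
    refine ih ν' hν' ?_ J ?_
    · have h1 := norm_pos hν'
      have h2 := norm_pos hr
      have h3 : r.norm ≠ 1 := fun h => hru (isUnit_iff.2 h)
      rw [map_mul, Int.natAbs_mul] at hn
      have h4 : 2 ≤ r.norm.natAbs := by omega
      have h5 : 1 ≤ ν'.norm.natAbs := by omega
      nlinarith
    · rw [map_mul, ← Ideal.span_singleton_mul_span_singleton] at hI
      exact mul_left_cancel₀ (span_ne (D.ιne hr)) hI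

lemma dec_stable {I : Ideal R} (hI : I ≠ 0) (hs : Ideal.map D.σ I = I) : C.Dec I := by
  obtain ⟨ν, hν, h⟩ := D.NI_prin hI
  refine C.decomp _ ν hν le_rfl I ?_
  rw [← h, Dat.NI, hs, hs]; ring

/-- subgroup generated by P, Λ -/
noncomputable def T : Subgroup (ClassGroup R) := Subgroup.closure {cl C.P, cl C.Λ}

lemma dec_T {I : Ideal R} (hI : I ≠ 0) (h : C.Dec I) : cl I ∈ C.T := by
  obtain ⟨i, j, b, a, hb, ha, h⟩ := h
  have := congrArg cl h
  rw [cl_mul (span_ne hb.1) hI, cl_mul (span_ne ha.1) (mul_ne_zero (pow_ne_zero _ C.P_ne)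
    (pow_ne_zero _ C.Λ_ne)), cl_span hb.1, cl_span ha.1, one_mul, one_mul,
    cl_mul (pow_ne_zero _ C.P_ne) (pow_ne_zero _ C.Λ_ne), cl_pow C.P_ne, cl_pow C.Λ_ne] at this
  rw [this]
  exact mul_mem (pow_mem (Subgroup.subset_closure (by simp)) _)
    (pow_mem (Subgroup.subset_closure (by simp)) _)

end dec
end Ctx
end S11
end

section
namespace S11
open E
namespace Ctx
section nrm
variable {N : ℕ} {R : Type*} [CommRing R] [IsDedekindDomain R] [Module.Free ℤ R] [Module.Finite ℤ R]
  {D : Dat N R} (C : Ctx D)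

lemma aN_map (f : R ≃+* R) (I : Ideal R) : Ideal.absNorm (Ideal.map f I) = Ideal.absNorm I := by
  rw [Ideal.absNorm_apply, Ideal.absNorm_apply, Submodule.cardQuot_apply, Submodule.cardQuot_apply]
  exact (Nat.card_congr (Ideal.quotientEquiv I (Ideal.map f I) f rfl).toEquiv).symm

lemma ι_norm (D : Dat N R) (ν : E) : D.ι (ν * star ν) = ((ν.norm.natAbs : ℕ) : R) := by
  rw [mul_star_eq, map_intCast]
  have : (ν.norm.natAbs : ℤ) = ν.norm := Int.natAbs_of_nonneg (norm_nonneg _)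
  rw [← Int.cast_natCast, this]

lemma aN_ι (D : Dat N R) (hr : Module.finrank ℤ R = 6) (ν : E) :
    Ideal.absNorm (Ideal.span {D.ι ν}) = ν.norm.natAbs ^ 3 := by
  have h1 : Ideal.absNorm (Ideal.span {D.ι (star ν)}) = Ideal.absNorm (Ideal.span {D.ι ν}) := by
    rw [← D.τι, ← map_span1, aN_map]
  have h2 : Ideal.absNorm (Ideal.span {D.ι ν}) * Ideal.absNorm (Ideal.span {D.ι (star ν)}) =
      ν.norm.natAbs ^ 6 := by
    rw [← map_mul, Ideal.span_singleton_mul_span_singleton, ← map_mul, ι_norm,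
      Ideal.absNorm_span_natCast, hr]
  rw [h1] at h2
  have h3 : (Ideal.absNorm (Ideal.span {D.ι ν})) ^ 2 = (ν.norm.natAbs ^ 3) ^ 2 := by
    rw [sq, h2]; ring
  exact Nat.pow_left_injective (n := 2) (by norm_num) h3

lemma aN_NI (D : Dat N R) (I : Ideal R) : Ideal.absNorm (D.NI I) = Ideal.absNorm I ^ 3 := by
  rw [Dat.NI, map_mul, map_mul, aN_map, aN_map, aN_map]; ring

lemma aN_of_NI (hr : Module.finrank ℤ R = 6) {I : Ideal R} {ν : E}
    (h : D.NI I = Ideal.span {D.ι ν}) : Ideal.absNorm I = ν.norm.natAbs := by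
  have h1 := aN_NI D I
  rw [h, aN_ι D hr] at h1
  exact (Nat.pow_left_injective (n := 3) (by norm_num) h1).symm

lemma aN_of_cube (hr : Module.finrank ℤ R = 6) {I : Ideal R} {ν : E}
    (h : I ^ 3 = Ideal.span {D.ι ν}) : Ideal.absNorm I = ν.norm.natAbs := by
  have h1 := congrArg Ideal.absNorm h
  rw [aN_ι D hr, map_pow] at h1
  exact (Nat.pow_left_injective (n := 3) (by norm_num) h1)

lemma aN_P (hr : Module.finrank ℤ R = 6) : Ideal.absNorm C.P = N := by
  rw [aN_of_cube hr C.P3, C.norm_π]; simp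

lemma aN_Λ (hr : Module.finrank ℤ R = 6) : Ideal.absNorm C.Λ = 3 := by
  rw [aN_of_cube hr C.Λ3, lam_norm]; rfl

lemma ex_φ (hr : Module.finrank ℤ R = 6) : ∃ φ : R →+* ZMod N, ∀ x, φ x = 0 ↔ x ∈ C.P := by
  have h := C.aN_P hr
  rw [Ideal.absNorm_apply, Submodule.cardQuot_apply] at h
  haveI : Finite (R ⧸ C.P) := Nat.finite_of_card_ne_zero (by rw [h]; exact C.hp.ne_zero)
  letI := Fintype.ofFinite (R ⧸ C.P)
  let e : ZMod N ≃+* R ⧸ C.P := ZMod.ringEquivOfPrime (R ⧸ C.P) C.hp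
    (by rw [Fintype.card_eq_nat_card, h])
  refine ⟨(e.symm : (R ⧸ C.P) →+* ZMod N).comp (Ideal.Quotient.mk C.P), fun x => ?_⟩
  rw [← Ideal.Quotient.eq_zero_iff_mem]
  simp

/-- reduction modulo P -/
noncomputable def φ (hr : Module.finrank ℤ R = 6) : R →+* ZMod N := (C.ex_φ hr).choose

lemma φ_zero (hr : Module.finrank ℤ R = 6) (x : R) : C.φ hr x = 0 ↔ x ∈ C.P :=
  (C.ex_φ hr).choose_spec x

lemma φσ (hr : Module.finrank ℤ R = 6) (x : R) : C.φ hr (D.σ x) = C.φ hr x := by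
  haveI : NeZero N := ⟨C.hp.ne_zero⟩
  have h1 : x - ((C.φ hr x).val : R) ∈ C.P := by
    rw [← C.φ_zero hr, map_sub, map_natCast, ZMod.natCast_zmod_val, sub_self]
  have h2 : D.σ (x - ((C.φ hr x).val : R)) ∈ C.P := by
    rw [← C.σP]; exact Ideal.mem_map_of_mem _ h1
  rw [← C.φ_zero hr, map_sub, map_sub, map_natCast, map_natCast, ZMod.natCast_zmod_val] at h2
  exact sub_eq_zero.1 h2

lemma φ_nE (hr : Module.finrank ℤ R = 6) (x : R) : C.φ hr (D.ι (D.nE x)) = C.φ hr x ^ 3 := by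
  rw [D.nE_spec, map_mul, map_mul, φσ, φσ, φσ]; ring

lemma φ_aN (hr : Module.finrank ℤ R = 6) (x : R) :
    ((Ideal.absNorm (Ideal.span {x}) : ℕ) : ZMod N) = (C.φ hr x * C.φ hr (D.τ x)) ^ 3 := by
  rw [aN_of_NI hr (D.NI_span x), ← map_natCast (C.φ hr), ← ι_norm, ← D.τnE, map_mul, map_mul,
    φ_nE, φ_nE]; ring

lemma unit_list {u : E} (hu : IsUnit u) : u = 1 ∨ u = -1 ∨ (u ^ 2) ^ 2 + u ^ 2 + 1 = 0 := by
  rw [isUnit_iff, norm_eq] at hu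
  have h1 : u.re ^ 2 ≤ 1 := by nlinarith [sq_nonneg (u.re - 2 * u.im)]
  have h2 : u.im ^ 2 ≤ 1 := by nlinarith [sq_nonneg (u.im - 2 * u.re)]
  obtain ⟨a, b⟩ := u
  simp only at h1 h2 hu
  have ha : -1 ≤ a := by nlinarith
  have ha' : a ≤ 1 := by nlinarith
  have hb : -1 ≤ b := by nlinarith
  have hb' : b ≤ 1 := by nlinarith
  interval_cases a <;> interval_cases b <;> first | (exfalso; revert hu; norm_num; done) | decide

lemma unit_pm (hr : Module.finrank ℤ R = 6) {u : E} (hu : IsUnit u) {t : ZMod N}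
    (ht : t ^ 3 = C.φ hr (D.ι u)) : u = 1 ∨ u = -1 := by
  haveI : Fact N.Prime := ⟨C.hp⟩
  rcases unit_list hu with h | h | h
  · exact Or.inl h
  · exact Or.inr h
  exfalso
  have h1 := congrArg (fun z => C.φ hr (D.ι z)) h
  simp only [map_add, map_pow, map_one, map_zero] at h1
  rw [← ht] at h1
  set s := t ^ 2 with hs
  have e : (t ^ 3) ^ 2 = s ^ 3 := by rw [hs]; ring
  rw [e] at h1
  have h9 : s ^ 9 = 1 := by linear_combination (s ^ 3 - 1) * h1
  have h3 : s ^ 3 ≠ 1 := by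
    intro h
    rw [h] at h1
    have h3 : ((3 : ℕ) : ZMod N) = 0 := by push_cast; linear_combination h1
    rw [ZMod.natCast_eq_zero_iff] at h3
    have := (Nat.prime_dvd_prime_iff_eq C.hp Nat.prime_three).1 h3
    have := C.hN
    omega
  have ho : orderOf s = 3 ^ (1 + 1) := orderOf_eq_prime_pow (by simpa using h3) (by simpa using h9)
  have hs0 : s ≠ 0 := by
    intro h
    rw [h] at h9
    simp at h9
  have := ZMod.orderOf_dvd_card_sub_one hs0
  rw [ho] at this
  have := C.hN
  have := C.hp.pos
  omega

/-- key: norms of scaling factors -/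
lemma scale (hr : Module.finrank ℤ R = 6) {I : Ideal R} (hI : I ≠ 0) (hIP : ¬ I ≤ C.P) {x y : R}
    (hx : x ≠ 0) (hy : y ≠ 0) (h : Ideal.span {x} * I = Ideal.span {y} * Ideal.map D.σ I) :
    D.nE x = D.nE y ∨ D.nE x = - D.nE y := by
  haveI : Fact N.Prime := ⟨C.hp⟩
  have h1 : Ideal.span {D.ι (D.nE x)} = Ideal.span {D.ι (D.nE y)} := by
    have := congrArg D.NI h
    rw [D.NI_mul, D.NI_mul, D.NI_span, D.NI_span] at this
    have e : D.NI (Ideal.map D.σ I) = D.NI I := by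
      have e2 : Ideal.map D.σ (Ideal.map D.σ (Ideal.map D.σ I)) = I := by
        apply le_antisymm
        · rw [Ideal.map_le_iff_le_comap, Ideal.map_le_iff_le_comap, Ideal.map_le_iff_le_comap]
          intro z hz
          change D.σ (D.σ (D.σ z)) ∈ I
          rwa [D.σ3]
        · intro z hz
          rw [← D.σ3 z]
          exact Ideal.mem_map_of_mem _ (Ideal.mem_map_of_mem _ (Ideal.mem_map_of_mem _ hz))
      simp only [Dat.NI]
      rw [e2]; ring
    rw [e] at this
    exact mul_right_cancel₀ (D.NI_ne hI) this
  have h2 : ∃ u : E, IsUnit u ∧ D.nE x = u * D.nE y := by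
    rw [Ideal.span_singleton_eq_span_singleton] at h1
    have h3 : Associated (D.nE y) (D.nE x) :=
      associated_of_dvd_dvd (D.dvd_desc h1.symm.dvd) (D.dvd_desc h1.dvd)
    obtain ⟨u, hu⟩ := h3
    exact ⟨u, u.isUnit, by rw [← hu, mul_comm]⟩
  obtain ⟨u, hu, hxy⟩ := h2
  obtain ⟨b, hbI, hbP⟩ := SetLike.not_le_iff_exists.1 hIP
  have h4 : x * b ∈ Ideal.span {y} * Ideal.map D.σ I := by
    rw [← h]; exact Ideal.mul_mem_mul (Ideal.mem_span_singleton_self x) hbI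
  obtain ⟨a, -, ha⟩ := Ideal.mem_span_singleton_mul.1 h4
  have h5 : D.nE a = u * D.nE b := by
    apply mul_left_cancel₀ (D.nE_ne hy)
    rw [← D.nE_mul, ha, D.nE_mul, hxy]; ring
  have hb0 : C.φ hr b ≠ 0 := fun h => hbP ((C.φ_zero hr b).1 h)
  have h6 : (C.φ hr a / C.φ hr b) ^ 3 = C.φ hr (D.ι u) := by
    have := congrArg (fun z => C.φ hr (D.ι z)) h5
    simp only [map_mul] at this
    rw [φ_nE, φ_nE] at this
    rw [div_pow, this]
    field_simp
  rcases C.unit_pm hr hu h6 with rfl | rfl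
  · left; rw [hxy, one_mul]
  · right; rw [hxy, neg_one_mul]

/-- Hilbert 90 -/
lemma hilb {x y : R} (hy : y ≠ 0) (h : D.nE x = D.nE y) (hR : (3 : R) ≠ 0) (hθ : D.θ ≠ 0) :
    ∃ δ, δ ≠ 0 ∧ x * D.σ δ = δ * D.σ (D.σ y) := by
  have h' : x * D.σ x * D.σ (D.σ x) = y * D.σ y * D.σ (D.σ y) := by
    rw [← D.nE_spec, ← D.nE_spec, h]
  set f : R → R := fun c => y * D.σ y * c + x * D.σ y * D.σ c + x * D.σ x * D.σ (D.σ c) with hf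
  have key : ∀ c, x * D.σ (f c) = f c * D.σ (D.σ y) := by
    intro c
    simp only [hf, map_add, map_mul, D.σ3]
    linear_combination c * h'
  have hσy : D.σ y ≠ 0 := by simpa using hy
  by_contra hcon
  push Not at hcon
  have hz : ∀ c, f c = 0 := fun c => by
    by_contra hc
    exact hcon _ hc (key c)
  have e0 := hz 1
  have e1 := hz D.θ
  have e2 := hz (D.θ ^ 2)
  have w := D.ωrel
  simp only [hf, map_mul, map_pow, D.σθ, D.σι, map_one] at e0 e1 e2
  have : 3 * (y * D.σ y) * D.θ ^ 2 = 0 := by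
    generalize D.ι om = o at *
    have w3 : o ^ 3 = 1 := by linear_combination (o - 1) * w
    have w4 : o ^ 4 = o := by linear_combination o * w3
    linear_combination D.θ ^ 2 * e0 + D.θ * e1 + e2 - (x * D.σ y * D.θ ^ 2 + x * D.σ x * D.θ ^ 2) * w - x * D.σ x * D.θ ^ 2 * w4
  simp [hy, hR, hθ] at this

lemma P_ne_top : C.P ≠ ⊤ := by
  intro h
  have := C.P3
  rw [h, Ideal.top_pow, eq_comm, Ideal.span_singleton_eq_top] at this
  have h2 : D.ι C.π ∣ D.ι 1 := by rw [map_one]; exact this.dvd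
  exact C.πp.not_unit (isUnit_of_dvd_one (D.dvd_desc h2))

lemma N_mem : (N : R) ∈ C.P := by
  have h : Ideal.span {D.θ} ≤ C.P := by rw [← C.PτP]; exact Ideal.mul_le_left
  rw [Ideal.span_singleton_le_iff_mem] at h
  rw [← D.θ3]
  exact Ideal.pow_mem_of_mem _ h 3 (by norm_num)

lemma N_ne [CharZero R] (C : Ctx D) : Ideal.span {(N : R)} ≠ 0 :=
  span_ne (by exact_mod_cast C.hp.ne_zero)

lemma N_le : Ideal.span {(N : R)} ≤ C.P := (Ideal.span_singleton_le_iff_mem _).2 C.N_mem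

lemma N_top (C : Ctx D) : Ideal.span {(N : R)} ≠ ⊤ := fun h => C.P_ne_top (top_le_iff.1 (h ▸ C.N_le))

lemma not_le_P {I : Ideal R} (h : I ⊔ Ideal.span {(N : R)} = ⊤) : ¬ I ≤ C.P := by
  intro h'
  exact C.P_ne_top (top_le_iff.1 (h ▸ sup_le h' C.N_le))

lemma fixed_T [CharZero R] (hr : Module.finrank ℤ R = 6) (c : ClassGroup R)
    (hc : clMap D.σ c = c) : c ∈ C.T := by
  obtain ⟨I, hI, rfl, hIN⟩ := cl_copr c C.N_ne C.N_top
  rw [clMap_cl _ hI, eq_comm, cl_eq_iff hI (map_ne _ hI)] at hc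
  obtain ⟨x, y, hx, hy, h⟩ := hc
  obtain ⟨y, hy, hn, h⟩ : ∃ y : R, y ≠ 0 ∧ D.nE x = D.nE y ∧
      Ideal.span {x} * I = Ideal.span {y} * Ideal.map D.σ I := by
    rcases C.scale hr hI (C.not_le_P hIN) hx hy h with h' | h'
    · exact ⟨y, hy, h', h⟩
    · exact ⟨-y, neg_ne_zero.2 hy, by rw [h', D.nE_neg], by rw [h, Ideal.span_singleton_neg]⟩
  obtain ⟨δ, hδ, hδ2⟩ := hilb hy hn (by norm_num) C.θne
  have hσσ : D.σ (D.σ y) ≠ 0 := by simpa using hy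
  have hK : δ * D.σ (D.σ y) ≠ 0 := mul_ne_zero hδ hσσ
  have : cl (Ideal.span {δ * D.σ (D.σ y)} * I) = cl I := by
    rw [cl_mul (span_ne hK) hI, cl_span hK, one_mul]
  rw [← this]
  apply C.dec_T (mul_ne_zero (span_ne hK) hI)
  apply C.dec_stable (mul_ne_zero (span_ne hK) hI)
  rw [Ideal.map_mul, map_span1, map_mul, D.σ3, ← Ideal.span_singleton_mul_span_singleton,
    mul_assoc, ← h, ← mul_assoc, Ideal.span_singleton_mul_span_singleton, mul_comm _ x, hδ2]

lemma T_fixed (c : ClassGroup R) (hc : c ∈ C.T) : clMap D.σ c = c := by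
  induction hc using Subgroup.closure_induction with
  | mem x hx =>
    rcases hx with rfl | rfl
    · rw [clMap_cl _ C.P_ne, C.σP]
    · rw [clMap_cl _ C.Λ_ne, C.σΛ]
  | one => exact map_one _
  | mul a b _ _ h1 h2 => rw [map_mul, h1, h2]
  | inv a _ h => rw [map_inv, h]

end nrm
end Ctx
end S11
end

section
namespace S11
open E
namespace Ctx
section units
variable {N : ℕ} {R : Type*} [CommRing R] [IsDedekindDomain R] [Module.Free ℤ R] [Module.Finite ℤ R]
  [CharZero R] {D : Dat N R} (C : Ctx D)

lemma nE_one : D.nE 1 = 1 := by rw [← map_one D.ι, D.nE_ι, one_pow]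

lemma nE_unit_pm (hr : Module.finrank ℤ R = 6) (C : Ctx D) (u : Rˣ) :
    D.nE (u : R) = 1 ∨ D.nE (u : R) = -1 := by
  have := C.scale hr (I := 1) one_ne_zero (x := (u : R)) (y := 1) (by
    rw [Ideal.one_eq_top, top_le_iff]; exact C.P_ne_top) u.ne_zero one_ne_zero (by
    rw [Ideal.one_eq_top, Ideal.map_top, Ideal.span_singleton_one,
      Ideal.span_singleton_eq_top.2 u.isUnit])
  rwa [nE_one] at this

/-- omega as a unit -/
noncomputable def ou (D : Dat N R) : Rˣ :=
  ⟨D.ι om, D.ι om ^ 2, by have := D.ωrel; linear_combination (D.ι om - 1) * this,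
    by have := D.ωrel; linear_combination (D.ι om - 1) * this⟩

lemma ou3 (D : Dat N R) : ou D ^ 3 = 1 := by
  ext
  simp only [ou, Units.val_pow_eq_pow_val, Units.val_one]
  have := D.ωrel; linear_combination (D.ι om - 1) * this

lemma unit_hilb1 (hr : Module.finrank ℤ R = 6)
    (hall : ∀ i j : ℕ, cl C.P ^ i * cl C.Λ ^ j = 1 → 3 ∣ i ∧ 3 ∣ j) (u : Rˣ)
    (hu : D.nE (u : R) = 1) : ∃ v ζ : Rˣ, ζ ^ 3 = 1 ∧ (u : R) * D.σ v = ζ * v := by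
  obtain ⟨δ, hδ, h1⟩ := hilb (D := D) (x := (u : R)) (y := 1) one_ne_zero (by rw [hu, nE_one])
    (by norm_num) C.θne
  rw [map_one, map_one, mul_one] at h1
  have hst : Ideal.map D.σ (Ideal.span {δ}) = Ideal.span {δ} := by
    rw [map_span1, Ideal.span_singleton_eq_span_singleton]
    exact ⟨u, by rw [mul_comm]; exact h1⟩
  obtain ⟨i, j, b, a, hb, ha, h2⟩ := C.dec_stable (span_ne hδ) hst
  have h3 := congrArg cl h2
  rw [cl_mul (span_ne hb.1) (span_ne hδ), cl_mul (span_ne ha.1) (mul_ne_zero (pow_ne_zero _ C.P_ne)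
    (pow_ne_zero _ C.Λ_ne)), cl_span hb.1, cl_span ha.1, one_mul, one_mul,
    cl_mul (pow_ne_zero _ C.P_ne) (pow_ne_zero _ C.Λ_ne), cl_pow C.P_ne, cl_pow C.Λ_ne,
    cl_span hδ] at h3
  obtain ⟨⟨i', rfl⟩, ⟨j', rfl⟩⟩ := hall i j h3.symm
  rw [pow_mul, pow_mul, C.P3, C.Λ3, Ideal.span_singleton_pow, Ideal.span_singleton_pow, ← map_pow,
    ← map_pow, Ideal.span_singleton_mul_span_singleton, Ideal.span_singleton_mul_span_singleton,
    Ideal.span_singleton_mul_span_singleton, ← map_mul] at h2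
  have hμ : C.π ^ i' * (1 - om) ^ j' ≠ 0 :=
    mul_ne_zero (pow_ne_zero _ C.πp.ne_zero) (pow_ne_zero _ lam_ne)
  have ha' : Good D (a * D.ι (C.π ^ i' * (1 - om) ^ j')) := good_mul ha (good_ι hμ)
  generalize a * D.ι (C.π ^ i' * (1 - om) ^ j') = a' at h2 ha'
  obtain ⟨v, hv⟩ := Ideal.span_singleton_eq_span_singleton.1 h2.symm
  obtain ⟨ha0, k, hk⟩ := ha'
  obtain ⟨hb0, l, hl⟩ := hb
  have w3 : D.ι om ^ 3 = 1 := by have := D.ωrel; linear_combination (D.ι om - 1) * this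
  refine ⟨v, ou D ^ (l + 2 * k), ?_, ?_⟩
  · rw [← pow_mul, mul_comm, pow_mul, ou3, one_pow]
  · have hσ := congrArg D.σ hv
    rw [map_mul, map_mul, hk, hl] at hσ
    apply mul_left_cancel₀ ha0
    have e : ((ou D ^ (l + 2 * k) : Rˣ) : R) = D.ι om ^ (l + 2 * k) := by simp [ou]
    rw [e]
    have wk : (D.ι om ^ k) ^ 3 = 1 := by rw [← pow_mul, mul_comm, pow_mul, w3, one_pow]
    have e2 : D.ι om ^ (l + 2 * k) = D.ι om ^ l * (D.ι om ^ k) ^ 2 := by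
      rw [pow_add, mul_comm 2 k, pow_mul]
    rw [e2]
    generalize D.ι om ^ k = o at *
    generalize D.ι om ^ l = o' at *
    linear_combination (u : R) * o ^ 2 * hσ - o' * o ^ 2 * hv + b * o' * o ^ 2 * h1 - u * a' * D.σ v * wk

lemma unit_hilb (hr : Module.finrank ℤ R = 6)
    (hall : ∀ i j : ℕ, cl C.P ^ i * cl C.Λ ^ j = 1 → 3 ∣ i ∧ 3 ∣ j) (u : Rˣ) :
    ∃ v ζ : Rˣ, ζ ^ 6 = 1 ∧ (u : R) * D.σ v = ζ * v := by
  rcases nE_unit_pm hr C u with h | h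
  · obtain ⟨v, ζ, h1, h2⟩ := C.unit_hilb1 hr hall u h
    exact ⟨v, ζ, by rw [show 6 = 3 * 2 by norm_num, pow_mul, h1, one_pow], h2⟩
  · obtain ⟨v, ζ, h1, h2⟩ := C.unit_hilb1 hr hall (-u) (by
      rw [Units.val_neg, D.nE_neg, h, neg_neg])
    refine ⟨v, -ζ, by rw [show 6 = 2 * 3 by norm_num, pow_mul, neg_sq, ← pow_mul, mul_comm, pow_mul,
      h1, one_pow], ?_⟩
    rw [Units.val_neg] at h2 ⊢
    linear_combination -h2

lemma T_card [Finite (ClassGroup R)] (hr : Module.finrank ℤ R = 6)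
    (hU : ∃ u : Rˣ, ∀ w ζ : Rˣ, IsOfFinOrder ζ → u * w ^ 3 ≠ ζ) : Nat.card C.T ≤ 3 := by
  by_cases hall : ∀ i j : ℕ, cl C.P ^ i * cl C.Λ ^ j = 1 → 3 ∣ i ∧ 3 ∣ j
  · exfalso
    obtain ⟨u, hu⟩ := hU
    obtain ⟨v, ζ, hζ, h1⟩ := C.unit_hilb hr hall u
    obtain ⟨w, ζ', hζ', h2⟩ := C.unit_hilb hr hall v
    set s : Rˣ →* Rˣ := Units.map (D.σ : R →* R) with hs
    have hsv : ∀ x : Rˣ, ((s x : Rˣ) : R) = D.σ (x : R) := fun x => rfl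
    have hn : (w * s w * s (s w)) ^ 6 = 1 := by
      ext
      rw [Units.val_pow_eq_pow_val, Units.val_mul, Units.val_mul, hsv, hsv, hsv, ← D.nE_spec]
      rcases nE_unit_pm hr C w with h | h
      · rw [h, map_one, one_pow, Units.val_one]
      · rw [h, map_neg, map_one, Units.val_one]; norm_num
    refine hu (s w) ((s ζ')⁻¹ * ζ * ζ' * (w * s w * s (s w))) ?_ ?_
    · rw [isOfFinOrder_iff_pow_eq_one]
      refine ⟨6, by norm_num, ?_⟩
      rw [mul_pow, hn, mul_pow, hζ', mul_pow, hζ, inv_pow, ← map_pow, hζ']; simp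
    · have : s ζ' * (u * s w ^ 3) = ζ * ζ' * (w * s w * s (s w)) := by
        ext
        simp only [Units.val_mul, Units.val_pow_eq_pow_val, hsv]
        have h3 := congrArg D.σ h2
        rw [map_mul, map_mul] at h3
        linear_combination -(u * D.σ w ^ 2) * h3 + D.σ w ^ 2 * D.σ (D.σ w) * h1 + ζ * D.σ w * D.σ (D.σ w) * h2
      rw [mul_assoc, mul_assoc, ← mul_assoc ζ, ← this, inv_mul_cancel_left]
  · push Not at hall
    obtain ⟨i, j, h1, h2⟩ := hall
    have hP : cl C.P ^ 3 = 1 := by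
      rw [← cl_pow C.P_ne, C.P3, cl_span (D.ιne C.πp.ne_zero)]
    have hΛ : cl C.Λ ^ 3 = 1 := by
      rw [← cl_pow C.Λ_ne, C.Λ3, cl_span (D.ιne lam_ne)]
    exact closure_card hP hΛ h1 (fun h => h2 h.1 h.2)

end units
end Ctx
end S11
end

section
namespace S11
open E
namespace Ctx
section hh

/-- nonzero cubes mod N -/
def Cu (N n : ℕ) : Prop := ∃ y : ZMod N, y ≠ 0 ∧ (n : ZMod N) = y ^ 3

variable {N : ℕ} [Fact N.Prime]

lemma Cu.mul {a b : ℕ} (ha : Cu N a) (hb : Cu N b) : Cu N (a * b) := by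
  obtain ⟨y, hy, h⟩ := ha
  obtain ⟨z, hz, h'⟩ := hb
  exact ⟨y * z, mul_ne_zero hy hz, by push_cast; rw [h, h']; ring⟩

lemma Cu.pow {a : ℕ} (ha : Cu N a) (n : ℕ) : Cu N (a ^ n) := by
  obtain ⟨y, hy, h⟩ := ha
  exact ⟨y ^ n, pow_ne_zero _ hy, by push_cast; rw [h]; ring⟩

lemma Cu.of_mul {a b : ℕ} (ha : Cu N a) (hab : Cu N (a * b)) : Cu N b := by
  obtain ⟨y, hy, h⟩ := ha
  obtain ⟨z, hz, h'⟩ := hab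
  refine ⟨z / y, div_ne_zero hz hy, ?_⟩
  push_cast at h'
  rw [h] at h'
  rw [div_pow, ← h']
  field_simp

lemma Cu.cube {a : ℕ} (h : (a : ZMod N) ≠ 0) : Cu N (a ^ 3) := ⟨a, h, by push_cast; rfl⟩

lemma Cu.of_sq {a : ℕ} (h : Cu N (a ^ 2)) : Cu N a := by
  have h0 : (a : ZMod N) ≠ 0 := by
    intro h0
    obtain ⟨y, hy, h⟩ := h
    push_cast at h
    rw [h0] at h
    exact pow_ne_zero 3 hy (by rw [← h]; ring)
  apply h.of_mul
  rw [← pow_succ]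
  exact Cu.cube h0

lemma ex_noncube (h3 : N % 3 = 1) : ∃ g : ZMod N, g ≠ 0 ∧ ∀ y, y ^ 3 ≠ g := by
  obtain ⟨g, hg⟩ := IsCyclic.exists_generator (α := (ZMod N)ˣ)
  refine ⟨g, g.ne_zero, fun y hy => ?_⟩
  have hp := (Fact.out : N.Prime)
  have hy0 : y ≠ 0 := by
    rintro rfl
    exact g.ne_zero (by rw [← hy]; simp)
  have ho : orderOf g = N - 1 := by
    rw [orderOf_eq_card_of_forall_mem_zpowers hg, Nat.card_eq_fintype_card, ZMod.card_units]
  obtain ⟨k, hk⟩ : ∃ k, N = 3 * k + 1 := ⟨N / 3, by omega⟩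
  have h1 : g ^ k = 1 := by
    ext
    rw [Units.val_pow_eq_pow_val, ← hy, ← pow_mul, Units.val_one]
    have := ZMod.pow_card_sub_one_eq_one hy0
    rwa [show N - 1 = 3 * k by omega] at this
  have h2 := orderOf_dvd_of_pow_eq_one h1
  have h4 : 0 < k := by have := hp.two_le; omega
  have := Nat.le_of_dvd h4 h2
  omega

lemma ex_q (h3 : N % 3 = 1) : ∃ q : ℕ, q.Prime ∧ N < q ∧ q % 3 = 2 ∧ (q : ZMod N) ≠ 0 ∧ ¬ Cu N q := by
  have hp := (Fact.out : N.Prime)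
  obtain ⟨g, hg0, hg⟩ := ex_noncube (N := N) h3
  have hc : Nat.Coprime 3 N := (Nat.coprime_primes Nat.prime_three hp).2 (by omega)
  obtain ⟨a, ha1, ha2⟩ := Nat.chineseRemainder hc 2 g.val
  have haN : (a : ZMod N) = g := by
    rw [(ZMod.natCast_eq_natCast_iff _ _ _).2 ha2, ZMod.natCast_zmod_val]
  have hco : IsUnit ((a : ℕ) : ZMod (3 * N)) := by
    rw [ZMod.isUnit_iff_coprime]
    apply Nat.Coprime.mul_right
    · apply Nat.Coprime.symm
      rw [Nat.prime_three.coprime_iff_not_dvd]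
      have : a % 3 = 2 := ha1
      omega
    · apply Nat.Coprime.symm
      rw [hp.coprime_iff_not_dvd, ← ZMod.natCast_eq_zero_iff, haN]
      exact hg0
  haveI : NeZero (3 * N) := ⟨by have := hp.pos; omega⟩
  obtain ⟨q, hqN, hq, hqa⟩ := Nat.forall_exists_prime_gt_and_eq_mod hco N
  rw [ZMod.natCast_eq_natCast_iff] at hqa
  have hqa1 : q ≡ a [MOD N] := hqa.of_mul_left 3
  have hqa2 : q ≡ a [MOD 3] := hqa.of_mul_right N
  have hqg : (q : ZMod N) = g := by rw [(ZMod.natCast_eq_natCast_iff _ _ _).2 hqa1, haN]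
  refine ⟨q, hq, hqN, hqa2.trans ha1, by rw [hqg]; exact hg0, ?_⟩
  rintro ⟨y, -, hy⟩
  exact hg y (by rw [← hy, hqg])

lemma ex_c {q : ℕ} (hq : q.Prime) (hNq : N < q) (h2 : q % 3 = 2) (hN0 : 0 < N) :
    ∃ (c : ℤ) (k : ℤ), (N : ℤ) - c ^ 3 = q * k ∧ IsCoprime (q : ℤ) k := by
  haveI : Fact q.Prime := ⟨hq⟩
  have hN : ((N : ℕ) : ZMod q) ≠ 0 := by
    rw [Ne, ZMod.natCast_eq_zero_iff]
    exact Nat.not_dvd_of_pos_of_lt hN0 hNq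
  obtain ⟨m, hm⟩ : ∃ m, q = 3 * m + 2 := ⟨q / 3, by omega⟩
  have h1 : (((N : ℤ) ^ (2 * m + 1) : ℤ) : ZMod q) ^ 3 = (N : ZMod q) := by
    push_cast
    have h := ZMod.pow_card_sub_one_eq_one hN
    rw [show q - 1 = 3 * m + 1 by omega] at h
    calc ((N : ZMod q) ^ (2 * m + 1)) ^ 3 = (N : ZMod q) ^ (3 * m + 1) * (N : ZMod q) ^ (3 * m + 1) * N := by ring
      _ = N := by rw [h]; ring
  generalize (N : ℤ) ^ (2 * m + 1) = c at h1
  have h3 : (q : ℤ) ∣ N - c ^ 3 := by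
    rw [← ZMod.intCast_zmod_eq_zero_iff_dvd]
    push_cast; rw [h1]; ring
  have hcq : ¬ (q : ℤ) ∣ c := by
    rw [← ZMod.intCast_zmod_eq_zero_iff_dvd]
    intro h
    rw [h] at h1
    exact hN (by rw [← h1]; ring)
  have hqp : Prime (q : ℤ) := Nat.prime_iff_prime_int.1 hq
  obtain ⟨k, hk⟩ := h3
  by_cases hqk : (q : ℤ) ∣ k
  · refine ⟨c + q, k - 3 * c ^ 2 - 3 * c * q - q ^ 2, by linear_combination hk, ?_⟩
    rw [hqp.coprime_iff_not_dvd]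
    intro h
    have h4 : (q : ℤ) ∣ 3 * c ^ 2 := by
      have : 3 * c ^ 2 = k - (k - 3 * c ^ 2 - 3 * c * q - q ^ 2) - q * (3 * c + q) := by ring
      rw [this]
      exact dvd_sub (dvd_sub hqk h) (dvd_mul_right _ _)
    rcases hqp.dvd_or_dvd h4 with h | h
    · have : q ∣ 3 := by exact_mod_cast h
      have := (Nat.prime_dvd_prime_iff_eq hq Nat.prime_three).1 this
      omega
    · exact hcq (hqp.dvd_of_dvd_pow h)
  · exact ⟨c, k, hk, hqp.coprime_iff_not_dvd.2 hqk⟩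

end hh

section sub
variable {N : ℕ} {R : Type*} [CommRing R] [IsDedekindDomain R] [Module.Free ℤ R] [Module.Finite ℤ R]
  [CharZero R] {D : Dat N R} (C : Ctx D)

lemma prin_cu (C : Ctx D) (hr : Module.finrank ℤ R = 6) {x : R}
    (h : ((Ideal.absNorm (Ideal.span {x}) : ℕ) : ZMod N) ≠ 0) : Cu N (Ideal.absNorm (Ideal.span {x})) := by
  haveI : Fact N.Prime := ⟨C.hp⟩
  rw [C.φ_aN hr x] at h
  exact ⟨_, fun h0 => h (by rw [h0]; ring), C.φ_aN hr x⟩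

lemma σN (D : Dat N R) (f : R ≃+* R) : Ideal.map f (Ideal.span {(N : R)}) = Ideal.span {(N : R)} := by
  rw [map_span1, map_natCast]

lemma aN_copr (hr : Module.finrank ℤ R = 6) {I : Ideal R} (hI : I ≠ 0)
    (h : I ⊔ Ideal.span {(N : R)} = ⊤) (C : Ctx D) : ((Ideal.absNorm I : ℕ) : ZMod N) ≠ 0 := by
  intro h0
  obtain ⟨ν, hν, h1⟩ := D.NI_prin hI
  have h2 := D.NI_copr (σN D D.σ) h
  rw [h1] at h2
  rw [aN_of_NI hr h1, ZMod.natCast_eq_zero_iff] at h0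
  have h3 : (N : R) ∣ D.ι ν * D.ι (star ν) := by
    rw [← map_mul, ι_norm]
    exact Nat.cast_dvd_cast h0
  have h4 : IsCoprime (D.ι ν) (N : R) := by
    rw [← Ideal.isCoprime_span_singleton_iff, Ideal.isCoprime_iff_sup_eq]; exact h2
  have h5 : (N : R) ∣ D.ι (star ν) := h4.symm.dvd_of_dvd_mul_left h3
  have h6 : (N : R) ∣ D.ι ν := by
    have := map_dvd D.τ h5
    rwa [map_natCast, D.τι, star_star] at this
  apply C.N_top
  rw [Ideal.span_singleton_eq_top]
  exact h4.isUnit_of_dvd' h6 dvd_rfl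

lemma wd (C : Ctx D) (hr : Module.finrank ℤ R = 6) {I J : Ideal R} (hI : I ≠ 0) (hJ : J ≠ 0) (h : cl I = cl J)
    (hc : Cu N (Ideal.absNorm I)) (hJ0 : ((Ideal.absNorm J : ℕ) : ZMod N) ≠ 0) :
    Cu N (Ideal.absNorm J) := by
  haveI : Fact N.Prime := ⟨C.hp⟩
  obtain ⟨K, hK, hKc, hKN⟩ := cl_copr (cl I)⁻¹ C.N_ne C.N_top
  have hK0 := aN_copr hr hK hKN C
  have key : ∀ M : Ideal R, M ≠ 0 → cl M = cl I → ((Ideal.absNorm M : ℕ) : ZMod N) ≠ 0 →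
      Cu N (Ideal.absNorm M * Ideal.absNorm K) := by
    intro M hM hMc hM0
    have : cl (M * K) = 1 := by rw [cl_mul hM hK, hKc, hMc, mul_inv_cancel]
    obtain ⟨x, hx⟩ := (cl_one_iff (mul_ne_zero hM hK)).1 this
    rw [← map_mul, hx]
    apply C.prin_cu hr
    rw [← hx, map_mul]
    push_cast
    exact mul_ne_zero hM0 hK0
  have hI0 : ((Ideal.absNorm I : ℕ) : ZMod N) ≠ 0 := by
    obtain ⟨y, hy, h⟩ := hc
    rw [h]; exact pow_ne_zero _ hy
  have h1 := hc.of_mul (key I hI rfl hI0)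
  have h2 := key J hJ h.symm hJ0
  rw [mul_comm] at h2
  exact h1.of_mul h2

variable [Finite (ClassGroup R)]

/-- classes whose norm is a cube mod N -/
noncomputable def H (C : Ctx D) : Subgroup (ClassGroup R) where
  carrier := {c | ∃ I : Ideal R, I ≠ 0 ∧ cl I = c ∧ Cu N (Ideal.absNorm I)}
  one_mem' := by
    haveI : Fact N.Prime := ⟨C.hp⟩
    exact ⟨1, one_ne_zero, cl_top, 1, one_ne_zero, by simp⟩
  mul_mem' := by
    haveI : Fact N.Prime := ⟨C.hp⟩
    rintro a b ⟨I, hI, rfl, h⟩ ⟨J, hJ, rfl, h'⟩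
    exact ⟨I * J, mul_ne_zero hI hJ, cl_mul hI hJ, by rw [map_mul]; exact h.mul h'⟩
  inv_mem' := by
    haveI : Fact N.Prime := ⟨C.hp⟩
    rintro a ⟨I, hI, rfl, h⟩
    refine ⟨I ^ (Nat.card (ClassGroup R) - 1), pow_ne_zero _ hI, ?_, by rw [map_pow]; exact h.pow _⟩
    rw [cl_pow hI, eq_inv_iff_mul_eq_one, ← pow_succ,
      Nat.sub_add_cancel (Nat.card_pos (α := ClassGroup R)), pow_card_eq_one']

lemma mem_H (c : ClassGroup R) : c ∈ C.H ↔
    ∃ I : Ideal R, I ≠ 0 ∧ cl I = c ∧ Cu N (Ideal.absNorm I) := Iff.rfl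

lemma D_H (hr : Module.finrank ℤ R = 6) (c : ClassGroup R) : c / clMap D.σ c ∈ C.H := by
  haveI : Fact N.Prime := ⟨C.hp⟩
  obtain ⟨I, hI, rfl, h⟩ := cl_copr c C.N_ne C.N_top
  have h1 := D.cl_norm (cl I)
  have h2 : cl I / clMap D.σ (cl I) = cl I * cl I * clMap D.σ (clMap D.σ (cl I)) := by
    rw [div_eq_iff_eq_mul]
    calc cl I = cl I * (cl I * clMap D.σ (cl I) * clMap D.σ (clMap D.σ (cl I))) := by rw [h1, mul_one]
      _ = _ := by simp only [mul_comm, mul_left_comm, mul_assoc]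
  rw [h2, clMap_cl _ hI, clMap_cl _ (map_ne _ hI), ← cl_mul hI hI,
    ← cl_mul (mul_ne_zero hI hI) (map_ne _ (map_ne _ hI))]
  refine ⟨_, mul_ne_zero (mul_ne_zero hI hI) (map_ne _ (map_ne _ hI)), rfl, ?_⟩
  rw [map_mul, map_mul, aN_map, aN_map]
  have := Cu.cube (aN_copr hr hI h C)
  rwa [pow_three'] at this

lemma P_H (hr : Module.finrank ℤ R = 6) : cl C.P ∈ C.H := by
  haveI : Fact N.Prime := ⟨C.hp⟩
  obtain ⟨J, hJ, hJc, h⟩ := cl_copr (cl C.P) C.N_ne C.N_top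
  refine ⟨J, hJ, hJc, Cu.of_sq ?_⟩
  have h1 : cl (J * Ideal.map D.τ J) = 1 := by
    rw [cl_mul hJ (map_ne _ hJ), ← clMap_cl _ hJ, hJc, clMap_cl _ C.P_ne,
      ← cl_mul C.P_ne (map_ne _ C.P_ne), C.PτP, cl_span C.θne]
  obtain ⟨x, hx⟩ := (cl_one_iff (mul_ne_zero hJ (map_ne _ hJ))).1 h1
  have h2 : Ideal.absNorm J ^ 2 = Ideal.absNorm (Ideal.span {x}) := by
    rw [← hx, map_mul, aN_map, sq]
  rw [h2]
  apply C.prin_cu hr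
  rw [← h2]
  push_cast
  exact pow_ne_zero _ (aN_copr hr hJ h C)

lemma three_ne (C : Ctx D) : ((3 : ℕ) : ZMod N) ≠ 0 := by
  rw [Ne, ZMod.natCast_eq_zero_iff]
  intro h
  have := (Nat.prime_dvd_prime_iff_eq C.hp Nat.prime_three).1 h
  have := C.hN
  omega

lemma T_H (hr : Module.finrank ℤ R = 6) : C.T ≤ C.H ↔ ∃ x : ZMod N, x ^ 3 = 3 := by
  haveI : Fact N.Prime := ⟨C.hp⟩
  have h3 := three_ne C
  rw [T, Subgroup.closure_le]
  constructor
  · intro h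
    obtain ⟨I, hI, h1, h2⟩ := h (Set.mem_insert_of_mem _ rfl)
    obtain ⟨y, -, hy⟩ := C.wd hr hI C.Λ_ne h1 h2 (by rw [C.aN_Λ hr]; exact h3)
    rw [C.aN_Λ hr] at hy
    exact ⟨y, by rw [← hy]; norm_num⟩
  · rintro ⟨y, hy⟩ c hc
    rcases hc with rfl | rfl
    · exact C.P_H hr
    · refine ⟨C.Λ, C.Λ_ne, rfl, y, ?_, ?_⟩
      · rintro rfl
        apply h3
        push_cast
        rw [← hy]; ring
      · rw [C.aN_Λ hr, hy]; norm_num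

lemma ex_I (C : Ctx D) {q : ℕ} (hq : q.Prime) {c k : ℤ} (h : (N : ℤ) - c ^ 3 = q * k)
    (hk : IsCoprime (q : ℤ) k) :
    ∃ I : Ideal R, I ≠ 0 ∧ D.NI I = Ideal.span {D.ι (q : E)} := by
  have hq0 : (q : R) ≠ 0 := by exact_mod_cast hq.ne_zero
  set x : R := D.θ - (c : R) with hx
  have hn : x * D.σ x * D.σ (D.σ x) = q * k := by
    have h1 : ((N : ℤ) : R) - (c : R) ^ 3 = q * k := by exact_mod_cast congrArg (Int.cast (R := R)) h
    push_cast at h1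
    have w := D.ωrel
    have t := D.θ3
    rw [← h1, ← t, hx]
    simp only [map_sub, map_mul, map_intCast, D.σθ, D.σι]
    generalize D.ι om = o at *
    have w3 : o ^ 3 = 1 := by linear_combination (o - 1) * w
    linear_combination (D.θ ^ 3 - c * D.θ ^ 2) * w3 + (c ^ 2 * D.θ - c * D.θ ^ 2) * w
  set I : Ideal R := Ideal.span {(q : R), x} with hI
  have hqI : (q : R) ∈ I := Ideal.subset_span (by simp)
  have hxI : x ∈ I := Ideal.subset_span (by simp)
  refine ⟨I, fun h0 => hq0 (by rw [h0] at hqI; simpa using hqI), ?_⟩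
  rw [map_natCast]
  have m1 : ∀ f : R ≃+* R, Ideal.map f I = Ideal.span {(q : R), f x} := by
    intro f
    rw [hI, Ideal.map_span, Set.image_pair]
    simp
  apply le_antisymm
  · have m2 : Ideal.map D.σ (Ideal.map D.σ I) = Ideal.span {(q : R), D.σ (D.σ x)} := by
      rw [m1, Ideal.map_span, Set.image_pair, map_natCast]
    rw [Dat.NI, m2, m1]
    apply triple_le
    intro x1 h1 x2 h2 x3 h3
    rw [hI] at h1
    obtain ⟨a1, b1, rfl⟩ := Ideal.mem_span_pair.1 h1
    obtain ⟨a2, b2, rfl⟩ := Ideal.mem_span_pair.1 h2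
    obtain ⟨a3, b3, rfl⟩ := Ideal.mem_span_pair.1 h3
    rw [Ideal.mem_span_singleton]
    refine ⟨a1 * (a2 * q + b2 * D.σ x) * (a3 * q + b3 * D.σ (D.σ x)) +
      b1 * x * a2 * (a3 * q + b3 * D.σ (D.σ x)) + b1 * x * b2 * D.σ x * a3 + b1 * b2 * b3 * k, ?_⟩
    linear_combination b1 * b2 * b3 * hn
  · rw [Ideal.span_singleton_le_iff_mem]
    have e1 : x * D.σ x * D.σ (D.σ x) ∈ D.NI I :=
      Ideal.mul_mem_mul (Ideal.mul_mem_mul hxI (Ideal.mem_map_of_mem _ hxI))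
        (Ideal.mem_map_of_mem _ (Ideal.mem_map_of_mem _ hxI))
    have e2 : (q : R) * q * q ∈ D.NI I := by
      have hs : (q : R) ∈ Ideal.map D.σ I := by
        have := Ideal.mem_map_of_mem D.σ hqI
        rwa [map_natCast] at this
      have hss : (q : R) ∈ Ideal.map D.σ (Ideal.map D.σ I) := by
        have := Ideal.mem_map_of_mem D.σ hs
        rwa [map_natCast] at this
      exact Ideal.mul_mem_mul (Ideal.mul_mem_mul hqI hs) hss
    rw [hn] at e1
    have hk2 : IsCoprime ((q : ℤ) ^ 2) k := hk.pow_left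
    obtain ⟨a, b, hab⟩ := hk2
    have hab' : (a : R) * q ^ 2 + b * k = 1 := by exact_mod_cast congrArg (Int.cast (R := R)) hab
    have : (q : R) = a * (q * q * q) + b * (q * k) := by linear_combination (-(q : R)) * hab'
    rw [this]
    exact Ideal.add_mem _ (Ideal.mul_mem_left _ _ e2) (Ideal.mul_mem_left _ _ e1)

lemma H_ne_top (hr : Module.finrank ℤ R = 6) : C.H ≠ ⊤ := by
  haveI : Fact N.Prime := ⟨C.hp⟩
  intro hT
  obtain ⟨q, hq, hNq, hq3, hq0, hqc⟩ := ex_q (N := N) (by have := C.hN; omega)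
  obtain ⟨c, k, h, hk⟩ := ex_c hq hNq hq3 C.hp.pos
  obtain ⟨I, hI, hNI⟩ := C.ex_I hq h hk
  have hn : Ideal.absNorm I = q ^ 2 := by
    rw [aN_of_NI hr hNI, norm_eq]
    simp [Int.natAbs_pow]
  have hm : cl I ∈ C.H := by rw [hT]; trivial
  obtain ⟨J, hJ, h1, h2⟩ := hm
  apply hqc
  apply Cu.of_sq
  rw [← hn]
  apply C.wd hr hJ hI h1 h2
  rw [hn]
  push_cast
  exact pow_ne_zero _ hq0

theorem final (C : Ctx D) (hr : Module.finrank ℤ R = 6)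
    (hU : ∃ u : Rˣ, ∀ w ζ : Rˣ, IsOfFinOrder ζ → u * w ^ 3 ≠ ζ) :
    ((∃ x : ZMod N, x ^ 3 = 3) → Nat.card {g : ClassGroup R // g ^ 3 = 1} = 9) ∧
    ((¬ ∃ x : ZMod N, x ^ 3 = 3) → Nat.card {g : ClassGroup R // g ^ 3 = 1} = 3) := by
  rw [← C.T_H hr]
  exact group_lemma (clMap D.σ) D.cl_norm C.H (C.H_ne_top hr) (C.D_H hr) C.T (C.fixed_T hr)
    (C.T_card hr hU) C.T_fixed

end sub
end Ctx
end S11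
end

section
namespace S11
section fld
open Polynomial
variable {N : ℕ} {L : Type*} [Field L] [NumberField L]

lemma not_cube_rat (hp : N.Prime) (b : ℚ) : b ^ 3 ≠ (N : ℚ) := by
  haveI : Fact N.Prime := ⟨hp⟩
  intro h
  have hb : b ≠ 0 := by
    rintro rfl
    have : (N : ℚ) = 0 := by rw [← h]; ring
    exact hp.ne_zero (by exact_mod_cast this)
  have h1 := congrArg (padicValRat N) h
  rw [padicValRat.pow, padicValRat.self hp.one_lt] at h1
  push_cast at h1
  omega

lemma irr_rat (hp : N.Prime) : Irreducible ((X : ℚ[X]) ^ 3 - C (N : ℚ)) :=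
  X_pow_sub_C_irreducible_of_prime Nat.prime_three (not_cube_rat hp)

lemma ex_theta (N : ℕ) [IsSplittingField ℚ L ((X : ℚ[X]) ^ 3 - C (N : ℚ))] : ∃ t : L, t ^ 3 = (N : L) := by
  refine ⟨rootOfSplitsXPowSubC (n := 3) (NeZero.pos 3) (N : ℚ) L, ?_⟩
  rw [rootOfSplitsXPowSubC_pow]; simp

lemma ex_omega (hp : N.Prime) [IsSplittingField ℚ L ((X : ℚ[X]) ^ 3 - C (N : ℚ))] :
    ∃ w : L, w ^ 2 + w + 1 = 0 := by
  have hsp := IsSplittingField.splits L ((X : ℚ[X]) ^ 3 - C (N : ℚ))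
  have hsep : ((X : ℚ[X]) ^ 3 - C (N : ℚ)).Separable := (irr_rat hp).separable
  have hc := card_rootSet_eq_natDegree hsep hsp
  rw [natDegree_X_pow_sub_C] at hc
  obtain ⟨a, b, hab⟩ := Fintype.exists_pair_of_one_lt_card (α := ((X : ℚ[X]) ^ 3 - C (N : ℚ)).rootSet L)
    (by rw [hc]; norm_num)
  have hr : ∀ c : ((X : ℚ[X]) ^ 3 - C (N : ℚ)).rootSet L, (c : L) ^ 3 = (N : L) := by
    intro c
    have := (mem_rootSet.1 c.2).2
    simp at this
    linear_combination this
  have ha := hr a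
  have hb := hr b
  have hab' : (a : L) - b ≠ 0 := sub_ne_zero.2 (fun h => hab (Subtype.ext h))
  have hb0 : (b : L) ≠ 0 := by
    intro h
    rw [h] at hb
    exact hp.ne_zero (by exact_mod_cast (show (N : L) = 0 by rw [← hb]; ring))
  refine ⟨a / b, ?_⟩
  have : ((a : L) - b) * (a ^ 2 + a * b + b ^ 2) = 0 := by linear_combination ha - hb
  have h2 := (mul_eq_zero.1 this).resolve_left hab'
  field_simp
  linear_combination h2

variable {t w : L}

lemma root_cases (ht : t ^ 3 = (N : L)) (hw : w ^ 2 + w + 1 = 0) {x : L} (hx : x ^ 3 = (N : L)) :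
    x = t ∨ x = w * t ∨ x = w ^ 2 * t := by
  have : (x - t) * ((x - w * t) * (x - w ^ 2 * t)) = 0 := by
    linear_combination hx - ht + ((w - 1) * (- t ^ 3)) * hw + (- x ^ 2 * t + x * t ^ 2 * w) * hw
  rcases mul_eq_zero.1 this with h | h
  · exact Or.inl (sub_eq_zero.1 h)
  rcases mul_eq_zero.1 h with h | h
  · exact Or.inr (Or.inl (sub_eq_zero.1 h))
  · exact Or.inr (Or.inr (sub_eq_zero.1 h))

lemma hom_ext (N : ℕ) [IsSplittingField ℚ L ((X : ℚ[X]) ^ 3 - C (N : ℚ))] (ht : t ^ 3 = (N : L))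
    (hw : w ^ 2 + w + 1 = 0) (f g : L →ₐ[ℚ] L) (h1 : f t = g t)
    (h2 : f w = g w) : f = g := by
  refine AlgHom.ext_of_adjoin_eq_top (IsSplittingField.adjoin_rootSet L ((X : ℚ[X]) ^ 3 - C (N : ℚ))) ?_
  intro x hx
  have h := (mem_rootSet.1 hx).2
  simp at h
  rcases root_cases ht hw (sub_eq_zero.1 h) with rfl | rfl | rfl
  · exact h1
  · rw [map_mul, map_mul, h1, h2]
  · rw [map_mul, map_mul, map_pow, map_pow, h1, h2]

open IntermediateField in
lemma mem_Qw (hw : w ^ 2 + w + 1 = 0) {x : L} (hx : x ∈ ℚ⟮w⟯) : ∃ a b : ℚ, x = a + b * w := by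
  have hx' : x ∈ Algebra.adjoin ℚ {w} := by
    have h := adjoin_simple_toSubalgebra_of_isAlgebraic (Algebra.IsAlgebraic.isAlgebraic (R := ℚ) w)
    rw [← h]; exact hx
  induction hx' using Algebra.adjoin_induction with
  | mem y hy => rw [Set.mem_singleton_iff] at hy; exact ⟨0, 1, by rw [hy]; push_cast; ring⟩
  | algebraMap r => exact ⟨r, 0, by simp⟩
  | add y z hy hz h1 h2 =>
    obtain ⟨a, b, rfl⟩ := h1 (by rw [← mem_toSubalgebra, adjoin_simple_toSubalgebra_of_isAlgebraic (Algebra.IsAlgebraic.isAlgebraic (R := ℚ) w)]; exact hy)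
    obtain ⟨c, d, rfl⟩ := h2 (by rw [← mem_toSubalgebra, adjoin_simple_toSubalgebra_of_isAlgebraic (Algebra.IsAlgebraic.isAlgebraic (R := ℚ) w)]; exact hz)
    exact ⟨a + c, b + d, by push_cast; ring⟩
  | mul y z hy hz h1 h2 =>
    obtain ⟨a, b, rfl⟩ := h1 (by rw [← mem_toSubalgebra, adjoin_simple_toSubalgebra_of_isAlgebraic (Algebra.IsAlgebraic.isAlgebraic (R := ℚ) w)]; exact hy)
    obtain ⟨c, d, rfl⟩ := h2 (by rw [← mem_toSubalgebra, adjoin_simple_toSubalgebra_of_isAlgebraic (Algebra.IsAlgebraic.isAlgebraic (R := ℚ) w)]; exact hz)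
    exact ⟨a * c - b * d, a * d + b * c - b * d, by push_cast; linear_combination (b * d : L) * hw⟩

lemma w_prim (hw : w ^ 2 + w + 1 = 0) : IsPrimitiveRoot w 3 := by
  have h1 : w ≠ 1 := by
    rintro rfl
    norm_num at hw
  exact IsPrimitiveRoot.of_map_of_injective (f := RingHom.id L) (by
    have := orderOf_eq_prime (x := w) (p := 3) (by linear_combination (w - 1) * hw) h1
    rw [← this]
    exact IsPrimitiveRoot.orderOf w) Function.injective_id

open IntermediateField in
lemma finrank_w (hw : w ^ 2 + w + 1 = 0) : Module.finrank ℚ ℚ⟮w⟯ = 2 := by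
  rw [adjoin.finrank (Algebra.IsIntegral.isIntegral w), ← cyclotomic_eq_minpoly_rat (w_prim hw) (by norm_num),
    natDegree_cyclotomic]
  rfl

open IntermediateField in
lemma finrank_t (hp : N.Prime) (ht : t ^ 3 = (N : L)) : Module.finrank ℚ ℚ⟮t⟯ = 3 := by
  rw [adjoin.finrank (Algebra.IsIntegral.isIntegral t), ← minpoly.eq_of_irreducible_of_monic (irr_rat hp) (by simp [ht])
    (monic_X_pow_sub_C _ (by norm_num)), natDegree_X_pow_sub_C]

open IntermediateField in
lemma irr_w (hp : N.Prime) (hw : w ^ 2 + w + 1 = 0) :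
    Irreducible ((X : ℚ⟮w⟯[X]) ^ 3 - C (N : ℚ⟮w⟯)) := by
  apply X_pow_sub_C_irreducible_of_prime Nat.prime_three
  intro b hb
  have h1 := minpoly.natDegree_le (A := ℚ) b
  rw [finrank_w hw, ← minpoly.eq_of_irreducible_of_monic (irr_rat hp) (by simp [hb])
    (monic_X_pow_sub_C _ (by norm_num)), natDegree_X_pow_sub_C] at h1
  omega

open IntermediateField in
lemma split_w (N : ℕ) [IsSplittingField ℚ L ((X : ℚ[X]) ^ 3 - C (N : ℚ))] (w : L) :
    IsSplittingField ℚ⟮w⟯ L ((X : ℚ⟮w⟯[X]) ^ 3 - C (N : ℚ⟮w⟯)) := by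
  have := IsSplittingField.map (F := ℚ) (K := ℚ⟮w⟯) (L := L) ((X : ℚ[X]) ^ 3 - C (N : ℚ))
  simpa using this

open IntermediateField in
lemma ex_sigma (hp : N.Prime) [IsSplittingField ℚ L ((X : ℚ[X]) ^ 3 - C (N : ℚ))] (ht : t ^ 3 = (N : L)) (hw : w ^ 2 + w + 1 = 0) :
    Module.finrank ℚ L = 6 ∧ ∃ s : L ≃ₐ[ℚ] L, s t = w * t ∧ s w = w ∧
      ∀ x, s x = x → ∃ a b : ℚ, x = a + b * w := by
  haveI := split_w (L := L) N w
  have hH := irr_w hp hw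
  let w' : ℚ⟮w⟯ := ⟨w, mem_adjoin_simple_self ℚ w⟩
  have hw' : IsPrimitiveRoot w' 3 := by
    apply IsPrimitiveRoot.of_map_of_injective (f := algebraMap ℚ⟮w⟯ L) _ (algebraMap ℚ⟮w⟯ L).injective
    exact w_prim hw
  have hne : (primitiveRoots 3 ℚ⟮w⟯).Nonempty := ⟨w', (mem_primitiveRoots (by norm_num)).2 hw'⟩
  have hf := finrank_of_isSplittingField_X_pow_sub_C hne hH L
  haveI hG := isGalois_of_isSplittingField_X_pow_sub_C hne hH L
  refine ⟨by rw [← Module.finrank_mul_finrank ℚ ℚ⟮w⟯ L, hf, finrank_w hw], ?_⟩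
  let s := (autEquivZmod hH L hw').symm (Multiplicative.ofAdd ((1 : ℕ) : ZMod 3))
  have hst : s t = w * t := by
    have := autEquivZmod_symm_apply_natCast hH L (α := t) (by simp [ht]) hw' 1
    rw [pow_one] at this
    exact this
  have hsw : s w = w := s.commutes w'
  refine ⟨s.restrictScalars ℚ, hst, hsw, fun x hx => mem_Qw hw ?_⟩
  have hz : Subgroup.zpowers s = ⊤ := by
    haveI : Fact (Nat.Prime 3) := ⟨Nat.prime_three⟩
    apply zpowers_eq_top_of_prime_card (p := 3)
    · rw [IsGalois.card_aut_eq_finrank, hf]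
    · intro h
      rw [h, AlgEquiv.one_apply] at hst
      have ht0 : t ≠ 0 := by
        rintro rfl
        exact hp.ne_zero (by exact_mod_cast (show (N : L) = 0 by rw [← ht]; ring))
      have : w = 1 := by
        apply mul_right_cancel₀ ht0
        rw [← hst, one_mul]
      rw [this] at hw
      norm_num at hw
  have hfix : ∀ f : L ≃ₐ[ℚ⟮w⟯] L, f x = x := by
    intro f
    have hm : f ∈ Subgroup.zpowers s := by rw [hz]; trivial
    have : Subgroup.zpowers s ≤ MulAction.stabilizer (L ≃ₐ[ℚ⟮w⟯] L) x := by
      rw [Subgroup.zpowers_le, MulAction.mem_stabilizer_iff]; exact hx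
    exact MulAction.mem_stabilizer_iff.1 (this hm)
  obtain ⟨y, hy⟩ := (IsGalois.mem_range_algebraMap_iff_fixed x).2 hfix
  rw [← hy]; exact y.2

open IntermediateField in
lemma ex_tau (hp : N.Prime) [IsSplittingField ℚ L ((X : ℚ[X]) ^ 3 - C (N : ℚ))] (ht : t ^ 3 = (N : L)) (hw : w ^ 2 + w + 1 = 0) :
    ∃ s : L ≃ₐ[ℚ] L, s t = t ∧ s w = -1 - w := by
  haveI : IsGalois ℚ L := IsGalois.of_separable_splitting_field (irr_rat hp).separable
  have h1 := Module.finrank_mul_finrank ℚ ℚ⟮t⟯ L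
  rw [(ex_sigma hp ht hw).1, finrank_t hp ht] at h1
  have h2 : Module.finrank ℚ⟮t⟯ L = 2 := by omega
  have h3 : Nat.card (L ≃ₐ[ℚ⟮t⟯] L) = 2 := by rw [IsGalois.card_aut_eq_finrank, h2]
  haveI : Nontrivial (L ≃ₐ[ℚ⟮t⟯] L) := Finite.one_lt_card_iff_nontrivial.1 (by rw [h3]; norm_num)
  obtain ⟨s, hs1⟩ := exists_ne (1 : L ≃ₐ[ℚ⟮t⟯] L)
  have hst : s t = t := s.commutes ⟨t, mem_adjoin_simple_self ℚ t⟩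
  refine ⟨s.restrictScalars ℚ, hst, ?_⟩
  have hsw : s w ≠ w := by
    intro h
    apply hs1
    have := hom_ext N ht hw (s.restrictScalars ℚ : L ≃ₐ[ℚ] L).toAlgHom (AlgHom.id ℚ L) hst h
    ext x
    exact DFunLike.congr_fun this x
  have h4 : (s w) ^ 2 + s w + 1 = 0 := by
    have := congrArg s hw
    simpa using this
  have h5 : (s w - w) * (s w + 1 + w) = 0 := by linear_combination h4 - hw
  have h6 := (mul_eq_zero.1 h5).resolve_left (sub_ne_zero.2 hsw)
  change s w = -1 - w
  linear_combination h6

end fld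
end S11
end

section
namespace S11
open E
section inst
open Polynomial NumberField
variable {N : ℕ} {L : Type*} [Field L] [NumberField L]

lemma int_of_rat {q : ℚ} (h : IsIntegral ℤ (q : L)) : ∃ m : ℤ, q = m := by
  have h1 : IsIntegral ℤ (algebraMap ℚ L q) := by simpa using h
  have h2 : IsIntegral ℤ q := (isIntegral_algebraMap_iff (algebraMap ℚ L).injective).1 h1
  obtain ⟨m, hm⟩ := IsIntegrallyClosed.isIntegral_iff.1 h2
  exact ⟨m, by rw [← hm]; simp⟩

lemma int_ab {a b : ℚ} {w : L} (hw : w ^ 2 + w + 1 = 0) (τ : L ≃ₐ[ℚ] L) (hτ : τ w = -1 - w)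
    (h : IsIntegral ℤ ((a : L) + b * w)) : ∃ m n : ℤ, a = m ∧ b = n := by
  have hwi : IsIntegral ℤ w := by
    refine IsIntegral.of_pow (n := 3) (by norm_num) ?_
    rw [show w ^ 3 = 1 by linear_combination (w - 1) * hw]
    exact isIntegral_one
  have hc : ∀ x : L, IsIntegral ℤ x → IsIntegral ℤ (τ x) := fun x hx =>
    hx.map (τ.toAlgHom.restrictScalars ℤ)
  have e1 : τ (a + b * w) = a + b * (-1 - w) := by
    rw [map_add, map_mul, hτ, map_ratCast, map_ratCast]
  have e2 : τ w * τ (a + b * w) = (-1 - w) * (a + b * (-1 - w)) := by rw [e1, hτ]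
  have i1 := h.add (hc _ h)
  have i2 := h.mul (hc _ h)
  have i3 := (hwi.mul h).add ((hc _ hwi).mul (hc _ h))
  rw [e1] at i1 i2
  rw [e2] at i3
  rw [show (a : L) + b * w + (a + b * (-1 - w)) = ((2 * a - b : ℚ) : L) by push_cast; ring] at i1
  rw [show ((a : L) + b * w) * (a + b * (-1 - w)) = ((a ^ 2 - a * b + b ^ 2 : ℚ) : L) by
    push_cast; linear_combination (-(b : L) ^ 2) * hw] at i2
  rw [show w * ((a : L) + b * w) + (-1 - w) * (a + b * (-1 - w)) = ((- a - b : ℚ) : L) by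
    push_cast; linear_combination (2 * (b : L)) * hw] at i3
  obtain ⟨m, hm⟩ := int_of_rat i1
  obtain ⟨k, hk⟩ := int_of_rat i2
  obtain ⟨n, hn⟩ := int_of_rat i3
  have ha : a = (m - n) / 3 := by linarith
  have hb : b = (-2 * n - m) / 3 := by linarith
  have hq : (((m - n) ^ 2 + 3 * (m - n) * n + 3 * n ^ 2 : ℤ) : ℚ) = (3 * k : ℤ) := by
    push_cast
    rw [← hk, ha, hb]; ring
  have hq' : (m - n) ^ 2 + 3 * (m - n) * n + 3 * n ^ 2 = 3 * k := by exact_mod_cast hq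
  have h3 : (3 : ℤ) ∣ (m - n) ^ 2 := ⟨k - (m - n) * n - n ^ 2, by linear_combination hq'⟩
  obtain ⟨r, hr⟩ := Int.prime_three.dvd_of_dvd_pow h3
  have hr' : (m : ℚ) - n = 3 * r := by exact_mod_cast congrArg (Int.cast (R := ℚ)) hr
  refine ⟨r, -r - n, ?_, ?_⟩
  · rw [ha, hr']; ring
  · rw [hb]; push_cast; linear_combination (-1 / 3 : ℚ) * hr'

lemma w_integral {w : L} (hw : w ^ 2 + w + 1 = 0) : IsIntegral ℤ w := by
  refine IsIntegral.of_pow (n := 3) (by norm_num) ?_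
  rw [show w ^ 3 = 1 by linear_combination (w - 1) * hw]
  exact isIntegral_one

/-- the embedding of the Eisenstein integers -/
noncomputable def iotaE (W : 𝓞 L) (hW : W * W = (-1 : ℤ) • 1 + (-1 : ℤ) • W) : E →+* 𝓞 L :=
  (QuadraticAlgebra.lift ⟨W, hW⟩ : E →ₐ[ℤ] 𝓞 L).toRingHom

lemma iotaE_apply (W : 𝓞 L) (hW : W * W = (-1 : ℤ) • 1 + (-1 : ℤ) • W) (a : E) :
    iotaE W hW a = (a.re : 𝓞 L) + a.im * W := by
  simp [iotaE, QuadraticAlgebra.lift]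

lemma ex_dat (hp : N.Prime) [IsSplittingField ℚ L ((X : ℚ[X]) ^ 3 - C (N : ℚ))] :
    Module.finrank ℚ L = 6 ∧ Nonempty (Dat N (𝓞 L)) := by
  obtain ⟨t, ht⟩ := ex_theta (L := L) N
  obtain ⟨w, hw⟩ := ex_omega (L := L) hp
  obtain ⟨hr, s, hst, hsw, hfix⟩ := ex_sigma hp ht hw
  obtain ⟨r, hrt, hrw⟩ := ex_tau hp ht hw
  refine ⟨hr, ⟨?_⟩⟩
  have hti : IsIntegral ℤ t := by
    refine IsIntegral.of_pow (n := 3) (by norm_num) ?_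
    rw [ht]
    simpa using isIntegral_algebraMap (R := ℤ) (A := L) (x := (N : ℤ))
  let W : 𝓞 L := ⟨w, w_integral hw⟩
  let T : 𝓞 L := ⟨t, hti⟩
  have hWc : (W : L) = w := rfl
  have hTc : (T : L) = t := rfl
  have hW : W * W = (-1 : ℤ) • 1 + (-1 : ℤ) • W := by
    apply RingOfIntegers.ext
    simp only [map_mul, map_add, map_neg, neg_smul, one_smul, map_one, hWc]
    linear_combination hw
  have hsq : ∀ x, s (s (s x)) = x := by
    have := hom_ext N ht hw ((s.trans s).trans s : L ≃ₐ[ℚ] L).toAlgHom (AlgHom.id ℚ L) ?_ ?_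
    · intro x
      exact DFunLike.congr_fun this x
    · change s (s (s t)) = t
      simp only [hst, hsw, map_mul]
      linear_combination (t * (w - 1)) * hw
    · change s (s (s w)) = w
      rw [hsw, hsw, hsw]
  have hrs : ∀ x, r (s x) = s (s (r x)) := by
    have := hom_ext N ht hw (s.trans r : L ≃ₐ[ℚ] L).toAlgHom ((r.trans s).trans s : L ≃ₐ[ℚ] L).toAlgHom ?_ ?_
    · intro x
      exact DFunLike.congr_fun this x
    · change r (s t) = s (s (r t))
      simp only [hst, hsw, hrt, hrw, map_mul]
      linear_combination (- t) * hw
    · change r (s w) = s (s (r w))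
      simp only [hsw, hrw, map_sub, map_neg, map_one]
  have hio : ∀ a : E, ((iotaE W hW a : 𝓞 L) : L) = a.re + a.im * w := by
    intro a
    rw [iotaE_apply]
    simp [hWc]
  have hsE : ∀ x : 𝓞 L, ((RingOfIntegers.mapRingEquiv (s : L ≃+* L) x : 𝓞 L) : L) = s x := fun x => rfl
  have hrE : ∀ x : 𝓞 L, ((RingOfIntegers.mapRingEquiv (r : L ≃+* L) x : 𝓞 L) : L) = r x := fun x => rfl
  exact
  { σ := RingOfIntegers.mapRingEquiv (s : L ≃+* L)
    τ := RingOfIntegers.mapRingEquiv (r : L ≃+* L)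
    ι := iotaE W hW
    θ := T
    ι_inj := by
      rw [injective_iff_map_eq_zero]
      intro a ha
      have h1 := hio a
      rw [ha, show ((0 : 𝓞 L) : L) = 0 from rfl] at h1
      have h2 := congrArg r h1
      simp only [map_zero, map_add, map_mul, map_intCast, hrw] at h2
      have h3 : (a.re ^ 2 - a.re * a.im + a.im ^ 2 : ℤ) = 0 := by
        have : ((a.re ^ 2 - a.re * a.im + a.im ^ 2 : ℤ) : L) = 0 := by
          push_cast
          linear_combination (-((a.re : L) + a.im * (-1 - w))) * h1 + (a.im : L) ^ 2 * hw
        exact_mod_cast this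
      have h4 : a.im ^ 2 = 0 := by nlinarith [sq_nonneg (2 * a.re - a.im), sq_nonneg a.im]
      have h5 : a.re ^ 2 = 0 := by nlinarith [sq_nonneg (2 * a.im - a.re), sq_nonneg a.re]
      ext
      · simpa using h5
      · simpa using h4
    θ3 := by
      apply RingOfIntegers.ext
      simp [hTc, ht]
    σθ := by
      apply RingOfIntegers.ext
      rw [hsE, show ((iotaE W hW om * T : 𝓞 L) : L) = (iotaE W hW om : 𝓞 L) * (T : L) from rfl, hio, hTc, hst]
      simp [om]
    σι := by
      intro a
      apply RingOfIntegers.ext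
      rw [hsE, hio, map_add, map_mul, hsw, map_intCast, map_intCast]
    τθ := by
      apply RingOfIntegers.ext
      rw [hrE, hTc, hrt]
    τι := by
      intro a
      apply RingOfIntegers.ext
      rw [hrE, hio, hio, map_add, map_mul, hrw, map_intCast, map_intCast, QuadraticAlgebra.re_star,
        QuadraticAlgebra.im_star]
      push_cast
      ring
    σ3 := by
      intro x
      apply RingOfIntegers.ext
      rw [hsE, hsE, hsE, hsq]
    τσ := by
      intro x
      apply RingOfIntegers.ext
      rw [hrE, hsE, hsE, hsE, hrE, hrs]
    fix := by
      intro x hx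
      have h1 : s (x : L) = x := by rw [← hsE, hx]
      obtain ⟨a, b, hab⟩ := hfix _ h1
      have hi : IsIntegral ℤ (x : L) := RingOfIntegers.isIntegral_coe x
      rw [hab] at hi
      obtain ⟨m, n, rfl, rfl⟩ := int_ab hw r hrw hi
      refine ⟨⟨m, n⟩, ?_⟩
      apply RingOfIntegers.ext
      rw [hio, hab]
      push_cast
      ring }

lemma basis_ne {M κ : Type*} [AddCommGroup M] [Module ℤ M] (B : Module.Basis κ ℤ M) (i : κ) (x : M) :
    B i + 3 • x ≠ 0 := by
  intro h4
  have h5 := DFunLike.congr_fun (congrArg B.repr h4) i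
  rw [map_add, map_nsmul, map_zero, Module.Basis.repr_self] at h5
  simp at h5
  omega

lemma ex_unit (h6 : Module.finrank ℚ L = 6) :
    ∃ u : (𝓞 L)ˣ, ∀ w ζ : (𝓞 L)ˣ, IsOfFinOrder ζ → u * w ^ 3 ≠ ζ := by
  have h1 := InfinitePlace.card_add_two_mul_card_eq_rank L
  have h2 := InfinitePlace.card_eq_nrRealPlaces_add_nrComplexPlaces L
  rw [h6] at h1
  have h3 : 0 < Units.rank L := by
    rw [Units.rank, h2]; omega
  let B := Units.basisModTorsion L
  let i : Fin (Units.rank L) := ⟨0, h3⟩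
  refine ⟨Units.fundSystem L i, fun w ζ hζ h => ?_⟩
  have hz : ((ζ : (𝓞 L)ˣ) : (𝓞 L)ˣ ⧸ Units.torsion L) = 1 := by
    rw [QuotientGroup.eq_one_iff]
    exact hζ
  have h4 : Additive.ofMul (((Units.fundSystem L i * w ^ 3 : (𝓞 L)ˣ)) : (𝓞 L)ˣ ⧸ Units.torsion L) = 0 := by
    rw [h, hz]; rfl
  rw [QuotientGroup.mk_mul, QuotientGroup.mk_pow, ofMul_mul, ofMul_pow, Units.fundSystem_mk] at h4
  exact basis_ne (Units.basisModTorsion L) i _ h4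

end inst

section fin
open Polynomial NumberField
theorem card_L {N : ℕ} {L : Type*} [Field L] [NumberField L] (hp : N.Prime)
    (hN : N % 9 = 4 ∨ N % 9 = 7) [IsSplittingField ℚ L ((X : ℚ[X]) ^ 3 - C (N : ℚ))] :
    ((∃ x : ZMod N, x ^ 3 = 3) → Nat.card {g : ClassGroup (𝓞 L) // g ^ 3 = 1} = 9) ∧
    ((¬ ∃ x : ZMod N, x ^ 3 = 3) → Nat.card {g : ClassGroup (𝓞 L) // g ^ 3 = 1} = 3) := by
  obtain ⟨hr, ⟨D⟩⟩ := ex_dat (L := L) hp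
  obtain ⟨C⟩ := Ctx.exists_ctx D hp hN
  exact C.final (by rw [RingOfIntegers.rank, hr]) (ex_unit hr)
end fin
end S11
end

namespace S11
open E

lemma rk3_eq {N : ℕ} (hp : N.Prime) (hN : N % 9 = 4 ∨ N % 9 = 7) :
    ((∃ x : ZMod N, x ^ 3 = 3) → rk3 N = 2) ∧ ((¬ ∃ x : ZMod N, x ^ 3 = 3) → rk3 N = 1) := by
  have h0 : IsSplittingField ℚ (Lfield N) ((X : ℚ[X]) ^ 3 - C (N : ℚ)) :=
    IsSplittingField.splittingField _
  have e : (inferInstance : Algebra ℚ (Lfield N)) = DivisionRing.toRatAlgebra :=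
    Subsingleton.elim _ _
  have hs : @IsSplittingField ℚ (Lfield N) _ _ DivisionRing.toRatAlgebra
      ((X : ℚ[X]) ^ 3 - C (N : ℚ)) := by
    rw [← e]
    exact h0
  obtain ⟨h1, h2⟩ := @card_L N (Lfield N) _ _ hp hN hs
  constructor
  · intro h
    rw [rk3, pRank, h1 h, show 9 = 3 ^ 2 by norm_num, Nat.prime_three.factorization_pow]
    simp
  · intro h
    rw [rk3, pRank, h2 h, Nat.prime_three.factorization]
    simp

lemma rk3_final : Tendsto (fun x : ℕ =>
        (({N | N ≤ x ∧ N.Prime ∧ (N % 9 = 4 ∨ N % 9 = 7) ∧ rk3 N = 2}.ncard : ℝ) /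
          ({N | N ≤ x ∧ N.Prime ∧ (N % 9 = 4 ∨ N % 9 = 7)}.ncard : ℝ)))
      atTop (nhds (1 / 3)) ∧
    Tendsto (fun x : ℕ =>
        (({N | N ≤ x ∧ N.Prime ∧ (N % 9 = 4 ∨ N % 9 = 7) ∧ rk3 N = 1}.ncard : ℝ) /
          ({N | N ≤ x ∧ N.Prime ∧ (N % 9 = 4 ∨ N % 9 = 7)}.ncard : ℝ)))
      atTop (nhds (2 / 3)) := by
  have key := ratio_final {N | N ∈ S1 ∧ rk3 N = 2} (fun N h => h.1) (by
    intro β hβ hS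
    haveI : Fact (nn β).Prime := ⟨hβ⟩
    rw [← three_cube (p := nn β) rfl (nn_mod β)]
    obtain ⟨h1, h2⟩ := rk3_eq hβ hS.2
    constructor
    · intro h
      by_contra hc
      have := h2 hc
      have := h.2
      omega
    · intro h
      exact ⟨hS, h1 h⟩)
  have e0 : ∀ x : ℕ, {N | N ≤ x ∧ N ∈ S1} = {N | N ≤ x ∧ N.Prime ∧ (N % 9 = 4 ∨ N % 9 = 7)} := fun x => rfl
  have e1 : ∀ x : ℕ, {N | N ≤ x ∧ N ∈ {N | N ∈ S1 ∧ rk3 N = 2}} =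
      {N | N ≤ x ∧ N.Prime ∧ (N % 9 = 4 ∨ N % 9 = 7) ∧ rk3 N = 2} := by
    intro x
    ext N
    simp only [Set.mem_setOf_eq, S1]
    tauto
  have e2 : ∀ x : ℕ, {N | N ≤ x ∧ N ∈ S1 \ {N | N ∈ S1 ∧ rk3 N = 2}} =
      {N | N ≤ x ∧ N.Prime ∧ (N % 9 = 4 ∨ N % 9 = 7) ∧ rk3 N = 1} := by
    intro x
    ext N
    simp only [Set.mem_setOf_eq, S1, Set.mem_diff]
    constructor
    · rintro ⟨hx, ⟨hp, hN⟩, h⟩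
      refine ⟨hx, hp, hN, ?_⟩
      obtain ⟨h1, h2⟩ := rk3_eq hp hN
      exact h2 fun hc => h ⟨⟨hp, hN⟩, h1 hc⟩
    · rintro ⟨hx, hp, hN, h⟩
      exact ⟨hx, ⟨hp, hN⟩, fun hc => by have := hc.2; omega⟩
  simp only [e0, e1, e2] at key
  exact key

end S11


/-- As `x → ∞`, among primes `N ≡ 4, 7 (mod 9)` the proportion with
`rk_3(Cl(ℚ(ζ_3, N^{1/3}))) = 2` tends to `1/3`, and the proportion with
`rk_3(Cl(ℚ(ζ_3, N^{1/3}))) = 1` tends to `2/3`. -/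
theorem stmt11 :
    Tendsto (fun x : ℕ =>
        (({N | N ≤ x ∧ N.Prime ∧ (N % 9 = 4 ∨ N % 9 = 7) ∧ rk3 N = 2}.ncard : ℝ) /
          ({N | N ≤ x ∧ N.Prime ∧ (N % 9 = 4 ∨ N % 9 = 7)}.ncard : ℝ)))
      atTop (nhds (1 / 3)) ∧
    Tendsto (fun x : ℕ =>
        (({N | N ≤ x ∧ N.Prime ∧ (N % 9 = 4 ∨ N % 9 = 7) ∧ rk3 N = 1}.ncard : ℝ) /
          ({N | N ≤ x ∧ N.Prime ∧ (N % 9 = 4 ∨ N % 9 = 7)}.ncard : ℝ)))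
      atTop (nhds (2 / 3)) := by
  exact S11.rk3_final
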